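/- Let k be a number field, n > 1 an integer, and Γ a finitely generated subgroup of k*. Then all but finitely many solutions (u_0, …, u_n) ∈ Γ^{n+1} of the equation u_0 + u_1 + ⋯ + u_n = 1 satisfy ∑_{i∈I} u_i = 0 for some subset I ⊆ {0, …, n} with at least two elements and I ≠ {0,…,n}. -/

import Mathlib

/-- From `r` linearly independent vectors one extracts a nonsingular `r × r` minor. -/
theorem exists_minor_ne_zero {K ι : Type*} [Field K] {r : ℕ} (v : Fin r → ι → K)
    (hv : LinearIndependent K v) : ∃ a : Fin r → ι, (Matrix.of fun s t => v s (a t)).det ≠ 0 := by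
  classical
  let c : ι → (Fin r → K) := fun i s => v s i
  have hspan : Submodule.span K (Set.range c) = ⊤ := by
    by_contra h
    obtain ⟨f, hf0, hf⟩ := Submodule.exists_le_ker_of_lt_top _ (lt_top_iff_ne_top.mpr h)
    apply hf0
    have h1 : ∑ s, f (Pi.single s 1) • v s = 0 := by
      ext i
      have h2 : f (c i) = 0 := hf (Submodule.subset_span ⟨i, rfl⟩)
      have h3 : c i = ∑ s, v s i • (Pi.single s (1 : K) : Fin r → K) := by
        ext t
        simp [c, Finset.sum_apply, Pi.single_apply]
      rw [h3, map_sum] at h2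
      simp only [map_smul, smul_eq_mul] at h2
      simp only [Finset.sum_apply, Pi.smul_apply, smul_eq_mul, Pi.zero_apply]
      rw [← h2]
      exact Finset.sum_congr rfl fun s _ => mul_comm _ _
    have h4 := Fintype.linearIndependent_iff.mp hv _ h1
    refine LinearMap.pi_ext' fun s => ?_
    ext
    simpa using h4 s
  obtain ⟨κ, a, -, hs, hli⟩ := exists_linearIndependent' K c
  rw [hspan] at hs
  let b := Module.Basis.mk hli hs.ge
  have : Finite κ := Module.Finite.finite_basis b
  have : Fintype κ := Fintype.ofFinite κ
  have hcard : Fintype.card κ = r := by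
    rw [← Module.finrank_eq_card_basis b]; simp
  let e : Fin r ≃ κ := (finCongr hcard.symm).trans (Fintype.equivFin κ).symm
  refine ⟨fun t => a (e t), ?_⟩
  have hli2 : LinearIndependent K (Matrix.of fun t s => v s (a (e t))).row :=
    hli.comp e e.injective
  have := (Matrix.linearIndependent_rows_iff_isUnit.mp hli2)
  rw [Matrix.isUnit_iff_isUnit_det, ← Matrix.det_transpose] at this
  exact this.ne_zero

namespace MvPolynomial

variable {σ R S : Type*} [CommRing R] [CommRing S]

/-- The algebra homomorphism `P(x) ↦ P(x + y)`, where `x` are the inner variables. -/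
noncomputable def taylorHom : MvPolynomial σ R →ₐ[R] MvPolynomial σ (MvPolynomial σ R) :=
  aeval fun l => C (X l) + X l

/-- The Hasse derivative of multi-order `i`. -/
noncomputable def hasse (i : σ →₀ ℕ) : MvPolynomial σ R →ₗ[R] MvPolynomial σ R :=
  ((lcoeff (MvPolynomial σ R) i).restrictScalars R).comp taylorHom.toLinearMap

theorem hasse_apply (i : σ →₀ ℕ) (p : MvPolynomial σ R) :
    hasse i p = coeff i (taylorHom p) := rfl

/-- The Hasse derivatives commute with ring homomorphisms that move every variable by a
constant. -/
theorem hasse_eval₂Hom (φ : R →+* S) (α : σ → S) (i : σ →₀ ℕ) (p : MvPolynomial σ R) :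
    hasse i (eval₂Hom (C.comp φ) (fun l => X l + C (α l)) p) =
      eval₂Hom (C.comp φ) (fun l => X l + C (α l)) (hasse i p) := by
  rw [hasse_apply, hasse_apply, ← coeff_map]
  congr 1
  set τ : MvPolynomial σ R →+* MvPolynomial σ S :=
    eval₂Hom (C.comp φ) (fun l => X l + C (α l)) with hτ
  have : (taylorHom (R := S)).toRingHom.comp τ =
      (map τ).comp (taylorHom (σ := σ) (R := R)).toRingHom := by
    apply ringHom_ext
    · intro r
      simp only [RingHom.comp_apply, hτ, eval₂Hom_C, AlgHom.toRingHom_eq_coe, RingHom.coe_coe]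
      rw [← algebraMap_eq, ← algebraMap_eq, AlgHom.commutes, AlgHom.commutes]
      simp [algebraMap_apply]
    · intro l
      simp [hτ, taylorHom, algebraMap_apply]
      ring
  exact congrArg (fun f => f p) (this)

theorem prod_monomial {ι : Type*} (s : Finset ι) (e : ι → σ →₀ ℕ) (a : ι → R) :
    ∏ l ∈ s, monomial (e l) (a l) = monomial (∑ l ∈ s, e l) (∏ l ∈ s, a l) := by
  classical
  induction s using Finset.induction_on with
  | empty => simp
  | insert x s hx ih => simp [Finset.prod_insert hx, Finset.sum_insert hx, ih, monomial_mul]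

theorem hasse_monomial [Fintype σ] (i e : σ →₀ ℕ) (c : R) :
    hasse i (monomial e c) = monomial (e - i) (c * ∏ l, ((e l).choose (i l) : R)) := by
  classical
  rw [hasse_apply, taylorHom, aeval_monomial, Finsupp.prod_fintype _ _ (by simp)]
  have h1 : ∀ l, (C (X l : MvPolynomial σ R) + X l) ^ e l =
      ∑ j ∈ Finset.range (e l + 1), (monomial (Finsupp.single l j)
        ((X l : MvPolynomial σ R) ^ (e l - j) * ((e l).choose j : MvPolynomial σ R))) := by
    intro l
    rw [add_comm, add_pow]
    refine Finset.sum_congr rfl fun j _ => ?_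
    rw [X_pow_eq_monomial, ← C_pow, mul_assoc, mul_comm, ← map_natCast C, ← C_mul,
      C_mul_monomial, mul_one]
  simp_rw [h1]
  rw [Finset.prod_univ_sum, Finset.mul_sum, coeff_sum]
  have h2 : ∀ p : σ → ℕ, coeff i ((algebraMap R (MvPolynomial σ (MvPolynomial σ R))) c *
      ∏ l, (monomial (Finsupp.single l (p l))
        ((X l : MvPolynomial σ R) ^ (e l - p l) * ((e l).choose (p l) : MvPolynomial σ R)))) =
      if p = i then C c * ∏ l, ((X l : MvPolynomial σ R) ^ (e l - p l) *
        ((e l).choose (p l) : MvPolynomial σ R)) else 0 := by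
    intro p
    rw [prod_monomial, algebraMap_apply, coeff_C_mul, coeff_monomial]
    have h3 : ∑ l, Finsupp.single l (p l) = Finsupp.equivFunOnFinite.symm p := by
      ext l
      simp [Finsupp.finsetSum_apply, Finsupp.single_apply]
    rw [h3]
    have h4 : Finsupp.equivFunOnFinite.symm p = i ↔ p = i := by
      constructor
      · rintro rfl; rfl
      · rintro rfl; ext; rfl
    simp only [h4, algebraMap_eq, mul_ite, mul_zero]
  rw [Finset.sum_congr rfl fun p _ => h2 p, Finset.sum_ite_eq']
  have h5 : C c * ∏ l, ((X l : MvPolynomial σ R) ^ (e l - i l) *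
      ((e l).choose (i l) : MvPolynomial σ R)) =
      monomial (e - i) (c * ∏ l, ((e l).choose (i l) : R)) := by
    rw [Finset.prod_mul_distrib, monomial_eq, C_mul, Finsupp.prod_fintype _ _ (by simp)]
    simp only [map_prod, map_natCast, Finsupp.coe_tsub, Pi.sub_apply]
    ring
  split_ifs with h
  · exact h5
  · symm
    have : ∃ l, e l < i l := by
      by_contra! hc
      exact h (Fintype.mem_piFinset.mpr fun l => Finset.mem_range.mpr (by have := hc l; omega))
    obtain ⟨l, hl⟩ := this
    rw [Finset.prod_eq_zero (Finset.mem_univ l), mul_zero, map_zero]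
    rw [Nat.choose_eq_zero_of_lt hl, Nat.cast_zero]

end MvPolynomial

section

open MvPolynomial

section Interpolation

variable {σ K : Type*} [Fintype σ] [DecidableEq σ] [Field K]

theorem mul_prod_choose (e i : σ →₀ ℕ) (l : σ) :
    (e l : K) * ∏ q, ((e q).choose (i q) : K) =
      (i l + 1) * ∏ q, ((e q).choose ((i + Finsupp.single l 1 : σ →₀ ℕ) q) : K) +
        i l * ∏ q, ((e q).choose (i q) : K) := by
  rw [← Finset.mul_prod_erase _ _ (Finset.mem_univ l),
    ← Finset.mul_prod_erase _ (fun q => ((e q).choose ((i + Finsupp.single l 1 : σ →₀ ℕ) q) : K))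
      (Finset.mem_univ l)]
  have h1 : ∏ q ∈ Finset.univ.erase l, ((e q).choose ((i + Finsupp.single l 1 : σ →₀ ℕ) q) : K) =
      ∏ q ∈ Finset.univ.erase l, ((e q).choose (i q) : K) := by
    refine Finset.prod_congr rfl fun q hq => ?_
    have : q ≠ l := Finset.ne_of_mem_erase hq
    simp [this.symm]
  rw [h1]
  have h2 : (e l : K) * (e l).choose (i l) =
      (i l + 1) * (e l).choose (i l + 1) + i l * (e l).choose (i l) := by
    have h3 := Nat.choose_succ_right_eq (e l) (i l)
    rcases le_or_gt (i l) (e l) with h | h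
    · obtain ⟨t, ht⟩ := Nat.exists_eq_add_of_le h
      rw [ht] at h3 ⊢
      rw [Nat.add_sub_cancel_left] at h3
      have h4 := congrArg (Nat.cast (R := K)) h3
      push_cast at h4 ⊢
      linear_combination -h4
    · rw [Nat.choose_eq_zero_of_lt h, Nat.choose_eq_zero_of_lt (Nat.lt_succ_of_lt h)]
      simp
  simp only [Finsupp.add_apply, Finsupp.single_eq_same]
  linear_combination (∏ q ∈ Finset.univ.erase l, ((e q).choose (i q) : K)) * h2

/-- Distinct exponents are separated by binomial coefficients of small order. -/
theorem linearIndependent_prod_choose [CharZero K] {r : ℕ} (e : Fin r → σ →₀ ℕ)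
    (he : Function.Injective e) :
    LinearIndependent K fun (s : Fin r) (i : {i : σ →₀ ℕ // ∑ l, i l ≤ r - 1}) =>
      ∏ l, ((e s l).choose (i.1 l) : K) := by
  let U : ℕ → Submodule K (Fin r → K) := fun j => Submodule.span K
    ((fun (i : σ →₀ ℕ) (s : Fin r) => ∏ l, ((e s l).choose (i l) : K)) '' {i | ∑ l, i l ≤ j})
  have hmono : ∀ j, U j ≤ U (j + 1) := fun j => Submodule.span_mono
    (Set.image_mono fun i (hi : _ ≤ _) => hi.trans (Nat.le_succ j))
  have hstep : ∀ j l, ∀ h ∈ U j, (fun s => (e s l : K) * h s) ∈ U (j + 1) := by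
    intro j l h hh
    induction hh using Submodule.span_induction with
    | mem x hx =>
      obtain ⟨i, hi, rfl⟩ := hx
      simp only [Set.mem_ofPred_eq] at hi
      have h1 : (fun s => (e s l : K) * ∏ q, ((e s q).choose (i q) : K)) =
          ((i l : K) + 1) • (fun s => ∏ q, ((e s q).choose ((i + Finsupp.single l 1 : σ →₀ ℕ) q) : K)) +
          (i l : K) • (fun s => ∏ q, ((e s q).choose (i q) : K)) := by
        ext s
        simpa using mul_prod_choose (e s) i l
      rw [h1]
      refine add_mem (Submodule.smul_mem _ _ (Submodule.subset_span ⟨_, ?_, rfl⟩))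
        (Submodule.smul_mem _ _ (Submodule.subset_span ⟨_, ?_, rfl⟩))
      · simp only [Set.mem_ofPred_eq, Finsupp.add_apply, Finset.sum_add_distrib,
          Finsupp.single_apply, Finset.sum_ite_eq, Finset.mem_univ, if_true]
        omega
      · exact hi.trans (Nat.le_succ j)
    | zero => simp only [Pi.zero_apply, mul_zero]; exact zero_mem _
    | add x y _ _ hx hy =>
      simp only [Pi.add_apply, mul_add]
      exact add_mem hx hy
    | smul a x _ hx =>
      have := Submodule.smul_mem _ a hx
      convert this using 2 with s
      simp only [Pi.smul_apply, smul_eq_mul]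
      ring
  have hone : (fun _ => 1 : Fin r → K) ∈ U 0 :=
    Submodule.subset_span ⟨0, by simp, by ext; simp⟩
  have hprod : ∀ (T : Finset (Fin r)) (q : Fin r → σ),
      (fun s => ∏ t ∈ T, ((e s (q t) : K) - e t (q t))) ∈ U T.card := by
    intro T q
    induction T using Finset.induction_on with
    | empty => simpa using hone
    | insert t T ht ih =>
      rw [Finset.card_insert_of_notMem ht]
      have h1 := hstep _ (q t) _ ih
      have h2 := hmono _ (Submodule.smul_mem _ (e t (q t) : K) ih)
      convert sub_mem h1 h2 using 1
      ext s
      simp only [Finset.prod_insert ht, Pi.smul_apply, Pi.sub_apply, smul_eq_mul]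
      ring
  rw [Fintype.linearIndependent_iff]
  intro g hg s0
  have hker : ∀ h ∈ U (r - 1), ∑ s, g s * h s = 0 := by
    intro h hh
    induction hh using Submodule.span_induction with
    | mem x hx =>
      obtain ⟨i, hi, rfl⟩ := hx
      simpa [Finset.sum_apply] using congrFun hg ⟨i, hi⟩
    | zero => simp
    | add x y _ _ hx hy => simp [mul_add, Finset.sum_add_distrib, hx, hy]
    | smul a x _ hx =>
      simp only [Pi.smul_apply, smul_eq_mul]
      rw [← mul_zero a, ← hx, Finset.mul_sum]
      exact Finset.sum_congr rfl fun s _ => by ring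
  rcases isEmpty_or_nonempty σ with hσ | hσ
  · have : Subsingleton (Fin r) := ⟨fun s t => he (Subsingleton.elim _ _)⟩
    have h0 := congrFun hg ⟨0, by simp⟩
    have : Unique (Fin r) := ⟨⟨s0⟩, fun s => Subsingleton.elim _ _⟩
    simpa [Finset.sum_apply, Subsingleton.elim s0 default] using h0
  have hq : ∀ t : Fin r, t ≠ s0 → ∃ l : σ, e s0 l ≠ e t l := fun t ht =>
    DFunLike.ne_iff.mp (he.ne ht.symm)
  choose! q hq using hq
  have hmem := hprod (Finset.univ.erase s0) q
  rw [Finset.card_erase_of_mem (Finset.mem_univ _), Finset.card_univ, Fintype.card_fin] at hmem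
  have := hker _ hmem
  rw [Finset.sum_eq_single s0] at this
  · refine (mul_eq_zero.mp this).resolve_right (Finset.prod_ne_zero_iff.mpr fun t ht => ?_)
    rw [sub_ne_zero]
    exact_mod_cast hq t (Finset.ne_of_mem_erase ht)
  · intro s _ hs
    rw [Finset.prod_eq_zero (Finset.mem_erase.mpr ⟨hs, Finset.mem_univ s⟩) (sub_self _), mul_zero]
  · simp

end Interpolation

end

section

open MvPolynomial

namespace MonomialOrder

variable {σ R : Type*} [CommRing R] (m : MonomialOrder σ)

theorem coeff_prod_of_degree_le {ι : Type*} (P : ι → MvPolynomial σ R) (e : ι → σ →₀ ℕ)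
    (s : Finset ι) (h : ∀ i, m.degree (P i) ≼[m] e i) :
    coeff (∑ i ∈ s, e i) (∏ i ∈ s, P i) = ∏ i ∈ s, coeff (e i) (P i) := by
  classical
  induction s using Finset.induction_on with
  | empty => simp
  | insert a s has hrec =>
    simp only [Finset.prod_insert has, Finset.sum_insert has]
    rw [m.coeff_mul_of_add_of_degree_le (h a), hrec]
    refine m.degree_prod_le.trans ?_
    simp only [map_sum]
    exact Finset.sum_le_sum fun i _ => h i

/-- A finite-dimensional space of polynomials contains elements with distinct degrees. -/
theorem exists_distinct_degrees {K : Type*} [Field K] {r : ℕ} (f : Fin r → MvPolynomial σ K)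
    (hf : LinearIndependent K f) :
    ∃ F : Fin r → MvPolynomial σ K, (∀ s, F s ∈ Submodule.span K (Set.range f)) ∧
      (∀ s, F s ≠ 0) ∧ Function.Injective fun s => m.degree (F s) := by
  classical
  set W := Submodule.span K (Set.range f) with hW
  let D : Set (σ →₀ ℕ) := {e | ∃ p ∈ W, p ≠ 0 ∧ m.degree p = e}
  have hemb : Nonempty (Fin r ↪ D) := by
    rcases finite_or_infinite D with hD | hD
    · have : Fintype D := Fintype.ofFinite D
      apply Function.Embedding.nonempty_of_card_le
      let c : W →ₗ[K] (D → K) := LinearMap.pi fun e => (lcoeff K e.1).comp W.subtype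
      have hc : Function.Injective c := by
        rw [← LinearMap.ker_eq_bot, LinearMap.ker_eq_bot']
        intro p hp
        by_contra hp0
        have hp1 : p.1 ≠ 0 := fun h => hp0 (Subtype.ext h)
        have := congrFun hp ⟨m.degree p.1, p.1, p.2, hp1, rfl⟩
        exact hp1 (m.leadingCoeff_eq_zero_iff.mp this)
      have h1 := LinearMap.finrank_le_finrank_of_injective hc
      rwa [hW, finrank_span_eq_card hf, Module.finrank_fintype_fun_eq_card] at h1
    · exact ⟨Fin.valEmbedding.trans (Infinite.natEmbedding D)⟩
  obtain ⟨g⟩ := hemb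
  choose F h1 h2 h3 using fun s => (g s).2
  refine ⟨F, h1, h2, fun s t hst => g.injective (Subtype.ext ?_)⟩
  simpa [h3] using hst

end MonomialOrder

namespace MvPolynomial

variable {σ : Type*} [Fintype σ]

theorem coeff_monomial_mul_hasse {R : Type*} [CommRing R] (i e : σ →₀ ℕ) (p : MvPolynomial σ R) :
    coeff e (monomial i 1 * hasse i p) = coeff e p * ∏ l, ((e l).choose (i l) : R) := by
  classical
  induction p using MvPolynomial.induction_on' with
  | monomial e' c =>
    rw [hasse_monomial, monomial_mul, one_mul, coeff_monomial, coeff_monomial]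
    by_cases hle : i ≤ e'
    · rw [add_tsub_cancel_of_le hle]
      split_ifs with h
      · rw [h]
      · rw [zero_mul]
    · obtain ⟨l, hl⟩ : ∃ l, e' l < i l := by
        by_contra! hc
        exact hle hc
      have h0 : ∏ l, ((e' l).choose (i l) : R) = 0 :=
        Finset.prod_eq_zero (Finset.mem_univ l) (by rw [Nat.choose_eq_zero_of_lt hl, Nat.cast_zero])
      rw [h0, mul_zero, ite_self]
      split_ifs with h
      · rw [← h, h0, mul_zero]
      · rw [zero_mul]
  | add p q hp hq => rw [map_add, mul_add, coeff_add, coeff_add, hp, hq, add_mul]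

/-- Linearly independent polynomials have a nonvanishing generalized Wronskian. -/
theorem exists_hasse_det_ne_zero {K : Type*} [LinearOrder σ] [Field K] [CharZero K] {r : ℕ}
    (f : Fin r → MvPolynomial σ K) (hf : LinearIndependent K f) :
    ∃ i : Fin r → σ →₀ ℕ, (∀ t, ∑ l, i t l ≤ r - 1) ∧
      (Matrix.of fun s t => hasse (i t) (f s)).det ≠ 0 := by
  let m : MonomialOrder σ := MonomialOrder.lex
  obtain ⟨F, hFW, hF0, hdeg⟩ := m.exists_distinct_degrees f hf
  obtain ⟨a, ha⟩ := exists_minor_ne_zero _ (linearIndependent_prod_choose (K := K) _ hdeg)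
  refine ⟨fun t => (a t).1, fun t => (a t).2, fun h0 => ?_⟩
  have hA : ∀ s, ∃ c : Fin r → K, ∑ u, c u • f u = F s := fun s =>
    (Submodule.mem_span_range_iff_exists_fun K).mp (hFW s)
  choose A hA using hA
  have h1 : (Matrix.of fun s t => hasse (a t).1 (F s)).det = 0 := by
    have : (Matrix.of fun s t => hasse (a t).1 (F s)) =
        (Matrix.of A).map C * (Matrix.of fun s t => hasse (a t).1 (f s)) := by
      ext1 s t
      simp only [Matrix.of_apply, Matrix.mul_apply, Matrix.map_apply, ← hA, map_sum, map_smul]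
      simp only [smul_eq_C_mul]
    rw [this, Matrix.det_mul, h0, mul_zero]
  let G : Matrix (Fin r) (Fin r) (MvPolynomial σ K) :=
    Matrix.of fun s t => monomial (a t).1 1 * hasse (a t).1 (F s)
  have hG : G.det = 0 := by
    have := Matrix.det_mul_row (fun t => monomial (a t).1 (1 : K))
      (Matrix.of fun s t => hasse (a t).1 (F s))
    rw [h1, mul_zero] at this
    exact this
  have hGdeg : ∀ s t, m.toSyn (m.degree (G s t)) ≤ m.toSyn (m.degree (F s)) := by
    intro s t
    rw [m.degree_le_iff]
    intro c hc
    apply m.le_degree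
    rw [mem_support_iff] at hc ⊢
    intro h
    apply hc
    simp only [G, Matrix.of_apply]
    rw [coeff_monomial_mul_hasse, h, zero_mul]
  have h2 : coeff (∑ s, m.degree (F s)) G.det =
      (Matrix.of fun s t => coeff (m.degree (F s)) (F s) *
        ∏ l, ((m.degree (F s) l).choose ((a t).1 l) : K)).det := by
    rw [← Matrix.det_transpose, Matrix.det_apply, coeff_sum, ← Matrix.det_transpose,
      Matrix.det_apply]
    refine Finset.sum_congr rfl fun π _ => ?_
    rw [Units.smul_def, Units.smul_def, zsmul_eq_mul, zsmul_eq_mul, ← map_intCast (C : K →+* MvPolynomial σ K), coeff_C_mul]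
    simp only [Matrix.transpose_apply]
    rw [m.coeff_prod_of_degree_le (fun s => G s (π s)) (fun s => m.degree (F s)) _
      (fun s => hGdeg s _)]
    congr 1
    refine Finset.prod_congr rfl fun s _ => ?_
    simp only [G, Matrix.of_apply]
    rw [coeff_monomial_mul_hasse]
  rw [hG, coeff_zero] at h2
  have h3 := Matrix.det_mul_column (fun s => coeff (m.degree (F s)) (F s))
    (Matrix.of fun s t => ∏ l, ((m.degree (F s) l).choose ((a t).1 l) : K))
  have h4 : (∏ s, coeff (m.degree (F s)) (F s)) ≠ 0 :=
    Finset.prod_ne_zero_iff.mpr fun s _ => m.leadingCoeff_ne_zero_iff.mpr (hF0 s)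
  exact mul_ne_zero h4 ha (h3.symm.trans h2.symm)

end MvPolynomial

end

namespace MvPolynomial

variable {σ τ R S : Type*} [CommRing R] [CommRing S]

/-- The value at `w` of the monomial with exponent `e`. -/
noncomputable def monomialWeight (w : σ → ℝ) (e : σ →₀ ℕ) : ℝ := e.prod fun l n => w l ^ n

theorem monomialWeight_nonneg {w : σ → ℝ} (hw : ∀ l, 0 ≤ w l) (e : σ →₀ ℕ) :
    0 ≤ monomialWeight w e := Finset.prod_nonneg fun l _ => pow_nonneg (hw l) _

@[simp] theorem monomialWeight_zero (w : σ → ℝ) : monomialWeight w 0 = 1 := by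
  simp [monomialWeight]

theorem monomialWeight_add (w : σ → ℝ) (e f : σ →₀ ℕ) :
    monomialWeight w (e + f) = monomialWeight w e * monomialWeight w f := by
  classical
  exact Finsupp.prod_add_index' (by simp) (fun l => by intros; rw [pow_add])

theorem monomialWeight_eq [Fintype σ] (w : σ → ℝ) (e : σ →₀ ℕ) :
    monomialWeight w e = ∏ l, w l ^ e l := Finsupp.prod_fintype _ _ (by simp)

@[simp] theorem monomialWeight_one (e : σ →₀ ℕ) : monomialWeight (fun _ => 1) e = 1 := by
  simp [monomialWeight]

/-- The weighted `ℓ¹` norm of a polynomial. -/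
noncomputable def wnorm (A : AbsoluteValue R ℝ) (w : σ → ℝ) (p : MvPolynomial σ R) : ℝ :=
  ∑ e ∈ p.support, A (coeff e p) * monomialWeight w e

theorem wnorm_eq_of_subset (A : AbsoluteValue R ℝ) (w : σ → ℝ) {p : MvPolynomial σ R}
    {s : Finset (σ →₀ ℕ)} (h : p.support ⊆ s) :
    wnorm A w p = ∑ e ∈ s, A (coeff e p) * monomialWeight w e := by
  refine Finset.sum_subset h fun e _ he => ?_
  rw [notMem_support_iff.mp he, map_zero, zero_mul]

theorem wnorm_nonneg (A : AbsoluteValue R ℝ) {w : σ → ℝ} (hw : ∀ l, 0 ≤ w l)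
    (p : MvPolynomial σ R) : 0 ≤ wnorm A w p :=
  Finset.sum_nonneg fun e _ => mul_nonneg (A.nonneg _) (monomialWeight_nonneg hw e)

theorem coeff_le_wnorm (A : AbsoluteValue R ℝ) {w : σ → ℝ} (hw : ∀ l, 0 ≤ w l)
    (p : MvPolynomial σ R) (e : σ →₀ ℕ) : A (coeff e p) * monomialWeight w e ≤ wnorm A w p := by
  by_cases he : e ∈ p.support
  · exact Finset.single_le_sum (f := fun e => A (coeff e p) * monomialWeight w e)
      (fun e _ => mul_nonneg (A.nonneg _) (monomialWeight_nonneg hw e)) he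
  · rw [notMem_support_iff.mp he, map_zero, zero_mul]
    exact wnorm_nonneg A hw p

@[simp] theorem wnorm_zero (A : AbsoluteValue R ℝ) (w : σ → ℝ) :
    wnorm A w (0 : MvPolynomial σ R) = 0 := by simp [wnorm]

theorem wnorm_add_le (A : AbsoluteValue R ℝ) {w : σ → ℝ} (hw : ∀ l, 0 ≤ w l)
    (p q : MvPolynomial σ R) : wnorm A w (p + q) ≤ wnorm A w p + wnorm A w q := by
  classical
  rw [wnorm_eq_of_subset A w (support_add (p := p) (q := q)),
    wnorm_eq_of_subset A w (Finset.subset_union_left (s₁ := p.support) (s₂ := q.support)),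
    wnorm_eq_of_subset A w (Finset.subset_union_right (s₁ := p.support) (s₂ := q.support)),
    ← Finset.sum_add_distrib]
  refine Finset.sum_le_sum fun e _ => ?_
  rw [← add_mul, coeff_add]
  exact mul_le_mul_of_nonneg_right (A.add_le _ _) (monomialWeight_nonneg hw e)

theorem wnorm_sum_le {ι : Type*} (A : AbsoluteValue R ℝ) {w : σ → ℝ} (hw : ∀ l, 0 ≤ w l)
    (s : Finset ι) (p : ι → MvPolynomial σ R) :
    wnorm A w (∑ i ∈ s, p i) ≤ ∑ i ∈ s, wnorm A w (p i) := by
  classical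
  induction s using Finset.induction_on with
  | empty => simp
  | insert a s ha ih =>
    rw [Finset.sum_insert ha, Finset.sum_insert ha]
    exact (wnorm_add_le A hw _ _).trans (add_le_add_right ih _)

theorem wnorm_monomial (A : AbsoluteValue R ℝ) (w : σ → ℝ) (e : σ →₀ ℕ) (c : R) :
    wnorm A w (monomial e c) = A c * monomialWeight w e := by
  classical
  rw [wnorm_eq_of_subset A w support_monomial_subset, Finset.sum_singleton, coeff_monomial,
    if_pos rfl]

theorem wnorm_C (A : AbsoluteValue R ℝ) (w : σ → ℝ) (c : R) :
    wnorm A w (C c : MvPolynomial σ R) = A c := by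
  rw [C_apply, wnorm_monomial, monomialWeight_zero, mul_one]

theorem wnorm_mul_le (A : AbsoluteValue R ℝ) {w : σ → ℝ} (hw : ∀ l, 0 ≤ w l)
    (p q : MvPolynomial σ R) : wnorm A w (p * q) ≤ wnorm A w p * wnorm A w q := by
  classical
  have h1 : p * q = ∑ e ∈ p.support, ∑ f ∈ q.support,
      monomial (e + f) (coeff e p * coeff f q) := by
    conv_lhs => rw [as_sum p, as_sum q, Finset.sum_mul_sum]
    simp only [monomial_mul]
  rw [h1]
  calc _ ≤ ∑ e ∈ p.support, ∑ f ∈ q.support,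
        wnorm A w (monomial (e + f) (coeff e p * coeff f q)) :=
        (wnorm_sum_le A hw _ _).trans (Finset.sum_le_sum fun e _ => wnorm_sum_le A hw _ _)
    _ = _ := by
      rw [wnorm, wnorm, Finset.sum_mul_sum]
      refine Finset.sum_congr rfl fun e _ => Finset.sum_congr rfl fun f _ => ?_
      rw [wnorm_monomial, map_mul, monomialWeight_add]
      ring

variable [Nontrivial R]

@[simp] theorem wnorm_one (A : AbsoluteValue R ℝ) (w : σ → ℝ) :
    wnorm A w (1 : MvPolynomial σ R) = 1 := by
  rw [← C_1, wnorm_C, map_one]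

theorem wnorm_X (A : AbsoluteValue R ℝ) (w : σ → ℝ) (l : σ) :
    wnorm A w (X l : MvPolynomial σ R) = w l := by
  rw [X, wnorm_monomial, map_one, one_mul, monomialWeight, Finsupp.prod_single_index (by simp),
    pow_one]

theorem wnorm_prod_le {ι : Type*} (A : AbsoluteValue R ℝ) {w : σ → ℝ} (hw : ∀ l, 0 ≤ w l)
    (s : Finset ι) (p : ι → MvPolynomial σ R) :
    wnorm A w (∏ i ∈ s, p i) ≤ ∏ i ∈ s, wnorm A w (p i) := by
  classical
  induction s using Finset.induction_on with
  | empty => simp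
  | insert a s ha ih =>
    rw [Finset.prod_insert ha, Finset.prod_insert ha]
    exact (wnorm_mul_le A hw _ _).trans (mul_le_mul_of_nonneg_left ih (wnorm_nonneg A hw _))

theorem wnorm_pow_le (A : AbsoluteValue R ℝ) {w : σ → ℝ} (hw : ∀ l, 0 ≤ w l)
    (p : MvPolynomial σ R) (n : ℕ) : wnorm A w (p ^ n) ≤ wnorm A w p ^ n := by
  simpa using wnorm_prod_le A hw (Finset.range n) (fun _ => p)

theorem wnorm_eval₂Hom_le (A : AbsoluteValue R ℝ) (B : AbsoluteValue S ℝ) {w : σ → ℝ}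
    (hw : ∀ l, 0 ≤ w l) (φ : S →+* R) (hφ : ∀ x, A (φ x) ≤ B x) (g : τ → MvPolynomial σ R)
    (u : τ → ℝ) (hg : ∀ l, wnorm A w (g l) ≤ u l) (p : MvPolynomial τ S) :
    wnorm A w (eval₂Hom (C.comp φ) g p) ≤ wnorm B u p := by
  conv_lhs => rw [coe_eval₂Hom, eval₂_eq]
  refine (wnorm_sum_le A hw _ _).trans (Finset.sum_le_sum fun e _ => ?_)
  refine (wnorm_mul_le A hw _ _).trans ?_
  rw [RingHom.comp_apply, wnorm_C]
  refine mul_le_mul (hφ _) ((wnorm_prod_le A hw _ _).trans ?_) (wnorm_nonneg A hw _) (B.nonneg _)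
  exact Finset.prod_le_prod (fun l _ => wnorm_nonneg A hw _) fun l _ =>
    (wnorm_pow_le A hw _ _).trans (pow_le_pow_left₀ (wnorm_nonneg A hw _) (hg l) _)

omit [Nontrivial R] in
theorem wnorm_neg (A : AbsoluteValue R ℝ) (w : σ → ℝ) (p : MvPolynomial σ R) :
    wnorm A w (-p) = wnorm A w p := by
  simp [wnorm, A.map_neg, support_neg]

theorem wnorm_det_le {ι : Type*} [Fintype ι] [DecidableEq ι] (A : AbsoluteValue R ℝ)
    {w : σ → ℝ} (hw : ∀ l, 0 ≤ w l) (M : Matrix ι ι (MvPolynomial σ R)) (b : ι → ℝ)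
    (hb : ∀ i j, wnorm A w (M i j) ≤ b i) :
    wnorm A w M.det ≤ (Fintype.card ι).factorial * ∏ i, b i := by
  rw [← Matrix.det_transpose, Matrix.det_apply]
  refine (wnorm_sum_le A hw _ _).trans ?_
  rw [← Fintype.card_perm, ← nsmul_eq_mul, ← Finset.card_univ]
  refine Finset.sum_le_card_nsmul _ _ _ fun π _ => ?_
  have h1 : wnorm A w (∏ i, M.transpose (π i) i) ≤ ∏ i, b i :=
    (wnorm_prod_le A hw _ _).trans
      (Finset.prod_le_prod (fun i _ => wnorm_nonneg A hw _) fun i _ => hb _ _)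
  rcases Int.units_eq_one_or (Equiv.Perm.sign π) with h | h
  · rwa [h, one_smul]
  · rwa [h, Units.neg_smul, one_smul, wnorm_neg]

theorem _root_.AbsoluteValue.natCast_le (A : AbsoluteValue R ℝ) (n : ℕ) : A (n : R) ≤ n := by
  induction n with
  | zero => simp
  | succ n ih =>
    push_cast
    exact (A.add_le _ _).trans (by rw [map_one]; gcongr)

omit [Nontrivial R] in
theorem hasse_eq_sum [Fintype σ] (i : σ →₀ ℕ) (p : MvPolynomial σ R) :
    hasse i p = ∑ e ∈ p.support,
      monomial (e - i) (coeff e p * ∏ l, ((e l).choose (i l) : R)) := by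
  conv_lhs => rw [as_sum p, map_sum]
  simp only [hasse_monomial]

theorem wnorm_hasse_le [Fintype σ] (A : AbsoluteValue R ℝ) (i : σ →₀ ℕ) (d : σ → ℕ)
    (p : MvPolynomial σ R) (hd : ∀ l, degreeOf l p ≤ d l) :
    wnorm A (fun _ => 1) (hasse i p) ≤ 2 ^ (∑ l, d l) * wnorm A (fun _ => 1) p := by
  rw [hasse_eq_sum]
  refine (wnorm_sum_le A (fun _ => zero_le_one) _ _).trans ?_
  rw [wnorm, Finset.mul_sum]
  refine Finset.sum_le_sum fun e he => ?_
  rw [wnorm_monomial, monomialWeight_one, monomialWeight_one, mul_one, mul_one, map_mul, mul_comm]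
  refine mul_le_mul_of_nonneg_right ?_ (A.nonneg _)
  rw [map_prod, ← Finset.prod_pow_eq_pow_sum]
  refine Finset.prod_le_prod (fun l _ => A.nonneg _) fun l _ => (A.natCast_le _).trans ?_
  have h1 : e l ≤ d l := (monomial_le_degreeOf l he).trans (hd l)
  exact_mod_cast (Nat.choose_le_two_pow _ _).trans (Nat.pow_le_pow_right (by norm_num) h1)

omit [Nontrivial R] in
theorem degreeOf_hasse_le [Fintype σ] (i : σ →₀ ℕ) (l : σ) (p : MvPolynomial σ R) :
    degreeOf l (hasse i p) ≤ degreeOf l p := by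
  classical
  rw [hasse_eq_sum]
  refine degreeOf_le_iff.mpr fun f hf => ?_
  obtain ⟨e, he, hfe⟩ := Finset.mem_biUnion.mp (support_sum hf)
  rw [Finset.mem_singleton.mp (support_monomial_subset hfe)]
  exact (Nat.sub_le _ _).trans (monomial_le_degreeOf l he)

end MvPolynomial

namespace MvPolynomial

section Separated

variable {R : Type*} [CommRing R] {m : ℕ}

theorem mapDomain_succ_add_mapDomain_zero (a : Fin m →₀ ℕ) (b : Unit →₀ ℕ) :
    a.mapDomain Fin.succ + b.mapDomain (fun _ => (0 : Fin (m + 1))) = Finsupp.cons (b ()) a := by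
  ext l
  refine Fin.cases ?_ (fun l => ?_) l
  · rw [Finsupp.add_apply, Finsupp.cons_zero, Finsupp.mapDomain_of_notMem_range, zero_add]
    · exact Finsupp.mapDomain_apply (Function.injective_of_subsingleton _) b ()
    · rintro ⟨x, hx⟩
      exact Fin.succ_ne_zero x hx
  · rw [Finsupp.add_apply, Finsupp.cons_succ, Finsupp.mapDomain_apply (Fin.succ_injective m),
      Finsupp.mapDomain_of_notMem_range, add_zero]
    rintro ⟨x, hx⟩
    exact Fin.succ_ne_zero l hx.symm

/-- The product of a polynomial in the variables `1, …, m` and one in the variable `0`. -/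
noncomputable def sep (p : MvPolynomial (Fin m) R) (q : MvPolynomial Unit R) :
    MvPolynomial (Fin (m + 1)) R := rename Fin.succ p * rename (fun _ => 0) q

theorem sep_monomial (a : Fin m →₀ ℕ) (b : Unit →₀ ℕ) (x y : R) :
    sep (monomial a x) (monomial b y) = monomial (Finsupp.cons (b ()) a) (x * y) := by
  rw [sep, rename_monomial, rename_monomial, monomial_mul, mapDomain_succ_add_mapDomain_zero]

theorem sep_add_left (p p' : MvPolynomial (Fin m) R) (q : MvPolynomial Unit R) :
    sep (p + p') q = sep p q + sep p' q := by simp [sep, add_mul]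

theorem sep_add_right (p : MvPolynomial (Fin m) R) (q q' : MvPolynomial Unit R) :
    sep p (q + q') = sep p q + sep p q' := by simp [sep, mul_add]

theorem sep_sum_right {ι : Type*} (s : Finset ι) (p : MvPolynomial (Fin m) R)
    (q : ι → MvPolynomial Unit R) : sep p (∑ i ∈ s, q i) = ∑ i ∈ s, sep p (q i) := by
  simp [sep, Finset.mul_sum]

theorem sep_sum_left {ι : Type*} (s : Finset ι) (p : ι → MvPolynomial (Fin m) R)
    (q : MvPolynomial Unit R) : sep (∑ i ∈ s, p i) q = ∑ i ∈ s, sep (p i) q := by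
  simp [sep, Finset.sum_mul]

theorem coeff_sep (p : MvPolynomial (Fin m) R) (q : MvPolynomial Unit R) (a : Fin m →₀ ℕ)
    (b : Unit →₀ ℕ) : coeff (Finsupp.cons (b ()) a) (sep p q) = coeff a p * coeff b q := by
  classical
  induction p using MvPolynomial.induction_on' with
  | add p p' hp hp' => rw [sep_add_left, coeff_add, hp, hp', coeff_add, add_mul]
  | monomial a' x =>
    induction q using MvPolynomial.induction_on' with
    | add q q' hq hq' => rw [sep_add_right, coeff_add, hq, hq', coeff_add, mul_add]
    | monomial b' y =>
      rw [sep_monomial, coeff_monomial, coeff_monomial, coeff_monomial]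
      have h : Finsupp.cons (b' ()) a' = Finsupp.cons (b ()) a ↔ a' = a ∧ b' = b := by
        constructor
        · intro h
          have h0 := DFunLike.congr_fun h 0
          rw [Finsupp.cons_zero, Finsupp.cons_zero] at h0
          refine ⟨?_, Finsupp.ext fun _ => h0⟩
          rw [← Finsupp.tail_cons (b' ()) a', h, Finsupp.tail_cons]
        · rintro ⟨rfl, rfl⟩; rfl
      rw [if_congr h rfl rfl]
      by_cases h1 : a' = a <;> by_cases h2 : b' = b <;> simp [h1, h2]

theorem hasse_sep (p : MvPolynomial (Fin m) R) (q : MvPolynomial Unit R) (i : Fin m →₀ ℕ)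
    (j : Unit →₀ ℕ) : hasse (Finsupp.cons (j ()) i) (sep p q) = sep (hasse i p) (hasse j q) := by
  induction p using MvPolynomial.induction_on' with
  | add p p' hp hp' => rw [sep_add_left, map_add, hp, hp', map_add, sep_add_left]
  | monomial a x =>
    induction q using MvPolynomial.induction_on' with
    | add q q' hq hq' => rw [sep_add_right, map_add, hq, hq', map_add, sep_add_right]
    | monomial b y =>
      rw [sep_monomial, hasse_monomial, hasse_monomial, hasse_monomial, sep_monomial]
      have h1 : Finsupp.cons (b ()) a - Finsupp.cons (j ()) i =
          Finsupp.cons ((b - j) ()) (a - i) := by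
        ext l
        refine Fin.cases ?_ (fun l => ?_) l <;> simp
      rw [h1, Fin.prod_univ_succ]
      simp only [Finsupp.cons_zero, Finsupp.cons_succ, Finset.univ_unique, Finset.prod_singleton]
      congr 1
      ring

/-- A polynomial is the sum of its coefficients with respect to the variable `0`. -/
theorem eq_sum_sep (P : MvPolynomial (Fin (m + 1)) R) (d : ℕ) (hd : degreeOf 0 P ≤ d) :
    P = ∑ b : Fin (d + 1), sep (Polynomial.coeff (finSuccEquiv R m P) b)
      (monomial (Finsupp.single () (b : ℕ)) 1) := by
  classical
  ext e
  obtain ⟨b, a, rfl⟩ : ∃ b a, e = Finsupp.cons b a := ⟨_, _, (Finsupp.cons_tail e).symm⟩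
  rw [coeff_sum]
  have h1 : ∀ b' : Fin (d + 1), coeff (Finsupp.cons b a)
      (sep (Polynomial.coeff (finSuccEquiv R m P) b') (monomial (Finsupp.single () (b' : ℕ)) 1)) =
      if (b' : ℕ) = b then coeff (Finsupp.cons b a) P else 0 := by
    intro b'
    have := coeff_sep (Polynomial.coeff (finSuccEquiv R m P) b')
      (monomial (Finsupp.single () (b' : ℕ)) 1) a (Finsupp.single () b)
    rw [Finsupp.single_eq_same] at this
    rw [this, coeff_monomial, finSuccEquiv_coeff_coeff]
    by_cases h : (b' : ℕ) = b
    · simp [h]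
    · rw [if_neg h, if_neg, mul_zero]
      intro h'
      exact h (by simpa using DFunLike.congr_fun h' ())
  simp only [h1]
  by_cases hb : b < d + 1
  · rw [Finset.sum_eq_single ⟨b, hb⟩]
    · simp
    · intro b' _ hb'
      rw [if_neg]
      intro h
      exact hb' (Fin.ext h)
    · simp
  · rw [Finset.sum_eq_zero]
    · by_contra h
      have := monomial_le_degreeOf 0 (mem_support_iff.mpr h)
      rw [Finsupp.cons_zero] at this
      omega
    · intro b' _
      rw [if_neg]
      have := b'.2
      omega

end Separated

section Index

variable {σ R : Type*} [CommRing R] [Fintype σ]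

/-- All monomials of `Q` have weight at least `θ`. -/
def IndexGE (w : σ → ℝ) (θ : ℝ) (Q : MvPolynomial σ R) : Prop :=
  ∀ a, coeff a Q ≠ 0 → θ ≤ ∑ l, w l * a l

theorem indexGE_zero_of_nonneg {w : σ → ℝ} (hw : ∀ l, 0 ≤ w l) (Q : MvPolynomial σ R) :
    IndexGE w 0 Q := fun _ _ => Finset.sum_nonneg fun l _ => mul_nonneg (hw l) (Nat.cast_nonneg _)

theorem IndexGE.sum {ι : Type*} {w : σ → ℝ} {θ : ℝ} {s : Finset ι} {Q : ι → MvPolynomial σ R}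
    (h : ∀ i ∈ s, IndexGE w θ (Q i)) : IndexGE w θ (∑ i ∈ s, Q i) := by
  intro a ha
  rw [coeff_sum] at ha
  obtain ⟨i, hi, hia⟩ := Finset.exists_ne_zero_of_sum_ne_zero ha
  exact h i hi a hia

theorem IndexGE.mul {w : σ → ℝ} {θ η : ℝ} {p q : MvPolynomial σ R} (hp : IndexGE w θ p)
    (hq : IndexGE w η q) : IndexGE w (θ + η) (p * q) := by
  classical
  intro a ha
  rw [coeff_mul] at ha
  obtain ⟨x, hx, hxa⟩ := Finset.exists_ne_zero_of_sum_ne_zero ha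
  rw [Finset.HasAntidiagonal.mem_antidiagonal] at hx
  rw [← hx]
  refine (add_le_add (hp _ (left_ne_zero_of_mul hxa)) (hq _ (right_ne_zero_of_mul hxa))).trans_eq ?_
  rw [← Finset.sum_add_distrib]
  refine Finset.sum_congr rfl fun l _ => ?_
  push_cast [Finsupp.add_apply]
  ring

theorem IndexGE.prod {ι : Type*} {w : σ → ℝ} (hw : ∀ l, 0 ≤ w l) {θ : ι → ℝ} (s : Finset ι)
    {Q : ι → MvPolynomial σ R} (h : ∀ i, IndexGE w (θ i) (Q i)) :
    IndexGE w (∑ i ∈ s, θ i) (∏ i ∈ s, Q i) := by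
  classical
  induction s using Finset.induction_on with
  | empty => simpa using indexGE_zero_of_nonneg hw _
  | insert a s ha ih =>
    rw [Finset.sum_insert ha, Finset.prod_insert ha]
    exact (h a).mul ih

theorem IndexGE.det {ι : Type*} [Fintype ι] [DecidableEq ι] {w : σ → ℝ} (hw : ∀ l, 0 ≤ w l)
    {θ : ι → ℝ} {M : Matrix ι ι (MvPolynomial σ R)} (h : ∀ i j, IndexGE w (θ j) (M i j)) :
    IndexGE w (∑ i, θ i) M.det := by
  rw [Matrix.det_apply]
  refine IndexGE.sum fun π _ => ?_
  have h1 : IndexGE w (∑ i, θ i) (∏ i, M (π i) i) := IndexGE.prod hw _ fun i => h _ i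
  intro a ha
  refine h1 a fun h0 => ha ?_
  rw [Units.smul_def, coeff_smul, h0, smul_zero]

theorem IndexGE.hasse {w : σ → ℝ} (hw : ∀ l, 0 ≤ w l) {θ : ℝ} {Q : MvPolynomial σ R}
    (h : IndexGE w θ Q) (i : σ →₀ ℕ) : IndexGE w (θ - ∑ l, w l * i l) (hasse i Q) := by
  classical
  rw [hasse_eq_sum]
  refine IndexGE.sum fun e he a ha => ?_
  rw [coeff_monomial] at ha
  split_ifs at ha with h1
  · have h2 := h e (mem_support_iff.mp he)
    rw [sub_le_iff_le_add, ← Finset.sum_add_distrib]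
    refine h2.trans (Finset.sum_le_sum fun l _ => ?_)
    rw [← mul_add]
    refine mul_le_mul_of_nonneg_left ?_ (hw l)
    rw [← h1]
    have : e l ≤ (e - i) l + i l := by rw [Finsupp.tsub_apply]; omega
    exact_mod_cast this
  · exact absurd rfl ha

end Index

end MvPolynomial

/-- A lower bound for the sum of a truncated arithmetic progression. -/
theorem sum_max_sub_div_ge {r d : ℕ} (hd : 1 ≤ d) (hr : r ≤ d + 1) {x : ℝ} (hx0 : 0 ≤ x)
    (hx1 : x ≤ 1) : r * x ^ 2 / 8 ≤ ∑ j ∈ Finset.range r, max 0 (x - j / d) := by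
  have hd0 : (0 : ℝ) < d := by exact_mod_cast hd
  have hr' : (r : ℝ) ≤ 2 * d := by
    have : r ≤ 2 * d := by omega
    exact_mod_cast this
  set t := ⌈r * x / 4⌉₊ with ht
  have htr : t ≤ r := Nat.ceil_le.mpr (by nlinarith [Nat.cast_nonneg (α := ℝ) r])
  have h1 : ∑ j ∈ Finset.range t, x / 2 ≤ ∑ j ∈ Finset.range r, max 0 (x - j / d) := by
    refine (Finset.sum_le_sum fun j hj => ?_).trans
      (Finset.sum_le_sum_of_subset_of_nonneg (Finset.range_mono htr)
        fun j _ _ => le_max_left _ _)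
    refine le_max_of_le_right ?_
    have h2 : (j : ℝ) < r * x / 4 := Nat.lt_ceil.mp (Finset.mem_range.mp hj)
    have h3 : (j : ℝ) / d ≤ x / 2 := by
      rw [div_le_iff₀ hd0]
      nlinarith
    linarith
  rw [Finset.sum_const, Finset.card_range, nsmul_eq_mul] at h1
  have h4 : r * x / 4 ≤ t := Nat.le_ceil _
  nlinarith

namespace MvPolynomial

variable {σ R S : Type*} [CommRing R] [CommRing S]

/-- The ring homomorphism `P(x) ↦ P(x + α)`. -/
noncomputable def translate (φ : R →+* S) (α : σ → S) : MvPolynomial σ R →+* MvPolynomial σ S :=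
  eval₂Hom (C.comp φ) fun l => X l + C (α l)

theorem hasse_translate (φ : R →+* S) (α : σ → S) (i : σ →₀ ℕ) (p : MvPolynomial σ R) :
    hasse i (translate φ α p) = translate φ α (hasse i p) := hasse_eval₂Hom φ α i p

theorem translate_map (φ : R →+* S) (α : σ → S) (p : MvPolynomial σ R) :
    translate (RingHom.id S) α (map φ p) = translate φ α p := by
  rw [translate, eval₂Hom_map_hom]
  rfl

theorem translate_zero (φ : R →+* S) : translate φ (0 : σ → S) = map φ := by
  apply ringHom_ext <;> simp [translate]

theorem hasse_map (φ : R →+* S) (i : σ →₀ ℕ) (p : MvPolynomial σ R) :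
    hasse i (map φ p) = map φ (hasse i p) := by
  rw [← translate_zero, hasse_translate]

theorem translate_C (φ : R →+* S) (α : σ → S) (r : R) : translate φ α (C r) = C (φ r) := by
  simp [translate]

theorem rename_translate {τ : Type*} (φ : R →+* S) (g : τ → σ) (α : σ → S)
    (p : MvPolynomial τ R) :
    translate φ α (rename g p) = rename g (translate φ (α ∘ g) p) := by
  have : (translate φ α).comp (rename g : MvPolynomial τ R →ₐ[R] _).toRingHom =
      ((rename g : MvPolynomial τ S →ₐ[S] _).toRingHom).comp (translate φ (α ∘ g)) := by
    apply ringHom_ext <;> simp [translate]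
  exact congrArg (fun f => f p) this

theorem translate_sep {m : ℕ} (φ : R →+* S) (α : Fin (m + 1) → S) (p : MvPolynomial (Fin m) R)
    (q : MvPolynomial Unit R) :
    translate φ α (sep p q) =
      sep (translate φ (fun l => α l.succ) p) (translate φ (fun _ => α 0) q) := by
  rw [sep, map_mul, rename_translate, rename_translate]
  rfl

theorem wnorm_le_of_coeff {τ : Type*} (A : AbsoluteValue R ℝ) (p : MvPolynomial σ R)
    (q : MvPolynomial τ R) (ψ : (τ →₀ ℕ) → σ →₀ ℕ) (hψ : Function.Injective ψ)
    (h : ∀ e, coeff e q = coeff (ψ e) p) :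
    wnorm A (fun _ => 1) q ≤ wnorm A (fun _ => 1) p := by
  classical
  simp only [wnorm, monomialWeight_one, mul_one, h]
  rw [← Finset.sum_image (s := q.support) (g := ψ) (f := fun e => A (coeff e p))
    (fun _ _ _ _ h => hψ h)]
  refine Finset.sum_le_sum_of_subset_of_nonneg ?_ fun _ _ _ => A.nonneg _
  intro e he
  obtain ⟨f, hf, rfl⟩ := Finset.mem_image.mp he
  rw [mem_support_iff] at hf ⊢
  rwa [← h]

theorem degreeOf_det_le {ι : Type*} [Fintype ι] [DecidableEq ι] (l : σ) (d : ℕ)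
    (M : Matrix ι ι (MvPolynomial σ R)) (h : ∀ i j, degreeOf l (M i j) ≤ d) :
    degreeOf l M.det ≤ Fintype.card ι * d := by
  classical
  rw [Matrix.det_apply]
  refine (degreeOf_sum_le _ _ _).trans (Finset.sup_le fun π _ => ?_)
  have h1 : degreeOf l (∏ i, M (π i) i) ≤ Fintype.card ι * d := by
    refine (degreeOf_prod_le _ _ _).trans ?_
    rw [← smul_eq_mul, ← Finset.card_univ]
    exact Finset.sum_le_card_nsmul _ _ _ fun i _ => h _ _
  rcases Int.units_eq_one_or (Equiv.Perm.sign π) with h2 | h2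
  · rwa [h2, one_smul]
  · rw [h2, Units.neg_smul, one_smul]
    rwa [degreeOf, degrees_neg]

/-- The absolute value of an integer, as a real number. -/
noncomputable def _root_.absInt : AbsoluteValue ℤ ℝ :=
  AbsoluteValue.comp (AbsoluteValue.abs (S := ℝ)) (f := Int.castRingHom ℝ) Int.cast_injective

theorem _root_.absInt_apply (x : ℤ) : absInt x = |(x : ℝ)| := rfl

theorem one_le_wnorm_absInt {p : MvPolynomial σ ℤ} (hp : p ≠ 0) :
    1 ≤ wnorm absInt (fun _ => 1) p := by
  obtain ⟨e, he⟩ := ne_zero_iff.mp hp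
  have := coeff_le_wnorm absInt (w := fun _ => 1) (fun _ => zero_le_one) p e
  rw [monomialWeight_one, mul_one] at this
  refine le_trans ?_ this
  rw [absInt_apply]
  exact_mod_cast Int.one_le_abs he

end MvPolynomial

namespace MvPolynomial

set_option maxHeartbeats 1000000 in
theorem exists_wronskian_data (k : Type*) [Field k] [CharZero k] {m : ℕ}
    {P : MvPolynomial (Fin (m + 1)) ℤ} (hP : P ≠ 0) {d : ℕ} (hd : degreeOf 0 P ≤ d) :
    ∃ r : ℕ, 0 < r ∧ r ≤ d + 1 ∧
    ∃ (f : Fin r → MvPolynomial (Fin m) ℤ) (g : Fin r → MvPolynomial Unit ℤ)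
      (i : Fin r → Fin m →₀ ℕ) (κ : Fin r → Unit →₀ ℕ) (c : k),
      (∀ t, wnorm absInt (fun _ => 1) (f t) ≤ wnorm absInt (fun _ => 1) P ∧
        ∀ l, degreeOf l (f t) ≤ degreeOf l.succ P) ∧
      (∀ s, wnorm absInt (fun _ => 1) (g s) ≤ wnorm absInt (fun _ => 1) P ∧
        degreeOf () (g s) ≤ d) ∧
      (∀ s, ∑ l, i s l ≤ r - 1) ∧ (∀ t, κ t () ≤ r - 1) ∧
      (Matrix.of fun s t => hasse (i t) (f s)).det ≠ 0 ∧
      (Matrix.of fun s t => hasse (κ t) (g s)).det ≠ 0 ∧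
      C c * map (Int.castRingHom k)
          (Matrix.of fun s t => hasse (Finsupp.cons (κ t ()) (i s)) P).det =
        sep (map (Int.castRingHom k) (Matrix.of fun s t => hasse (i t) (f s)).det)
          (map (Int.castRingHom k) (Matrix.of fun s t => hasse (κ t) (g s)).det) := by
  classical
  set φ := Int.castRingHom k with hφ
  have hφi : Function.Injective φ := Int.cast_injective
  let p : ℕ → MvPolynomial (Fin m) ℤ := fun b => Polynomial.coeff (finSuccEquiv ℤ m P) b
  let pk : Fin (d + 1) → MvPolynomial (Fin m) k := fun b => map φ (p b)
  have hpP : P = ∑ b : Fin (d + 1), sep (p b) (monomial (Finsupp.single () (b : ℕ)) 1) :=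
    eq_sum_sep P d hd
  obtain ⟨ι, β', hβ', hspan, hli⟩ := exists_linearIndependent' k pk
  have : Finite ι := Finite.of_injective β' hβ'
  have : Fintype ι := Fintype.ofFinite ι
  obtain ⟨r, hr⟩ : ∃ r, r = Fintype.card ι := ⟨_, rfl⟩
  let eι : Fin r ≃ ι := (finCongr hr).trans (Fintype.equivFin ι).symm
  let β : Fin r → Fin (d + 1) := fun t => β' (eι t)
  have hβ : Function.Injective β := hβ'.comp eι.injective
  have hf : LinearIndependent k fun t => pk (β t) := hli.comp eι eι.injective
  have hspan' : ∀ b, ∃ c : Fin r → k, ∑ t, c t • pk (β t) = pk b := by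
    intro b
    rw [← Submodule.mem_span_range_iff_exists_fun]
    have h1 : Set.range (fun t => pk (β t)) = Set.range (pk ∘ β') := by
      have : (fun t => pk (β t)) = (pk ∘ β') ∘ eι := rfl
      rw [this, eι.surjective.range_comp]
    rw [h1, hspan]
    exact Submodule.subset_span ⟨b, rfl⟩
  choose lam hlam using hspan'
  have hrd : r ≤ d + 1 := by simpa using Fintype.card_le_of_injective β hβ
  have hr0 : 0 < r := by
    rcases Nat.eq_zero_or_pos r with h0 | h0
    · exfalso
      subst h0
      apply hP
      rw [hpP]
      refine Finset.sum_eq_zero fun b _ => ?_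
      have h1 := hlam b
      rw [Finset.univ_eq_empty, Finset.sum_empty] at h1
      have h2 : p b = 0 := map_injective φ hφi (by rw [map_zero]; exact h1.symm)
      rw [h2, sep, map_zero, zero_mul]
    · exact h0
  obtain ⟨a, ha⟩ := exists_minor_ne_zero
    (fun (s : Fin r) (e : Fin m →₀ ℕ) => coeff e (pk (β s))) (by
      have h1 : Function.Injective
          (LinearMap.pi (fun e => lcoeff k e) : MvPolynomial (Fin m) k →ₗ[k] _) := by
        intro x y hxy
        ext e
        exact congrFun hxy e
      exact hf.map' _ (LinearMap.ker_eq_bot.mpr h1))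
  let f : Fin r → MvPolynomial (Fin m) ℤ := fun t => p (β t)
  let g : Fin r → MvPolynomial Unit ℤ := fun s =>
    ∑ b : Fin (d + 1), monomial (Finsupp.single () (b : ℕ)) (coeff (a s) (p b))
  let h : Fin r → MvPolynomial Unit k := fun t =>
    ∑ b : Fin (d + 1), monomial (Finsupp.single () (b : ℕ)) (lam b t)
  let Ck : Matrix (Fin r) (Fin r) k := Matrix.of fun s t => coeff (a s) (pk (β t))
  have hCk : Ck.det ≠ 0 := by rwa [← Matrix.det_transpose]
  have hgcoef : ∀ s e, coeff e (g s) =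
      if e () < d + 1 then coeff (Finsupp.cons (e ()) (a s)) P else 0 := by
    intro s e
    simp only [g, coeff_sum, coeff_monomial]
    have h1 : ∀ b : ℕ, Finsupp.single () b = e ↔ b = e () := by
      intro b
      constructor
      · rintro rfl; simp
      · rintro rfl; ext; simp
    simp only [h1]
    split_ifs with h2
    · rw [Finset.sum_eq_single ⟨e (), h2⟩]
      · simp [p, finSuccEquiv_coeff_coeff]
      · intro b _ hb
        rw [if_neg]
        exact fun h3 => hb (Fin.ext h3)
      · simp
    · refine Finset.sum_eq_zero fun b _ => if_neg ?_
      have := b.2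
      omega
  have hgh : ∀ s, map φ (g s) = ∑ t, Ck s t • h t := by
    intro s
    have h1 : ∀ b : Fin (d + 1), φ (coeff (a s) (p b)) = ∑ t, Ck s t * lam b t := by
      intro b
      rw [← coeff_map]
      change coeff (a s) (pk b) = _
      rw [← hlam b, coeff_sum]
      refine Finset.sum_congr rfl fun t _ => ?_
      rw [coeff_smul, smul_eq_mul, mul_comm]
      rfl
    simp only [g, h, map_sum, map_monomial, h1, Finset.smul_sum, smul_monomial, smul_eq_mul]
    rw [Finset.sum_comm]
  have hgli : LinearIndependent k fun s => map φ (g s) := by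
    rw [Fintype.linearIndependent_iff]
    intro μ hμ
    have h1 : Matrix.vecMul μ Ck = 0 := by
      ext t
      have h2 := congrArg (coeff (Finsupp.single () ((β t : Fin (d + 1)) : ℕ))) hμ
      rw [coeff_sum, coeff_zero] at h2
      rw [Matrix.vecMul, dotProduct, Pi.zero_apply, ← h2]
      refine Finset.sum_congr rfl fun s _ => ?_
      rw [coeff_smul, coeff_map, hgcoef, Finsupp.single_eq_same, if_pos (β t).2, smul_eq_mul]
      simp only [Ck, pk, p, Matrix.of_apply, coeff_map, finSuccEquiv_coeff_coeff]
    intro s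
    exact congrFun (Matrix.eq_zero_of_vecMul_eq_zero hCk h1) s
  obtain ⟨i, hi, hidet⟩ := exists_hasse_det_ne_zero _ hf
  obtain ⟨κ, hκ, hκdet⟩ := exists_hasse_det_ne_zero _ hgli
  have hF : map φ (Matrix.of fun s t => hasse (i t) (f s)).det =
      (Matrix.of fun s t => hasse (i t) (pk (β s))).det := by
    rw [RingHom.map_det]
    congr 1
    ext1 s t
    simp [f, pk, hasse_map]
  have hG : map φ (Matrix.of fun s t => hasse (κ t) (g s)).det =
      (Matrix.of fun s t => hasse (κ t) (map φ (g s))).det := by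
    rw [RingHom.map_det]
    congr 1
    ext1 s t
    simp [hasse_map]
  refine ⟨r, hr0, hrd, f, g, i, κ, Ck.det, fun t => ⟨?_, fun l => ?_⟩, fun s => ⟨?_, ?_⟩, hi,
    fun t => by simpa using hκ t, ?_, ?_, ?_⟩
  · exact wnorm_le_of_coeff _ _ _ (Finsupp.cons ((β t : Fin (d + 1)) : ℕ))
      (fun x y hxy => by rw [← Finsupp.tail_cons _ x, hxy, Finsupp.tail_cons])
      fun e => finSuccEquiv_coeff_coeff _ _ _
  · exact degreeOf_coeff_finSuccEquiv _ _ _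
  · refine le_trans (wnorm_le_of_coeff (σ := Fin (m + 1)) absInt
      (∑ b : Fin (d + 1), sep (p b) (monomial (Finsupp.single () (b : ℕ)) 1)) _
      (fun e => Finsupp.cons (e ()) (a s)) ?_ ?_) (le_of_eq (by rw [← hpP]))
    · intro x y hxy
      ext
      simpa using DFunLike.congr_fun hxy 0
    · intro e
      rw [← hpP, hgcoef]
      split_ifs with h1
      · rfl
      · by_contra h2
        have := monomial_le_degreeOf 0 (mem_support_iff.mpr (Ne.symm h2))
        rw [Finsupp.cons_zero] at this
        omega
  · rw [degreeOf_le_iff]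
    intro e he
    rw [mem_support_iff, hgcoef] at he
    by_contra h1
    exact he (if_neg (by omega))
  · intro h0
    rw [h0, map_zero] at hF
    exact hidet hF.symm
  · intro h0
    rw [h0, map_zero] at hG
    exact hκdet hG.symm
  · rw [hF, hG]
    have hPk : map φ P = ∑ t, sep (pk (β t)) (h t) := by
      have h1 : map φ P = ∑ b : Fin (d + 1),
          sep (pk b) (monomial (Finsupp.single () (b : ℕ)) 1) := by
        conv_lhs => rw [hpP, map_sum]
        refine Finset.sum_congr rfl fun b _ => ?_
        rw [sep, map_mul, map_rename, map_rename, map_monomial, map_one]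
        rfl
      rw [h1]
      simp only [h, sep_sum_right]
      rw [Finset.sum_comm]
      refine Finset.sum_congr rfl fun b _ => ?_
      rw [← hlam b, sep_sum_left]
      refine Finset.sum_congr rfl fun t _ => ?_
      rw [← mul_one (lam b t), ← smul_eq_mul, ← smul_monomial, sep, sep, map_smul, map_smul,
        smul_mul_assoc, mul_smul_comm, smul_eq_mul, mul_one]
    let A : Matrix (Fin r) (Fin r) (MvPolynomial (Fin (m + 1)) k) :=
      Matrix.of fun s u => rename Fin.succ (hasse (i s) (pk (β u)))
    let B : Matrix (Fin r) (Fin r) (MvPolynomial (Fin (m + 1)) k) :=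
      Matrix.of fun u t => rename (fun _ => 0) (hasse (κ t) (h u))
    have hW : map φ (Matrix.of fun s t => hasse (Finsupp.cons (κ t ()) (i s)) P).det =
        A.det * B.det := by
      rw [← Matrix.det_mul, RingHom.map_det]
      congr 1
      ext1 s t
      simp only [RingHom.mapMatrix_apply, Matrix.map_apply, Matrix.of_apply, A, B, Matrix.mul_apply]
      rw [← hasse_map, hPk, map_sum]
      exact Finset.sum_congr rfl fun u _ => hasse_sep _ _ _ _
    have hGB : rename (fun _ => 0) (Matrix.of fun s t => hasse (κ t) (map φ (g s))).det =
        C Ck.det * B.det := by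
      rw [AlgHom.map_det, RingHom.map_det, ← Matrix.det_mul]
      congr 1
      ext1 s t
      simp only [AlgHom.mapMatrix_apply, Matrix.map_apply, Matrix.of_apply, hgh, map_sum, map_smul,
        Matrix.mul_apply, RingHom.mapMatrix_apply, B]
      simp only [smul_eq_C_mul]
    have hFA : rename Fin.succ (Matrix.of fun s t => hasse (i t) (pk (β s))).det = A.det := by
      rw [AlgHom.map_det, ← Matrix.det_transpose]
      congr 1
    rw [hW, sep, hGB, hFA]
    ring

end MvPolynomial

section

open MvPolynomial

/-- `α` is not close to being a root of high multiplicity of an integer polynomial of small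
height; `L` measures the quality. -/
def RothPoint {k : Type*} [Field k] (α : k) (L : ℝ) : Prop :=
  ∀ V : MvPolynomial Unit ℤ, V ≠ 0 → ∃ b : Unit →₀ ℕ,
    coeff b (translate (Int.castRingHom k) (fun _ => α) V) ≠ 0 ∧
      b () * L ≤ Real.log (wnorm absInt (fun _ => 1) V)

theorem log_wnorm_det_le {σ : Type*} {r : ℕ} (M : Matrix (Fin r) (Fin r) (MvPolynomial σ ℤ))
    (hM : M.det ≠ 0) {N : ℝ} (hN : 0 < N) {D d : ℕ} (hr : r ≤ d + 1)
    (h : ∀ i j, wnorm absInt (fun _ => 1) (M i j) ≤ 2 ^ D * N) :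
    Real.log (wnorm absInt (fun _ => 1) M.det) ≤ r * (d + D + Real.log N) := by
  have h1 := wnorm_det_le absInt (w := fun _ => 1) (fun _ => zero_le_one) M _ h
  have h2 := one_le_wnorm_absInt hM
  rw [Fintype.card_fin, Finset.prod_const, Finset.card_univ, Fintype.card_fin] at h1
  have h3 := Real.log_le_log (by linarith) h1
  have hfac : (0 : ℝ) < r.factorial := by exact_mod_cast r.factorial_pos
  rw [Real.log_mul hfac.ne' (by positivity), Real.log_pow, Real.log_mul (by positivity) hN.ne',
    Real.log_pow] at h3
  have h4 : Real.log r.factorial ≤ r * d := by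
    rcases Nat.eq_zero_or_pos r with h0 | h0
    · simp [h0]
    · have hr0 : (0 : ℝ) < r := by exact_mod_cast h0
      calc Real.log r.factorial ≤ Real.log ((r : ℝ) ^ r) :=
            Real.log_le_log hfac (by exact_mod_cast r.factorial_le_pow)
        _ = r * Real.log r := Real.log_pow _ _
        _ ≤ r * d := by
          have := Real.log_le_sub_one_of_pos hr0
          have h5 : (r : ℝ) ≤ d + 1 := by exact_mod_cast hr
          gcongr
          linarith
  have h5 : Real.log 2 ≤ 1 := Real.log_two_lt_d9.le.trans (by norm_num)
  have h6 : (D : ℝ) * Real.log 2 ≤ D := mul_le_of_le_one_right (Nat.cast_nonneg _) h5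
  have h7 : (r : ℝ) * (D * Real.log 2 + Real.log N) ≤ r * (D + Real.log N) := by gcongr
  linarith

/-- Roth's lemma, in the form without a zero estimate at a fixed point. -/
theorem roth_lemma (k : Type*) [Field k] [CharZero k] (m : ℕ) :
    ∀ θ : ℝ, 0 < θ → ∃ σ : ℝ, 0 < σ ∧ ∀ (d : Fin m → ℕ) (L : Fin m → ℝ) (α : Fin m → k)
      (P : MvPolynomial (Fin m) ℤ), P ≠ 0 → (∀ l, 1 ≤ d l) →
      (∀ l l', l < l' → (d l : ℝ) ≤ σ * d l') → (∀ l, RothPoint (α l) (L l)) →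
      (∀ l, degreeOf l P ≤ d l) →
      (∀ l, Real.log (wnorm absInt (fun _ => 1) P) + ∑ l', (d l' : ℝ) ≤ σ * (d l * L l)) →
      ∃ a, coeff a (translate (Int.castRingHom k) α P) ≠ 0 ∧ ∑ l, (a l : ℝ) / d l < θ := by
  induction m with
  | zero =>
    intro θ hθ
    refine ⟨1, one_pos, fun d L α P hP _ _ _ _ _ => ⟨0, ?_, by simpa using hθ⟩⟩
    obtain ⟨c, rfl⟩ := C_surjective (Fin 0) P
    rw [translate_C, coeff_zero_C]
    intro h
    apply hP
    have : c = 0 := by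
      have h' : ((c : ℤ) : k) = 0 := h
      exact_mod_cast h'
    rw [this, C_0]
  | succ m ih =>
    intro θ₀ hθ₀
    set θ : ℝ := min θ₀ 1 with hθdef
    have hθ : 0 < θ := lt_min hθ₀ one_pos
    have hθ1 : θ ≤ 1 := min_le_right _ _
    obtain ⟨σm, hσm, ihm⟩ := ih (θ ^ 2 / 64) (by positivity)
    set σ : ℝ := min (σm / 2) (θ ^ 2 / 128) with hσdef
    have hσ : 0 < σ := lt_min (by positivity) (by positivity)
    have hσ1 : 2 * σ ≤ σm := by have := min_le_left (σm / 2) (θ ^ 2 / 128); linarith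
    have hσ2 : σ ≤ θ ^ 2 / 128 := min_le_right _ _
    have hσ3 : σ ≤ θ / 2 := by nlinarith
    refine ⟨σ, hσ, fun d L α P hP hd hdd hα hdeg hnorm => ?_⟩
    by_contra hcon
    push Not at hcon
    obtain ⟨r, hr0, hrd, f, g, i, κ, c, hf, hg, hi, hκ, hU, hV, hW⟩ :=
      exists_wronskian_data k hP (hdeg 0)
    set φ := Int.castRingHom k with hφ
    set N := wnorm absInt (fun _ => 1) P with hN
    have hN1 : 1 ≤ N := one_le_wnorm_absInt hP
    have hlogN : 0 ≤ Real.log N := Real.log_nonneg hN1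
    set U := (Matrix.of fun s t => hasse (i t) (f s)).det with hUdef
    set V := (Matrix.of fun s t => hasse (κ t) (g s)).det with hVdef
    have hdpos : ∀ l, (0 : ℝ) < d l := fun l => by exact_mod_cast hd l
    have hrpos : (0 : ℝ) < r := by exact_mod_cast hr0
    have hsum : ∑ l, (d l : ℝ) = d 0 + ∑ l : Fin m, (d l.succ : ℝ) := Fin.sum_univ_succ _
    have hsum0 : (0 : ℝ) ≤ ∑ l : Fin m, (d l.succ : ℝ) :=
      Finset.sum_nonneg fun _ _ => Nat.cast_nonneg _
    have hdL : ∀ l, 0 ≤ (d l : ℝ) * L l := fun l => by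
      have h1 := hnorm l
      by_contra h2
      push Not at h2
      have := hdpos 0
      nlinarith
    have hlogU : Real.log (wnorm absInt (fun _ => 1) U) ≤
        r * (d 0 + ∑ l : Fin m, (d l.succ : ℝ) + Real.log N) := by
      have := log_wnorm_det_le (Matrix.of fun s t => hasse (i t) (f s)) hU
        (lt_of_lt_of_le one_pos hN1) (D := ∑ l : Fin m, d l.succ) hrd (fun s t => by
          refine (wnorm_hasse_le absInt (i t) (fun l => d l.succ) (f s)
            fun l => ((hf s).2 l).trans (hdeg _)).trans ?_
          exact mul_le_mul_of_nonneg_left (hf s).1 (by positivity))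
      push_cast at this
      exact this
    have hlogV : Real.log (wnorm absInt (fun _ => 1) V) ≤ r * (d 0 + d 0 + Real.log N) := by
      refine log_wnorm_det_le (Matrix.of fun s t => hasse (κ t) (g s)) hV
        (lt_of_lt_of_le one_pos hN1) (D := d 0) hrd (fun s t => ?_)
      have h1 := wnorm_hasse_le absInt (κ t) (fun _ => d 0) (g s) fun l => (hg s).2
      rw [Finset.univ_unique, Finset.sum_singleton] at h1
      exact h1.trans (mul_le_mul_of_nonneg_left (hg s).1 (by positivity))
    -- the induction hypothesis for `U`
    obtain ⟨a, ha, haθ⟩ := ihm (fun l => r * d l.succ) (fun l => L l.succ) (fun l => α l.succ) U hU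
      (fun l => Nat.mul_pos hr0 (hd _))
      (fun l l' hl => by
        push_cast
        have := hdd l.succ l'.succ (Fin.succ_lt_succ_iff.mpr hl)
        have h2 : (d l.succ : ℝ) ≤ σm * d l'.succ := this.trans (by
          have := hdpos l'.succ
          gcongr
          linarith)
        nlinarith)
      (fun l => hα _)
      (fun l => by
        have := degreeOf_det_le l (d l.succ) (Matrix.of fun s t => hasse (i t) (f s))
          (fun s t => (degreeOf_hasse_le _ _ _).trans (((hf s).2 l).trans (hdeg _)))
        simpa using this)
      (fun l => by
        push_cast
        rw [← Finset.mul_sum]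
        have h1 := hnorm l.succ
        have h2 := hdL l.succ
        rw [hsum] at h1
        have h3 : r * (d 0 + ∑ l : Fin m, (d l.succ : ℝ) + Real.log N) +
            r * ∑ l : Fin m, (d l.succ : ℝ) ≤ r * (2 * (σ * (d l.succ * L l.succ))) := by
          rw [← mul_add]
          have := hdpos 0
          gcongr
          linarith
        have h4 : r * (2 * (σ * (d l.succ * L l.succ))) ≤ r * (σm * (d l.succ * L l.succ)) := by
          have h5 := mul_le_mul_of_nonneg_right hσ1 h2
          refine mul_le_mul_of_nonneg_left ?_ (by positivity)
          linarith
        nlinarith)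
    obtain ⟨b, hb, hbL⟩ := hα 0 V hV
    have hL0 : 0 < L 0 := by
      have h1 := hnorm 0
      have h2 := hdpos 0
      by_contra h3
      push Not at h3
      have : σ * (d 0 * L 0) ≤ 0 := by
        have := mul_nonneg hσ.le h2.le
        nlinarith
      linarith
    have hbd : (b () : ℝ) / d 0 ≤ r * (2 * σ) := by
      rw [div_le_iff₀ (hdpos 0)]
      have h1 : (b () : ℝ) * L 0 ≤ (r * (2 * σ) * d 0) * L 0 := by
        have h2 := hnorm 0
        have h3 : r * (d 0 + d 0 + Real.log N) ≤ r * (2 * (σ * (d 0 * L 0))) := by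
          gcongr
          linarith
        calc _ ≤ _ := hbL
          _ ≤ _ := hlogV
          _ ≤ _ := h3
          _ = _ := by ring
      exact le_of_mul_le_mul_right h1 hL0
    -- the index of the Wronskian of `P`
    let w : Fin (m + 1) → ℝ := fun l => 1 / d l
    have hw : ∀ l, 0 ≤ w l := fun l => by positivity
    have hPidx : IndexGE w θ (translate φ α P) := fun e he => by
      refine (min_le_left _ _).trans ((hcon e he).trans_eq (Finset.sum_congr rfl fun l _ => ?_))
      simp only [w]
      ring
    have hcoef : coeff (Finsupp.cons (b ()) a) (translate φ α
        (Matrix.of fun s t => hasse (Finsupp.cons (κ t ()) (i s)) P).det) ≠ 0 := by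
      intro h0
      have h1 := congrArg (translate (RingHom.id k) α) hW
      rw [map_mul, translate_C, translate_map, translate_sep, translate_map, translate_map] at h1
      have h2 := congrArg (coeff (Finsupp.cons (b ()) a)) h1
      rw [coeff_C_mul, h0, mul_zero, coeff_sep] at h2
      exact mul_ne_zero ha hb h2.symm
    let F : ℕ → ℝ := fun j => max 0 (θ - σ - j / d 0)
    have hentry : ∀ s t, IndexGE w (F (κ t ()))
        (translate φ α (hasse (Finsupp.cons (κ t ()) (i s)) P)) := by
      intro s t e he
      refine max_le (indexGE_zero_of_nonneg hw _ e he) ?_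
      rw [← hasse_translate] at he
      refine le_trans ?_ (hPidx.hasse hw _ e he)
      rw [Fin.sum_univ_succ, Finsupp.cons_zero]
      simp only [Finsupp.cons_succ]
      have h1 : ∑ l : Fin m, w l.succ * (i s l : ℝ) ≤ σ := by
        calc ∑ l : Fin m, w l.succ * (i s l : ℝ) ≤ ∑ l : Fin m, σ / d 0 * (i s l : ℝ) := by
              refine Finset.sum_le_sum fun l _ => ?_
              gcongr
              simp only [w]
              rw [div_le_div_iff₀ (hdpos _) (hdpos _), one_mul]
              exact hdd 0 l.succ (Fin.succ_pos l)
          _ = σ / d 0 * ((∑ l : Fin m, i s l : ℕ) : ℝ) := by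
              rw [← Finset.mul_sum]; push_cast; rfl
          _ ≤ σ / d 0 * d 0 := by
              have := hi s
              have h2 : ((∑ l : Fin m, i s l : ℕ) : ℝ) ≤ d 0 := by
                exact_mod_cast this.trans (by omega)
              gcongr
          _ = σ := div_mul_cancel₀ _ (hdpos 0).ne'
      have h2 : w 0 * (κ t () : ℝ) = κ t () / d 0 := by simp only [w]; ring
      linarith
    have hdet : IndexGE w (∑ t, F (κ t ()))
        (translate φ α (Matrix.of fun s t => hasse (Finsupp.cons (κ t ()) (i s)) P).det) := by
      rw [RingHom.map_det]
      exact IndexGE.det (θ := fun t => F (κ t ())) hw hentry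
    have hκinj : Function.Injective fun t => κ t () := by
      intro t t' htt
      by_contra hne
      apply hV
      have : κ t = κ t' := Finsupp.ext fun _ => htt
      exact Matrix.det_zero_of_column_eq hne fun s => by simp [this]
    have hFsum : ∑ t, F (κ t ()) = ∑ j ∈ Finset.range r, F j := by
      have h1 : Finset.univ.image (fun t => κ t ()) = Finset.range r := by
        refine Finset.eq_of_subset_of_card_le (fun j hj => ?_) ?_
        · obtain ⟨t, -, rfl⟩ := Finset.mem_image.mp hj
          have := hκ t
          rw [Finset.mem_range]
          omega
        · rw [Finset.card_image_of_injective _ hκinj]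
          simp
      rw [← h1, Finset.sum_image fun _ _ _ _ h => hκinj h]
    have h1 := hdet _ hcoef
    rw [hFsum, Fin.sum_univ_succ, Finsupp.cons_zero] at h1
    simp only [Finsupp.cons_succ] at h1
    have h2 := sum_max_sub_div_ge (hd 0) hrd (x := θ - σ) (by linarith) (by linarith)
    have h3 : ∑ l : Fin m, w l.succ * (a l : ℝ) < r * (θ ^ 2 / 64) := by
      have h4 : ∑ l : Fin m, w l.succ * (a l : ℝ) =
          r * ∑ l : Fin m, (a l : ℝ) / ((r * d l.succ : ℕ) : ℝ) := by
        rw [Finset.mul_sum]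
        refine Finset.sum_congr rfl fun l _ => ?_
        have := hdpos l.succ
        simp only [w]
        push_cast
        field_simp
      rw [h4]
      exact mul_lt_mul_of_pos_left haθ hrpos
    have h5 : w 0 * (b () : ℝ) = b () / d 0 := by simp only [w]; ring
    have h6 : (θ / 2) ^ 2 ≤ (θ - σ) ^ 2 := by
      apply pow_le_pow_left₀ (by positivity)
      linarith
    have h7 : (r : ℝ) * (2 * σ) ≤ r * (θ ^ 2 / 64) := by
      gcongr
      linarith
    have h8 : (r : ℝ) * (θ / 2) ^ 2 ≤ r * (θ - σ) ^ 2 := by gcongr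
    have h9 : (r : ℝ) * (θ - σ) ^ 2 / 8 < r * (θ ^ 2 / 64) + r * (θ ^ 2 / 64) := by
      simp only [F] at h1
      linarith
    nlinarith

end

section

open Polynomial

theorem exists_isPrimitive_map_eq_minpoly {k : Type*} [Field k] [NumberField k] (α : k) :
    ∃ f : ℤ[X], f.IsPrimitive ∧ ∃ u : ℚ, u ≠ 0 ∧
      f.map (Int.castRingHom ℚ) = C u * minpoly ℚ α := by
  obtain ⟨b, hb, hg⟩ := IsLocalization.integerNormalization_spec (nonZeroDivisors ℤ) (minpoly ℚ α)
  set g : ℤ[X] := IsLocalization.integerNormalization (nonZeroDivisors ℤ) (minpoly ℚ α) with hgdef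
  have hα : IsIntegral ℚ α := Algebra.IsIntegral.isIntegral α
  have hb0 : b ≠ 0 := nonZeroDivisors.ne_zero hb
  have hg0 : g ≠ 0 := by
    rw [hgdef, Ne, IsLocalization.integerNormalization_eq_zero_iff le_rfl]
    exact minpoly.ne_zero hα
  have hc : (g.content : ℚ) ≠ 0 := by
    have : g.content ≠ 0 := by rwa [Ne, content_eq_zero_iff]
    exact_mod_cast this
  refine ⟨g.primPart, g.isPrimitive_primPart, b / g.content, div_ne_zero (by exact_mod_cast hb0) hc,
    ?_⟩
  have h1 := congrArg (Polynomial.map (Int.castRingHom ℚ)) g.eq_C_content_mul_primPart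
  rw [Polynomial.map_mul, Polynomial.map_C] at h1
  have hg' : g.map (Int.castRingHom ℚ) = C (b : ℚ) * minpoly ℚ α := by
    rw [show Int.castRingHom ℚ = algebraMap ℤ ℚ from rfl, hg, zsmul_eq_mul]
    simp
  rw [hg'] at h1
  have h2 : C (g.content : ℚ) ≠ 0 := by rwa [Ne, C_eq_zero]
  apply mul_left_cancel₀ h2
  rw [← mul_assoc, ← C_mul, mul_div_cancel₀ _ hc]
  exact h1.symm

theorem pow_rootMultiplicity_le_mahlerMeasure {k : Type*} [Field k] [NumberField k] {α : k}
    {f : ℤ[X]} (hf : f.IsPrimitive) {u : ℚ} (hu : u ≠ 0)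
    (hfu : f.map (Int.castRingHom ℚ) = C u * minpoly ℚ α) (n : ℕ) : ∀ V : ℤ[X], V ≠ 0 →
      rootMultiplicity α (V.map (Int.castRingHom k)) = n →
      (f.map (Int.castRingHom ℂ)).mahlerMeasure ^ n ≤
        (V.map (Int.castRingHom ℂ)).mahlerMeasure := by
  have hα : IsIntegral ℚ α := Algebra.IsIntegral.isIntegral α
  have hinj : Function.Injective (Int.castRingHom k) := Int.cast_injective
  have hmapk : ∀ V : ℤ[X], V.map (Int.castRingHom k) =
      (V.map (Int.castRingHom ℚ)).map (algebraMap ℚ k) := fun V => by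
    rw [Polynomial.map_map]; congr 1; exact RingHom.ext_int _ _
  have hf1 : rootMultiplicity α (f.map (Int.castRingHom k)) ≤ 1 := by
    rw [hmapk, hfu, Polynomial.map_mul, Polynomial.map_C]
    apply rootMultiplicity_le_one_of_separable
    have : IsUnit (C (algebraMap ℚ k u)) := by
      rw [isUnit_C]; exact (IsUnit.mk0 u hu).map _
    have h1 : (minpoly ℚ α).Separable := (minpoly.irreducible hα).separable
    obtain ⟨v, hv⟩ := this
    rw [← hv]
    exact (separable_def _).mpr <| by
      rw [hv, derivative_mul, derivative_C, zero_mul, zero_add]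
      have h2 := (separable_def _).mp (h1.map (f := algebraMap ℚ k))
      rw [← hv]
      exact (isCoprime_mul_unit_left v.isUnit _ _).mpr h2
  induction n with
  | zero => intro V hV _; simpa using one_le_mahlerMeasure_of_ne_zero hV
  | succ n ih =>
    intro V hV hn
    have hVk : V.map (Int.castRingHom k) ≠ 0 := (Polynomial.map_ne_zero_iff hinj).mpr hV
    have hroot : (V.map (Int.castRingHom k)).IsRoot α :=
      (rootMultiplicity_pos hVk).mp (by omega)
    have hdvd : f ∣ V := by
      rw [IsPrimitive.Int.dvd_iff_map_cast_dvd_map_cast _ _ hf, hfu]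
      refine (isUnit_C.mpr (IsUnit.mk0 u hu)).mul_left_dvd.mpr ?_
      apply minpoly.dvd
      rw [hmapk, IsRoot.def, eval_map] at hroot
      exact hroot
    obtain ⟨q, rfl⟩ := hdvd
    have hq : q ≠ 0 := right_ne_zero_of_mul hV
    rw [Polynomial.map_mul] at hVk hn
    rw [rootMultiplicity_mul hVk] at hn
    obtain ⟨j, hj⟩ : ∃ j, rootMultiplicity α (q.map (Int.castRingHom k)) = n + j :=
      ⟨rootMultiplicity α (q.map (Int.castRingHom k)) - n, by omega⟩
    have hf0 : f ≠ 0 := left_ne_zero_of_mul hV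
    have h1 := one_le_mahlerMeasure_of_ne_zero hf0
    rw [Polynomial.map_mul, mahlerMeasure_mul, pow_succ', ]
    rcases Nat.eq_zero_or_pos j with rfl | hj0
    · exact mul_le_mul_of_nonneg_left (ih q hq hj) (by linarith)
    · have h3 : rootMultiplicity α (f.map (Int.castRingHom k)) = 0 := by omega
      have h4 : (f.map (Int.castRingHom k)).IsRoot α := by
        rw [hmapk, IsRoot.def, eval_map]
        change aeval α _ = 0
        rw [hfu, map_mul, minpoly.aeval, mul_zero]
      have h5 := (rootMultiplicity_pos ((Polynomial.map_ne_zero_iff hinj).mpr hf0)).mpr h4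
      omega

theorem uniqueAlgEquiv_translate {R S : Type*} [CommRing R] [CommRing S] (φ : R →+* S) (α : S)
    (V : MvPolynomial Unit R) :
    MvPolynomial.uniqueAlgEquiv S Unit (MvPolynomial.translate φ (fun _ => α) V) =
      ((MvPolynomial.uniqueAlgEquiv R Unit V).map φ).comp (X + C α) := by
  have : ((MvPolynomial.uniqueAlgEquiv S Unit).toRingEquiv.toRingHom).comp
      (MvPolynomial.translate φ (fun _ => α)) = ((compRingHom (X + C α)).comp (mapRingHom φ)).comp
        (MvPolynomial.uniqueAlgEquiv R Unit).toRingEquiv.toRingHom := by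
    apply MvPolynomial.ringHom_ext <;> simp [MvPolynomial.translate]
  exact congrArg (fun g => g V) this

theorem mahlerMeasure_uniqueAlgEquiv_le (V : MvPolynomial Unit ℤ) :
    ((MvPolynomial.uniqueAlgEquiv ℤ Unit V).map (Int.castRingHom ℂ)).mahlerMeasure ≤
      MvPolynomial.wnorm absInt (fun _ => 1) V := by
  refine (mahlerMeasure_le_sum_norm_coeff _).trans ?_
  set q := MvPolynomial.uniqueAlgEquiv ℤ Unit V
  have h0 : (q.map (Int.castRingHom ℂ)).support ⊆ q.support := support_map_subset _ _
  rw [Polynomial.sum_eq_of_subset _ (by simp) h0]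
  have h1 : ∀ n ∈ q.support, ‖(q.map (Int.castRingHom ℂ)).coeff n‖ =
      absInt (MvPolynomial.coeff (Finsupp.single default n) V) := by
    intro n _
    rw [coeff_map, ← MvPolynomial.coeff_uniqueAlgEquiv, absInt_apply]
    simp [q]
  rw [Finset.sum_congr rfl h1]
  have hinj : Function.Injective fun n : ℕ => (Finsupp.single () n) :=
    Finsupp.single_injective ()
  have h2 : V.support ⊆ q.support.map ⟨_, hinj⟩ := by
    intro e he
    rw [Finset.mem_map]
    refine ⟨e (), ?_, ?_⟩
    · rw [mem_support_iff, MvPolynomial.coeff_uniqueAlgEquiv]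
      have : Finsupp.single default (e ()) = e := by ext; simp
      rw [this]
      exact MvPolynomial.mem_support_iff.mp he
    · ext; simp
  rw [MvPolynomial.wnorm_eq_of_subset _ _ h2, Finset.sum_map]
  simp

/-- Either `α` has a small integral numerator and denominator, or it is far from being a root of
high multiplicity of polynomials of small height. -/
theorem rothPoint_or_small {k : Type*} [Field k] [NumberField k] (α : k) {A : ℝ} (hA : 1 ≤ A) :
    (∃ a : ℤ, a ≠ 0 ∧ |(a : ℝ)| ≤ A ∧ IsIntegral ℤ ((a : k) * α) ∧
      ∀ φ : k →+* ℂ, ‖φ (a * α)‖ ≤ A) ∨ RothPoint α (Real.log A) := by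
  obtain ⟨f, hf, u, hu, hfu⟩ := exists_isPrimitive_map_eq_minpoly α
  have hmapf : f.map (Int.castRingHom k) = (f.map (Int.castRingHom ℚ)).map (algebraMap ℚ k) := by
    rw [Polynomial.map_map]; congr 1; exact RingHom.ext_int _ _
  have hroot : aeval α f = 0 := by
    have : eval α (f.map (Int.castRingHom k)) = 0 := by
      rw [hmapf, hfu, eval_map]
      change aeval α _ = 0
      rw [map_mul, minpoly.aeval, mul_zero]
    rwa [eval_map] at this
  by_cases hM : (f.map (Int.castRingHom ℂ)).mahlerMeasure ≤ A
  · left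
    have hlc : (f.map (Int.castRingHom ℂ)).leadingCoeff = (f.leadingCoeff : ℂ) := by
      rw [leadingCoeff_map_of_injective (Int.castRingHom ℂ).injective_int, eq_intCast]
    have hf0 := hf.ne_zero
    refine ⟨f.leadingCoeff, leadingCoeff_ne_zero.mpr hf0, ?_, ?_, fun φ => ?_⟩
    · have := leadingCoeff_le_mahlerMeasure (f.map (Int.castRingHom ℂ))
      rw [hlc] at this
      simpa using this.trans hM
    · simpa [zsmul_eq_mul] using isIntegral_leadingCoeff_smul (R := ℤ) f α hroot
    · refine le_trans ?_ hM
      rw [mahlerMeasure_eq_leadingCoeff_mul_prod_roots, hlc, map_mul, norm_mul, map_intCast]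
      refine mul_le_mul_of_nonneg_left ?_ (norm_nonneg _)
      have hfc : f.map (Int.castRingHom ℂ) ≠ 0 :=
        (Polynomial.map_ne_zero_iff (Int.castRingHom ℂ).injective_int).mpr hf0
      have hmem : φ α ∈ (f.map (Int.castRingHom ℂ)).roots := by
        rw [mem_roots hfc, IsRoot.def, eval_map]
        have h1 := congrArg φ hroot
        rw [map_zero, aeval_def, hom_eval₂] at h1
        rwa [RingHom.ext_int (Int.castRingHom ℂ) (φ.comp (algebraMap ℤ k))]
      refine (le_max_right 1 _).trans ?_
      rw [← Multiset.cons_erase hmem, Multiset.map_cons, Multiset.prod_cons]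
      refine le_mul_of_one_le_right (by positivity) ?_
      apply Multiset.one_le_prod
      intro x hx
      rw [Multiset.mem_map] at hx
      obtain ⟨y, _, rfl⟩ := hx
      exact le_max_left _ _
  · right
    push Not at hM
    intro V hV
    set q := MvPolynomial.uniqueAlgEquiv ℤ Unit V with hq
    have hq0 : q ≠ 0 := by rwa [hq, Ne, EmbeddingLike.map_eq_zero_iff]
    have hqk : q.map (Int.castRingHom k) ≠ 0 :=
      (Polynomial.map_ne_zero_iff (Int.castRingHom k).injective_int).mpr hq0
    have hcomp : (q.map (Int.castRingHom k)).comp (X + C α) ≠ 0 := by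
      rw [← uniqueAlgEquiv_translate]
      rw [Ne, EmbeddingLike.map_eq_zero_iff]
      intro h
      have h2 := uniqueAlgEquiv_translate (Int.castRingHom k) α V
      rw [h, map_zero] at h2
      have h3 := congrArg (fun p => p.comp (X - C α)) h2
      simp only [zero_comp, comp_assoc] at h3
      rw [add_comp, X_comp, C_comp, sub_add_cancel, comp_X] at h3
      exact hqk h3.symm
    set n := rootMultiplicity α (q.map (Int.castRingHom k)) with hn
    refine ⟨Finsupp.single () n, ?_, ?_⟩
    · have := MvPolynomial.coeff_uniqueAlgEquiv k
        (MvPolynomial.translate (Int.castRingHom k) (fun _ => α) V) n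
      rw [show Finsupp.single () n = Finsupp.single default n from rfl, ← this,
        uniqueAlgEquiv_translate, hn, rootMultiplicity_eq_natTrailingDegree]
      exact trailingCoeff_nonzero_iff_nonzero.mpr hcomp
    · have h1 := pow_rootMultiplicity_le_mahlerMeasure hf hu hfu n q hq0 hn.symm
      have h2 := h1.trans (mahlerMeasure_uniqueAlgEquiv_le V)
      have h3 : A ^ n ≤ MvPolynomial.wnorm absInt (fun _ => 1) V :=
        (pow_le_pow_left₀ (by linarith) hM.le n).trans h2
      have h4 := Real.log_le_log (by positivity) h3
      rw [Real.log_pow] at h4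
      simpa using h4

end

section

open MvPolynomial

section BinaryReduction

variable {k : Type*} [Field k] {m : ℕ} {J : Type*} [Fintype J] [DecidableEq J]

/-- The parametrisation of block `l` by the rows `I ≠ o` of `Y l`, together with the coordinate
vector of index `i l`. -/
noncomputable def blockForm (o : J) (i : Fin m → J) (Y : Fin m → Matrix J J k) (x : Fin m × J) :
    MvPolynomial (Fin m × J) k :=
  ∑ I, if I = o then (if x.2 = i x.1 then X (x.1, o) else 0) else C (Y x.1 I x.2) * X (x.1, I)

/-- The exponents of the variables other than those of index `i l` and `q l`. -/
noncomputable def otherExponents (i q : Fin m → J) (e : Fin m × J →₀ ℕ) : Fin m × J →₀ ℕ :=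
  e.filter fun x => x.2 ≠ i x.1 ∧ x.2 ≠ q x.1

/-- The exponents of the variables of index `i l`. -/
noncomputable def mainExponents (i : Fin m → J) (e : Fin m × J →₀ ℕ) : Fin m →₀ ℕ :=
  Finsupp.equivFunOnFinite.symm fun l => e (l, i l)

theorem eq_of_mainExponents_eq {i q : Fin m → J} {d : Fin m → ℕ}
    {e f : Fin m × J →₀ ℕ} (he : ∀ l, ∑ j, e (l, j) = d l) (hf : ∀ l, ∑ j, f (l, j) = d l)
    (h1 : otherExponents i q e = otherExponents i q f)
    (h2 : mainExponents i e = mainExponents i f) : e = f := by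
  have hi : ∀ l, e (l, i l) = f (l, i l) := fun l => by
    simpa [mainExponents] using DFunLike.congr_fun h2 l
  have ho : ∀ l j, j ≠ i l → j ≠ q l → e (l, j) = f (l, j) := fun l j h3 h4 => by
    have := DFunLike.congr_fun h1 (l, j)
    rwa [otherExponents, otherExponents, Finsupp.filter_apply_pos _ _ ⟨h3, h4⟩,
      Finsupp.filter_apply_pos _ _ ⟨h3, h4⟩] at this
  ext ⟨l, j⟩
  by_cases hj : j = q l
  · subst hj
    have h3 := (he l).trans (hf l).symm
    rw [← Finset.add_sum_erase _ _ (Finset.mem_univ (q l)),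
      ← Finset.add_sum_erase _ _ (Finset.mem_univ (q l))] at h3
    have h4 : ∑ j ∈ Finset.univ.erase (q l), e (l, j) =
        ∑ j ∈ Finset.univ.erase (q l), f (l, j) := by
      refine Finset.sum_congr rfl fun j hj => ?_
      by_cases h5 : j = i l
      · rw [h5, hi]
      · exact ho l j h5 (Finset.ne_of_mem_erase hj)
    omega
  · by_cases h5 : j = i l
    · rw [h5, hi]
    · exact ho l j h5 hj

/-- The specialisation of the variables to a generic point of the hyperplanes. -/
noncomputable def hyperplanePoint (i q : Fin m → J) (ξ : Fin m → J → k) (x : Fin m × J) :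
    MvPolynomial (Fin m × J) k :=
  if x.2 = i x.1 then
    C (-ξ x.1 (q x.1) / ξ x.1 (i x.1)) -
      ∑ j ∈ Finset.univ.filter (fun j => j ≠ i x.1 ∧ j ≠ q x.1),
        C (ξ x.1 j / ξ x.1 (i x.1)) * X (x.1, j)
  else if x.2 = q x.1 then 1 else X x

theorem sum_mul_hyperplanePoint {i q : Fin m → J} (hiq : ∀ l, q l ≠ i l) {ξ : Fin m → J → k}
    (hξ : ∀ l, ξ l (i l) ≠ 0) (l : Fin m) :
    ∑ j, C (ξ l j) * hyperplanePoint i q ξ (l, j) = 0 := by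
  classical
  have h1 : (Finset.univ : Finset J) =
      insert (i l) (insert (q l) (Finset.univ.filter (fun j => j ≠ i l ∧ j ≠ q l))) := by
    ext j
    simp only [Finset.mem_univ, Finset.mem_insert, Finset.mem_filter, true_and, true_iff]
    tauto
  conv_lhs => rw [h1]
  rw [Finset.sum_insert (by simp [(hiq l).symm]), Finset.sum_insert (by simp)]
  have h2 : ∀ j ∈ Finset.univ.filter (fun j => j ≠ i l ∧ j ≠ q l),
      C (ξ l j) * hyperplanePoint i q ξ (l, j) = C (ξ l j) * X (l, j) := by
    intro j hj
    rw [Finset.mem_filter] at hj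
    simp [hyperplanePoint, hj.2.1, hj.2.2]
  rw [Finset.sum_congr rfl h2]
  simp only [hyperplanePoint, if_true, hiq l, if_false]
  rw [mul_sub, Finset.mul_sum, ← C_mul, mul_div_cancel₀ _ (hξ l), mul_one]
  have h3 : ∀ j ∈ Finset.univ.filter (fun j => j ≠ i l ∧ j ≠ q l),
      C (ξ l (i l)) * (C (ξ l j / ξ l (i l)) * X (l, j)) =
        (C (ξ l j) * X (l, j) : MvPolynomial (Fin m × J) k) := by
    intro j _
    rw [← mul_assoc, ← C_mul, mul_div_cancel₀ _ (hξ l)]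
  rw [Finset.sum_congr rfl h3, C_neg]
  ring

theorem exists_hyperplanePoint_eq {i q : Fin m → J} (hiq : ∀ l, q l ≠ i l) {ξ : Fin m → J → k}
    (hξ : ∀ l, ξ l (i l) ≠ 0) {Y : Fin m → Matrix J J k} (hY : ∀ l, (Y l).det ≠ 0) {o : J}
    (hYξ : ∀ l, ∀ I ≠ o, ∑ j, Y l I j * ξ l j = 0) :
    ∃ a : Fin m → J → MvPolynomial (Fin m × J) k, ∀ l j,
      hyperplanePoint i q ξ (l, j) = ∑ I ∈ Finset.univ.erase o, C (Y l I j) * a l I := by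
  refine ⟨fun l I => ∑ j, C ((Y l)⁻¹ j I) * hyperplanePoint i q ξ (l, j), fun l j => ?_⟩
  have hu : IsUnit (Y l).det := (hY l).isUnit
  obtain ⟨c, h1⟩ : ∃ c, Matrix.mulVec (Y l) (ξ l) = Pi.single o c := by
    refine ⟨∑ j, Y l o j * ξ l j, ?_⟩
    ext I
    by_cases hI : I = o
    · subst hI; simp [Matrix.mulVec, dotProduct]
    · rw [Pi.single_eq_of_ne hI]; exact hYξ l I hI
  have h2 : ∀ j', ξ l j' = (Y l)⁻¹ j' o * c := fun j' => by
    have h3 := congrArg (Matrix.mulVec (Y l)⁻¹) h1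
    rw [Matrix.mulVec_mulVec, Matrix.nonsing_inv_mul _ hu, Matrix.one_mulVec] at h3
    rw [h3, Matrix.mulVec_single]
    simp
  have hc0 : C c ≠ (0 : MvPolynomial (Fin m × J) k) := by
    intro h
    rw [C_eq_zero] at h
    exact hξ l (by rw [h2, h, mul_zero])
  have h4 : ∑ j', C ((Y l)⁻¹ j' o) * hyperplanePoint i q ξ (l, j') = 0 := by
    have h5 := sum_mul_hyperplanePoint hiq hξ l
    simp only [h2 _, C_mul, mul_right_comm _ (C c)] at h5
    rw [← Finset.sum_mul] at h5
    exact (mul_eq_zero.mp h5).resolve_right hc0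
  have h6 : hyperplanePoint i q ξ (l, j) =
      ∑ I, C (Y l I j) * ∑ j', C ((Y l)⁻¹ j' I) * hyperplanePoint i q ξ (l, j') := by
    simp only [Finset.mul_sum]
    rw [Finset.sum_comm]
    have h7 : ∀ j', ∑ I, C (Y l I j) * (C ((Y l)⁻¹ j' I) * hyperplanePoint i q ξ (l, j')) =
        C ((1 : Matrix J J k) j' j) * hyperplanePoint i q ξ (l, j') := by
      intro j'
      rw [← Matrix.nonsing_inv_mul _ hu, Matrix.mul_apply, map_sum, Finset.sum_mul]
      refine Finset.sum_congr rfl fun I _ => ?_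
      rw [C_mul]
      ring
    simp only [h7]
    rw [Finset.sum_eq_single j]
    · simp
    · intro j' _ hj; simp [Matrix.one_apply_ne hj]
    · simp
  rw [h6, ← Finset.add_sum_erase _ _ (Finset.mem_univ o), h4, mul_zero, zero_add]

end BinaryReduction

end

section

open MvPolynomial

section BinaryReduction

variable {k : Type*} [Field k] {m : ℕ} {J : Type*} [Fintype J] [DecidableEq J]

/-- Evaluation at a generic point of the hyperplanes plus generic multiples of coordinate
vectors. -/
noncomputable def genericEval (i q : Fin m → J) (ξ : Fin m → J → k) :
    MvPolynomial (Fin m × J) ℤ →+* MvPolynomial (Fin m × J) (MvPolynomial (Fin m) k) :=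
  eval₂Hom (C.comp (C.comp (Int.castRingHom k))) fun x =>
    map C (hyperplanePoint i q ξ x) + if x.2 = i x.1 then C (X x.1) else 0

theorem genericEval_eq {i q : Fin m → J} {ξ : Fin m → J → k} {o : J} {Y : Fin m → Matrix J J k}
    {a : Fin m → J → MvPolynomial (Fin m × J) k}
    (ha : ∀ l j, hyperplanePoint i q ξ (l, j) = ∑ I ∈ Finset.univ.erase o, C (Y l I j) * a l I)
    (P : MvPolynomial (Fin m × J) ℤ) :
    genericEval i q ξ P = eval₂Hom (C.comp C)
      (fun x => if x.2 = o then C (X x.1) else map C (a x.1 x.2))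
      (eval₂Hom (C.comp (Int.castRingHom k)) (blockForm o i Y) P) := by
  have : genericEval i q ξ = (eval₂Hom (C.comp C)
      (fun x => if x.2 = o then C (X x.1) else map C (a x.1 x.2))).comp
      (eval₂Hom (C.comp (Int.castRingHom k)) (blockForm o i Y)) := by
    apply ringHom_ext
    · intro r; simp [genericEval]
    · rintro ⟨l, j⟩
      rw [RingHom.comp_apply]
      simp only [genericEval, coe_eval₂Hom, eval₂_X]
      rw [ha, blockForm, ← Finset.add_sum_erase _ _ (Finset.mem_univ o), if_pos rfl, add_comm,
        ← coe_eval₂Hom, map_add, map_sum, map_sum]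
      congr 1
      · split_ifs <;> simp
      · refine Finset.sum_congr rfl fun I hI => ?_
        simp [Finset.ne_of_mem_erase hI]
  rw [this, RingHom.comp_apply]

theorem exists_coeff_of_coeff_genericEval {i q : Fin m → J} {ξ : Fin m → J → k} {o : J}
    {Y : Fin m → Matrix J J k} {a : Fin m → J → MvPolynomial (Fin m × J) k}
    (ha : ∀ l j, hyperplanePoint i q ξ (l, j) = ∑ I ∈ Finset.univ.erase o, C (Y l I j) * a l I)
    (P : MvPolynomial (Fin m × J) ℤ) (ε : Fin m × J →₀ ℕ) (n : Fin m →₀ ℕ)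
    (h : coeff n (coeff ε (genericEval i q ξ P)) ≠ 0) :
    ∃ f, coeff f (eval₂Hom (C.comp (Int.castRingHom k)) (blockForm o i Y) P) ≠ 0 ∧
      ∀ l, f (l, o) = n l := by
  rw [genericEval_eq ha, coe_eval₂Hom, eval₂_eq', coeff_sum, coeff_sum] at h
  obtain ⟨f, hf, hne⟩ := Finset.exists_ne_zero_of_sum_ne_zero h
  refine ⟨f, mem_support_iff.mp hf, ?_⟩
  set c := coeff f (eval₂Hom (C.comp (Int.castRingHom k)) (blockForm o i Y) P)
  have h1 : ∏ x : Fin m × J, (if x.2 = o then C (X x.1) else map C (a x.1 x.2) :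
      MvPolynomial (Fin m × J) (MvPolynomial (Fin m) k)) ^ f x =
      C (monomial (Finsupp.equivFunOnFinite.symm fun l => f (l, o)) 1) *
        map C (∏ x : Fin m × J, if x.2 = o then 1 else a x.1 x.2 ^ f x) := by
    rw [map_prod]
    have h2 : ∀ x : Fin m × J, (if x.2 = o then C (X x.1) else map C (a x.1 x.2) :
        MvPolynomial (Fin m × J) (MvPolynomial (Fin m) k)) ^ f x =
        (if x.2 = o then C (X x.1 ^ f x) else 1) *
          map C (if x.2 = o then 1 else a x.1 x.2 ^ f x) := by
      intro x
      split_ifs <;> simp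
    rw [Finset.prod_congr rfl fun x _ => h2 x, Finset.prod_mul_distrib]
    congr 1
    rw [Fintype.prod_prod_type, monomial_eq, C_1, one_mul, Finsupp.prod_fintype _ _ (by simp),
      map_prod]
    refine Finset.prod_congr rfl fun l _ => ?_
    rw [Finset.prod_eq_single o]
    · simp
    · intro b _ hb; simp [hb]
    · simp
  rw [h1, RingHom.comp_apply, mul_left_comm, coeff_C_mul] at hne
  rw [coeff_C_mul, coeff_map, ← C_mul, mul_comm, coeff_C_mul, coeff_monomial] at hne
  intro l
  have h3 := (ite_ne_right_iff.mp (right_ne_zero_of_mul hne)).1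
  rw [← h3]; rfl

theorem coeff_genericEval_monomial {i q : Fin m → J} (hiq : ∀ l, q l ≠ i l) (ξ : Fin m → J → k)
    (e ε : Fin m × J →₀ ℕ) (c : ℤ) (h : ε.degree ≤ (otherExponents i q e).degree) :
    coeff ε (genericEval i q ξ (monomial e c)) = if otherExponents i q e = ε then
      translate (Int.castRingHom k) (fun l => -ξ l (q l) / ξ l (i l))
        (monomial (mainExponents i e) c) else 0 := by
  let B : Fin m × J → MvPolynomial (Fin m × J) (MvPolynomial (Fin m) k) := fun x =>
    if x.2 = i x.1 then map C (hyperplanePoint i q ξ x) + C (X x.1) else 1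
  have h1 : genericEval i q ξ (monomial e c) =
      C (C (c : k)) * (monomial (otherExponents i q e) 1 * ∏ x, B x ^ e x) := by
    rw [genericEval, coe_eval₂Hom, eval₂_monomial, Finsupp.prod_fintype _ _ (by simp)]
    congr 1
    rw [monomial_eq, C_1, one_mul, Finsupp.prod_fintype _ _ (by simp), ← Finset.prod_mul_distrib]
    refine Finset.prod_congr rfl fun x _ => ?_
    simp only [B, otherExponents, hyperplanePoint]
    by_cases h2 : x.2 = i x.1
    · rw [Finsupp.filter_apply_neg _ _ (by simp [h2])]
      simp [h2]
    · by_cases h3 : x.2 = q x.1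
      · rw [Finsupp.filter_apply_neg _ _ (by simp [h3])]
        simp [h3, hiq]
      · rw [Finsupp.filter_apply_pos _ _ ⟨h2, h3⟩]
        simp [h2, h3]
  rw [h1, coeff_C_mul, coeff_monomial_mul']
  by_cases h2 : otherExponents i q e = ε
  · rw [if_pos h2.le, if_pos h2, h2, tsub_self, one_mul]
    rw [← constantCoeff_eq, map_prod, Fintype.prod_prod_type]
    rw [MvPolynomial.translate, coe_eval₂Hom, eval₂_monomial, Finsupp.prod_fintype _ _ (by simp)]
    congr 1
    refine Finset.prod_congr rfl fun l _ => ?_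
    rw [Finset.prod_eq_single (i l)]
    · rw [map_pow]
      congr 1
      simp only [B, if_true, map_add, constantCoeff_C, constantCoeff_map]
      simp [hyperplanePoint, map_sum, add_comm]
    · intro b _ hb; simp [B, hb]
    · simp
  · rw [if_neg h2, if_neg, mul_zero]
    intro h3
    apply h2
    obtain ⟨δ, hδ⟩ := exists_add_of_le h3
    have h4 : δ.degree = 0 := by rw [hδ, map_add] at h; omega
    rw [Finsupp.degree_eq_zero_iff] at h4
    rw [hδ, h4, add_zero]

theorem exists_binary_reduction {i q : Fin m → J} (hiq : ∀ l, q l ≠ i l) {ξ : Fin m → J → k}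
    (hξ : ∀ l, ξ l (i l) ≠ 0) {Y : Fin m → Matrix J J k} (hY : ∀ l, (Y l).det ≠ 0) {o : J}
    (hYξ : ∀ l, ∀ I ≠ o, ∑ j, Y l I j * ξ l j = 0) {d : Fin m → ℕ}
    (P : MvPolynomial (Fin m × J) ℤ) (hP : P ≠ 0)
    (hd : ∀ e ∈ P.support, ∀ l, ∑ j, e (l, j) = d l) :
    ∃ Q : MvPolynomial (Fin m) ℤ, Q ≠ 0 ∧ (∀ l, degreeOf l Q ≤ d l) ∧
      wnorm absInt (fun _ => 1) Q ≤ wnorm absInt (fun _ => 1) P ∧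
      ∀ n, coeff n (translate (Int.castRingHom k) (fun l => -ξ l (q l) / ξ l (i l)) Q) ≠ 0 →
        ∃ f, coeff f (eval₂Hom (C.comp (Int.castRingHom k)) (blockForm o i Y) P) ≠ 0 ∧
          ∀ l, f (l, o) = n l := by
  classical
  obtain ⟨a, ha⟩ := exists_hyperplanePoint_eq hiq hξ hY hYξ
  obtain ⟨e₀, he₀, hmin⟩ := Finset.exists_min_image P.support
    (fun e => (otherExponents i q e).degree) (support_nonempty.mpr hP)
  set ε := otherExponents i q e₀
  set F := P.support.filter fun e => otherExponents i q e = ε with hF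
  have hinj : Set.InjOn (mainExponents i) (F : Set (Fin m × J →₀ ℕ)) := by
    intro e he f hf h
    rw [Finset.mem_coe, hF, Finset.mem_filter] at he hf
    exact eq_of_mainExponents_eq (hd e he.1) (hd f hf.1) (he.2.trans hf.2.symm) h
  have hcoeff : ∀ e ∈ F, coeff (mainExponents i e)
      (∑ e ∈ F, monomial (mainExponents i e) (coeff e P)) = coeff e P := by
    intro e he
    rw [coeff_sum, Finset.sum_eq_single e]
    · rw [coeff_monomial, if_pos rfl]
    · intro f hf hfe
      rw [coeff_monomial, if_neg fun h => hfe (hinj hf he h)]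
    · exact fun h => absurd he h
  refine ⟨∑ e ∈ F, monomial (mainExponents i e) (coeff e P), ?_, ?_, ?_, ?_⟩
  · intro h
    have h1 := hcoeff e₀ (Finset.mem_filter.mpr ⟨he₀, rfl⟩)
    rw [h, coeff_zero] at h1
    exact mem_support_iff.mp he₀ h1.symm
  · intro l
    refine (degreeOf_sum_le _ _ _).trans (Finset.sup_le fun e he => ?_)
    refine (degreeOf_le_iff.mpr fun n hn => ?_)
    rw [Finset.mem_singleton.mp (support_monomial_subset hn)]
    rw [← hd e (Finset.mem_filter.mp he).1 l]
    exact Finset.single_le_sum (f := fun j => e (l, j)) (fun _ _ => Nat.zero_le _)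
      (Finset.mem_univ (i l))
  · refine (wnorm_sum_le _ (fun _ => zero_le_one) _ _).trans ?_
    rw [wnorm]
    simp only [wnorm_monomial, monomialWeight_one, mul_one]
    exact Finset.sum_le_sum_of_subset_of_nonneg (Finset.filter_subset _ _)
      fun _ _ _ => absInt.nonneg _
  · intro n hn
    refine exists_coeff_of_coeff_genericEval ha P ε n ?_
    have h5 : coeff ε (genericEval i q ξ P) = translate (Int.castRingHom k)
        (fun l => -ξ l (q l) / ξ l (i l)) (∑ e ∈ F, monomial (mainExponents i e) (coeff e P)) := by
      have h6 := congrArg (fun p => coeff ε (genericEval i q ξ p)) P.as_sum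
      refine h6.trans ?_
      rw [map_sum, map_sum, coeff_sum, hF, Finset.sum_filter]
      exact Finset.sum_congr rfl fun e he =>
        coeff_genericEval_monomial hiq ξ e ε _ (hmin e he)
    rwa [h5]

end BinaryReduction

end

section Deviation

theorem sum_piFinset_mul_apply {m : ℕ} {X : Type*} [DecidableEq X] (S : Fin m → Finset X)
    (g : Fin m → X → ℝ) (h0 : ∀ l, ∑ x ∈ S l, g l x = 0) {l l' : Fin m} (hl : l ≠ l') :
    ∑ x ∈ Fintype.piFinset S, g l (x l) * g l' (x l') = 0 := by
  have h1 := Finset.prod_univ_sum S fun j x =>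
    (if j = l then g l x else 1) * (if j = l' then g l' x else 1)
  have h2 : ∀ x : Fin m → X, ∏ j, ((if j = l then g l (x j) else 1) *
      (if j = l' then g l' (x j) else 1)) = g l (x l) * g l' (x l') := by
    intro x
    rw [Finset.prod_mul_distrib]
    simp
  simp only [h2] at h1
  rw [← h1, Finset.prod_eq_zero (Finset.mem_univ l)]
  simp [hl, h0]

/-- Chebyshev's inequality for a sum of independent bounded centred variables. -/
theorem card_deviation_mul_le {m : ℕ} {X : Type*} [DecidableEq X] (S : Fin m → Finset X)
    (g : Fin m → X → ℝ) {c : ℝ} (hc : ∀ l, ∀ x ∈ S l, |g l x| ≤ c)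
    (h0 : ∀ l, ∑ x ∈ S l, g l x = 0) {t : ℝ} (ht : 0 < t) :
    ((Fintype.piFinset S).filter fun x => t ≤ ∑ l, g l (x l)).card * t ^ 2 ≤
      m * c ^ 2 * (Fintype.piFinset S).card := by
  have h1 : ∑ x ∈ Fintype.piFinset S, (∑ l, g l (x l)) ^ 2 ≤
      m * c ^ 2 * (Fintype.piFinset S).card := by
    have h2 : ∑ x ∈ Fintype.piFinset S, (∑ l, g l (x l)) ^ 2 =
        ∑ l, ∑ x ∈ Fintype.piFinset S, g l (x l) ^ 2 := by
      simp only [pow_two, Finset.sum_mul_sum]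
      rw [Finset.sum_comm]
      refine Finset.sum_congr rfl fun l _ => ?_
      rw [Finset.sum_comm, Finset.sum_eq_single l]
      · intro l' _ hl
        exact sum_piFinset_mul_apply S g h0 hl.symm
      · simp
    rw [h2]
    calc ∑ l, ∑ x ∈ Fintype.piFinset S, g l (x l) ^ 2
        ≤ ∑ _l : Fin m, ∑ _x ∈ Fintype.piFinset S, c ^ 2 := by
          refine Finset.sum_le_sum fun l _ => Finset.sum_le_sum fun x hx => ?_
          rw [← sq_abs]
          exact pow_le_pow_left₀ (abs_nonneg _) (hc l _ (Fintype.mem_piFinset.mp hx l)) 2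
      _ = _ := by simp; ring
  refine le_trans ?_ h1
  rw [← nsmul_eq_mul, ← Finset.sum_const]
  refine le_trans (Finset.sum_le_sum fun x hx => ?_)
    (Finset.sum_le_sum_of_subset_of_nonneg (Finset.filter_subset _ _) fun _ _ _ => sq_nonneg _)
  exact pow_le_pow_left₀ ht.le (Finset.mem_filter.mp hx).2 2

variable {J : Type*} [Fintype J] [DecidableEq J]

theorem sum_piAntidiag_apply_eq (d : ℕ) (i j : J) :
    ∑ x ∈ Finset.piAntidiag (Finset.univ : Finset J) d, x i =
      ∑ x ∈ Finset.piAntidiag (Finset.univ : Finset J) d, x j := by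
  refine Finset.sum_nbij' (fun x => x ∘ Equiv.swap i j) (fun x => x ∘ Equiv.swap i j) ?_ ?_ ?_ ?_ ?_
  · intro x hx
    simp only [Finset.mem_piAntidiag, Finset.mem_univ, implies_true, and_true] at hx ⊢
    rw [← hx]; exact Equiv.sum_comp (Equiv.swap i j) x
  · intro x hx
    simp only [Finset.mem_piAntidiag, Finset.mem_univ, implies_true, and_true] at hx ⊢
    rw [← hx]; exact Equiv.sum_comp (Equiv.swap i j) x
  · intro x _; ext; simp
  · intro x _; ext; simp
  · intro x _; simp

theorem card_mul_sum_piAntidiag_apply (d : ℕ) (i : J) :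
    Fintype.card J * ∑ x ∈ Finset.piAntidiag (Finset.univ : Finset J) d, x i =
      d * (Finset.piAntidiag (Finset.univ : Finset J) d).card := by
  have h1 : ∑ x ∈ Finset.piAntidiag (Finset.univ : Finset J) d, ∑ j, x j =
      d * (Finset.piAntidiag (Finset.univ : Finset J) d).card := by
    rw [mul_comm, ← smul_eq_mul, ← Finset.sum_const]
    exact Finset.sum_congr rfl fun x hx => (Finset.mem_piAntidiag.mp hx).1
  rw [← h1, Finset.sum_comm, Finset.sum_congr rfl fun j _ => sum_piAntidiag_apply_eq d j i]
  simp

/-- The average of a linear form over the points of a simplex. -/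
theorem sum_piAntidiag_linear [Nonempty J] (e : J → ℝ) {d : ℕ} (hd : 1 ≤ d) :
    ∑ x ∈ Finset.piAntidiag (Finset.univ : Finset J) d,
      (∑ i, e i * x i / d - (∑ i, e i) / Fintype.card J) = 0 := by
  have hN : (Fintype.card J : ℝ) ≠ 0 := by exact_mod_cast Fintype.card_ne_zero
  have hd0 : (d : ℝ) ≠ 0 := by exact_mod_cast (by omega : d ≠ 0)
  rw [Finset.sum_sub_distrib, Finset.sum_comm, sub_eq_zero, Finset.sum_const, nsmul_eq_mul,
    Finset.sum_div, Finset.mul_sum]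
  refine Finset.sum_congr rfl fun i _ => ?_
  have h1 : (Fintype.card J : ℝ) *
      ∑ x ∈ Finset.piAntidiag (Finset.univ : Finset J) d, (x i : ℝ) =
      d * (Finset.piAntidiag (Finset.univ : Finset J) d).card := by
    exact_mod_cast card_mul_sum_piAntidiag_apply d i
  rw [← Finset.sum_div, ← Finset.mul_sum]
  field_simp
  rw [mul_assoc, mul_comm _ (Fintype.card J : ℝ), h1]
  ring

omit [DecidableEq J] in
theorem abs_linear_le [Nonempty J] {e : J → ℝ} {K : ℝ} (he : ∀ i, |e i| ≤ K) {d : ℕ} (hd : 1 ≤ d)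
    {x : J → ℕ} (hx : ∑ i, x i = d) : |∑ i, e i * x i / d| ≤ K := by
  have hd0 : (0 : ℝ) < d := by exact_mod_cast hd
  rw [← Finset.sum_div, abs_div, abs_of_pos hd0, div_le_iff₀ hd0]
  refine (Finset.abs_sum_le_sum_abs _ _).trans ?_
  have hx' : ∑ i, (x i : ℝ) = d := by exact_mod_cast hx
  rw [← hx', Finset.mul_sum]
  refine Finset.sum_le_sum fun i _ => ?_
  rw [abs_mul, Nat.abs_cast]
  exact mul_le_mul_of_nonneg_right (he i) (Nat.cast_nonneg _)

omit [DecidableEq J] in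
theorem abs_average_le [Nonempty J] {e : J → ℝ} {K : ℝ} (he : ∀ i, |e i| ≤ K) :
    |(∑ i, e i) / Fintype.card J| ≤ K := by
  have hN : (0 : ℝ) < Fintype.card J := by exact_mod_cast Fintype.card_pos
  rw [abs_div, abs_of_pos hN, div_le_iff₀ hN]
  refine (Finset.abs_sum_le_sum_abs _ _).trans ?_
  refine (Finset.sum_le_sum fun i _ => he i).trans ?_
  simp [mul_comm]

/-- The multi-exponents with prescribed degree in each block. -/
def blockExponents {m : ℕ} (J : Type*) [Fintype J] [DecidableEq J] (d : Fin m → ℕ) :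
    Finset (Fin m → J → ℕ) :=
  Fintype.piFinset fun l => Finset.piAntidiag Finset.univ (d l)

theorem mem_blockExponents {m : ℕ} {d : Fin m → ℕ} {x : Fin m → J → ℕ} :
    x ∈ blockExponents J d ↔ ∀ l, ∑ i, x l i = d l := by
  simp [blockExponents, Fintype.mem_piFinset]

theorem card_bad_blockExponents [Nonempty J] {m : ℕ} {d : Fin m → ℕ} (hd : ∀ l, 1 ≤ d l)
    {e : J → ℝ} {K : ℝ} (he : ∀ i, |e i| ≤ K) {t : ℝ} (ht : 0 < t) :
    ((blockExponents J d).filter fun x =>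
      m * ((∑ i, e i) / Fintype.card J) + t ≤ ∑ l, ∑ i, e i * x l i / d l).card * t ^ 2 ≤
        m * (2 * K) ^ 2 * (blockExponents J d).card := by
  have h := card_deviation_mul_le (fun l => Finset.piAntidiag (Finset.univ : Finset J) (d l))
    (fun l x => ∑ i, e i * x i / d l - (∑ i, e i) / Fintype.card J) (c := 2 * K)
    (fun l x hx => ?_) (fun l => sum_piAntidiag_linear e (hd l)) ht
  · refine le_trans (le_of_eq ?_) h
    congr 3
    ext x
    simp only [Finset.mem_filter, blockExponents]
    refine and_congr_right fun _ => ?_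
    rw [Finset.sum_sub_distrib, Finset.sum_const, Finset.card_univ, Fintype.card_fin, nsmul_eq_mul]
    constructor <;> intro h1 <;> linarith
  · refine (abs_sub _ _).trans ?_
    have h1 := abs_linear_le he (hd l) (Finset.mem_piAntidiag.mp hx).1
    have h2 := abs_average_le he
    linarith

theorem card_blockExponents_le {m : ℕ} (d : Fin m → ℕ) :
    (blockExponents J d).card ≤ 2 ^ (Fintype.card J * ∑ l, d l) := by
  rw [blockExponents, Fintype.card_piFinset, Finset.mul_sum, ← Finset.prod_pow_eq_pow_sum]
  refine Finset.prod_le_prod' fun l _ => ?_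
  have h1 : Finset.piAntidiag (Finset.univ : Finset J) (d l) ⊆
      Fintype.piFinset fun _ => Finset.range (d l + 1) := by
    intro x hx
    rw [Fintype.mem_piFinset]
    intro i
    rw [Finset.mem_range, Nat.lt_succ_iff, ← (Finset.mem_piAntidiag.mp hx).1]
    exact Finset.single_le_sum (fun _ _ => Nat.zero_le _) (Finset.mem_univ i)
  refine (Finset.card_le_card h1).trans ?_
  rw [Fintype.card_piFinset, Finset.prod_const, Finset.card_univ, Finset.card_range, mul_comm, pow_mul]
  exact Nat.pow_le_pow_left (Nat.lt_two_pow_self) _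

theorem blockExponents_nonempty [Nonempty J] {m : ℕ} (d : Fin m → ℕ) :
    (blockExponents J d).Nonempty := by
  refine ⟨fun l => Pi.single (Classical.arbitrary J) (d l), mem_blockExponents.mpr fun l => ?_⟩
  simp

end Deviation

section Siegel

attribute [local instance] Matrix.seminormedAddCommGroup

theorem exists_small_int_kernel {α β : Type*} [Fintype α] [Fintype β]
    (A : Matrix α β ℤ) (h : 2 * Fintype.card α ≤ Fintype.card β) (hβ : 0 < Fintype.card β)
    {B : ℝ} (hB : 1 ≤ B) (hA : ∀ i j, |(A i j : ℝ)| ≤ B) :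
    ∃ t : β → ℤ, t ≠ 0 ∧ Matrix.mulVec A t = 0 ∧ ∀ j, |(t j : ℝ)| ≤ Fintype.card β * B := by
  have hβ1 : (1 : ℝ) ≤ Fintype.card β := by exact_mod_cast hβ
  rcases Nat.eq_zero_or_pos (Fintype.card α) with h0 | h0
  · have := Fintype.card_eq_zero_iff.mp h0
    have := Fintype.card_pos_iff.mp hβ
    refine ⟨fun _ => 1, ?_, Subsingleton.elim _ _, fun j => ?_⟩
    · intro h1
      exact one_ne_zero (congrFun h1 (Classical.arbitrary β))
    · simp only [Int.cast_one, abs_one]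
      nlinarith
  · obtain ⟨t, ht0, ht, hn⟩ := Int.Matrix.exists_ne_zero_int_vec_norm_le A (by omega) h0
    refine ⟨t, ht0, ht, fun j => ?_⟩
    have h1 : ‖A‖ ≤ B := (Matrix.norm_le_iff (by linarith)).mpr fun i j => by
      rw [Int.norm_eq_abs]; exact hA i j
    have h2 : |(t j : ℝ)| ≤ ‖t‖ := by rw [← Int.norm_eq_abs]; exact norm_le_pi_norm t j
    refine h2.trans (hn.trans ?_)
    have h3 : (1 : ℝ) ≤ Fintype.card β * max 1 ‖A‖ := by
      have := le_max_left 1 ‖A‖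
      nlinarith
    have h4 : (Fintype.card α : ℝ) / (Fintype.card β - Fintype.card α) ≤ 1 := by
      have h5 : (2 : ℝ) * Fintype.card α ≤ Fintype.card β := by exact_mod_cast h
      have h6 : (0 : ℝ) < Fintype.card α := by exact_mod_cast h0
      rw [div_le_one (by linarith)]
      linarith
    calc _ ≤ (Fintype.card β * max 1 ‖A‖) ^ (1 : ℝ) := Real.rpow_le_rpow_of_exponent_le h3 h4
      _ ≤ _ := by
        rw [Real.rpow_one]
        gcongr
        exact max_le hB h1

end Siegel

namespace MvPolynomial

variable {J : Type*} [Fintype J] [DecidableEq J] {m : ℕ}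

/-- The exponent vector in the variables `Fin m × J` with the given blocks. -/
noncomputable def blockMonomial (x : Fin m → J → ℕ) : Fin m × J →₀ ℕ :=
  Finsupp.equivFunOnFinite.symm fun p => x p.1 p.2

omit [DecidableEq J] in
@[simp] theorem blockMonomial_apply (x : Fin m → J → ℕ) (p : Fin m × J) :
    blockMonomial x p = x p.1 p.2 := rfl

omit [DecidableEq J] in
theorem blockMonomial_injective : Function.Injective (blockMonomial (J := J) (m := m)) := by
  intro x y h
  funext l i
  exact DFunLike.congr_fun h (l, i)

/-- The same linear substitution in each block of variables. -/
noncomputable def blockSubst (m : ℕ) (N : Matrix J J ℤ) :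
    MvPolynomial (Fin m × J) ℤ →+* MvPolynomial (Fin m × J) ℤ :=
  eval₂Hom (C.comp (RingHom.id ℤ)) fun p => ∑ j, C (N p.2 j) * X (p.1, j)

/-- The weights for which homogeneity means homogeneity in each block of variables. -/
def blockWeight (J : Type*) (m : ℕ) (p : Fin m × J) : Fin m → ℕ := Pi.single p.1 1

omit [DecidableEq J] in
theorem weight_blockWeight (e : Fin m × J →₀ ℕ) (l : Fin m) :
    Finsupp.weight (blockWeight J m) e l = ∑ j, e (l, j) := by
  rw [Finsupp.weight_apply, Finsupp.sum_fintype _ _ (by simp), Finset.sum_apply,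
    Fintype.sum_prod_type, Finset.sum_eq_single l]
  · simp [blockWeight]
  · intro l' _ h
    simp [blockWeight, h.symm]
  · simp

omit [DecidableEq J] in
theorem isWeightedHomogeneous_blockSubst (N : Matrix J J ℤ) {p : MvPolynomial (Fin m × J) ℤ}
    {d : Fin m → ℕ} (hp : IsWeightedHomogeneous (blockWeight J m) p d) :
    IsWeightedHomogeneous (blockWeight J m) (blockSubst m N p) d := by
  rw [blockSubst, coe_eval₂Hom, eval₂_eq]
  refine IsWeightedHomogeneous.sum _ _ _ fun e he => ?_
  have h1 := hp (mem_support_iff.mp he)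
  rw [← zero_add d, ← h1]
  refine IsWeightedHomogeneous.mul (isWeightedHomogeneous_C _ _) ?_
  rw [Finsupp.weight_apply]
  refine IsWeightedHomogeneous.prod _ _ _ fun p _ => ?_
  refine IsWeightedHomogeneous.pow ?_ _
  refine IsWeightedHomogeneous.sum _ _ _ fun j _ => ?_
  rw [← zero_add (blockWeight J m p)]
  exact IsWeightedHomogeneous.mul (isWeightedHomogeneous_C _ _)
    (isWeightedHomogeneous_X _ _ (p.1, j))

omit [DecidableEq J] in
theorem wnorm_blockSubst_le (N : Matrix J J ℤ) {B : ℝ} (hN : ∀ i j, |(N i j : ℝ)| ≤ B)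
    (p : MvPolynomial (Fin m × J) ℤ) :
    wnorm absInt (fun _ => 1) (blockSubst m N p) ≤
      wnorm absInt (fun _ => Fintype.card J * B) p := by
  refine wnorm_eval₂Hom_le absInt absInt (fun _ => zero_le_one) _ (fun _ => le_rfl) _ _ ?_ p
  intro l
  refine (wnorm_sum_le _ (fun _ => zero_le_one) _ _).trans ?_
  rw [← nsmul_eq_mul, ← Finset.card_univ]
  refine Finset.sum_le_card_nsmul _ _ _ fun j _ => ?_
  refine (wnorm_mul_le _ (fun _ => zero_le_one) _ _).trans ?_
  rw [wnorm_C, wnorm_X, mul_one, absInt_apply]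
  exact hN _ _

omit [DecidableEq J] in
theorem monomialWeight_const_blockMonomial (c : ℝ) {x : Fin m → J → ℕ} {d : Fin m → ℕ}
    (hx : ∀ l, ∑ i, x l i = d l) :
    monomialWeight (fun _ => c) (blockMonomial x) = c ^ ∑ l, d l := by
  rw [monomialWeight_eq, Finset.prod_pow_eq_pow_sum, Fintype.sum_prod_type]
  simp [hx]

/-- Siegel's lemma construction of a multihomogeneous polynomial which has no monomials of
large weight in any of finitely many coordinate systems. -/
theorem exists_auxiliary [Nonempty J] {V : Type*} [Fintype V] (e : J → V → ℝ) {K : ℝ}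
    (he : ∀ i v, |e i v| ≤ K) (M' : V → Matrix J J ℤ) {B : ℝ} (hB : 1 ≤ B)
    (hM' : ∀ v i j, |(M' v i j : ℝ)| ≤ B) {t : ℝ} (ht : 0 < t)
    (hmt : 2 * (Fintype.card V * (m * (2 * K) ^ 2)) ≤ t ^ 2) (d : Fin m → ℕ)
    (hd : ∀ l, 1 ≤ d l) :
    ∃ P : MvPolynomial (Fin m × J) ℤ, P ≠ 0 ∧
      (∀ f ∈ P.support, ∀ l, ∑ j, f (l, j) = d l) ∧
      wnorm absInt (fun _ => 1) P ≤ (4 ^ Fintype.card J * (Fintype.card J * B)) ^ (∑ l, d l) ∧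
      ∀ v, ∀ f ∈ (blockSubst m (M' v) P).support, (∀ l, ∑ j, f (l, j) = d l) ∧
        ∑ l, ∑ i, e i v * f (l, i) / d l < m * ((∑ i, e i v) / Fintype.card J) + t := by
  classical
  set S := blockExponents J d with hS
  let bad : V → Finset (Fin m → J → ℕ) := fun v => S.filter fun x =>
    m * ((∑ i, e i v) / Fintype.card J) + t ≤ ∑ l, ∑ i, e i v * x l i / d l
  have hbad : ∀ v, ((bad v).card : ℝ) * t ^ 2 ≤ m * (2 * K) ^ 2 * S.card := fun v =>
    card_bad_blockExponents hd (fun i => he i v) ht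
  obtain ⟨A, hAdef⟩ : ∃ A : Matrix ((v : V) × {y // y ∈ bad v}) {x // x ∈ S} ℤ, ∀ y x, A y x =
      coeff (blockMonomial y.2.1) (blockSubst m (M' y.1) (monomial (blockMonomial x.1) 1)) :=
    ⟨fun y x => _, fun _ _ => rfl⟩
  have hN : (1 : ℝ) ≤ Fintype.card J := by exact_mod_cast Fintype.card_pos (α := J)
  have hNB : 1 ≤ Fintype.card J * B := one_le_mul_of_one_le_of_one_le hN hB
  have hA : ∀ y x, |(A y x : ℝ)| ≤ (Fintype.card J * B) ^ (∑ l, d l) := by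
    intro y x
    have h1 := wnorm_blockSubst_le (m := m) (M' y.1) (hM' y.1) (monomial (blockMonomial x.1) 1)
    rw [wnorm_monomial, monomialWeight_const_blockMonomial _ (mem_blockExponents.mp x.2),
      absInt_apply, Int.cast_one, abs_one, one_mul] at h1
    have h2 := coeff_le_wnorm absInt (w := fun _ => 1) (fun _ => zero_le_one)
      (blockSubst m (M' y.1) (monomial (blockMonomial x.1) 1)) (blockMonomial y.2.1)
    rw [monomialWeight_one, mul_one, absInt_apply] at h2
    rw [hAdef]
    exact h2.trans h1
  have hcard : 2 * Fintype.card ((v : V) × {y // y ∈ bad v}) ≤ Fintype.card {x // x ∈ S} := by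
    rw [Fintype.card_sigma, Fintype.card_coe]
    simp only [Fintype.card_coe]
    have h1 : ((∑ v, (bad v).card : ℕ) : ℝ) * t ^ 2 ≤
        Fintype.card V * (m * (2 * K) ^ 2 * S.card) := by
      push_cast
      rw [Finset.sum_mul, ← nsmul_eq_mul (Fintype.card V), ← Finset.card_univ]
      exact Finset.sum_le_card_nsmul _ _ _ fun v _ => hbad v
    have h3 : (2 * ((∑ v, (bad v).card : ℕ) : ℝ)) * t ^ 2 ≤ S.card * t ^ 2 := by
      calc _ = 2 * (((∑ v, (bad v).card : ℕ) : ℝ) * t ^ 2) := by ring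
        _ ≤ 2 * (Fintype.card V * (m * (2 * K) ^ 2 * S.card)) := by gcongr
        _ = 2 * (Fintype.card V * (m * (2 * K) ^ 2)) * S.card := by ring
        _ ≤ t ^ 2 * S.card := by gcongr
        _ = _ := mul_comm _ _
    have h4 := le_of_mul_le_mul_right h3 (by positivity)
    exact_mod_cast h4
  have hβ : 0 < Fintype.card {x // x ∈ S} := by
    rw [Fintype.card_coe]
    exact (blockExponents_nonempty d).card_pos
  obtain ⟨z, hz0, hAz, hz⟩ := exists_small_int_kernel A hcard hβ (one_le_pow₀ hNB) hA
  have hdeg : ∀ p : MvPolynomial (Fin m × J) ℤ, IsWeightedHomogeneous (blockWeight J m) p d →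
      ∀ f ∈ p.support, ∀ l, ∑ j, f (l, j) = d l := by
    intro p hp f hf l
    rw [← weight_blockWeight, hp (mem_support_iff.mp hf)]
  have hhom : ∀ x : {x // x ∈ S}, ∀ c : ℤ, IsWeightedHomogeneous (blockWeight J m)
      (monomial (blockMonomial x.1) c) d := by
    intro x c
    refine isWeightedHomogeneous_monomial _ _ _ ?_
    funext l
    rw [weight_blockWeight]
    exact mem_blockExponents.mp x.2 l
  obtain ⟨P, hPdef⟩ : ∃ P : MvPolynomial (Fin m × J) ℤ,
      P = ∑ x : {x // x ∈ S}, monomial (blockMonomial x.1) (z x) := ⟨_, rfl⟩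
  have hP : IsWeightedHomogeneous (blockWeight J m) P d := by
    rw [hPdef]
    exact IsWeightedHomogeneous.sum _ _ _ fun x _ => hhom x _
  have hcoeff : ∀ x : {x // x ∈ S}, coeff (blockMonomial x.1) P = z x := by
    intro x
    rw [hPdef, coeff_sum, Finset.sum_eq_single x]
    · rw [coeff_monomial, if_pos rfl]
    · intro y _ hy
      rw [coeff_monomial, if_neg]
      exact fun h => hy (Subtype.ext (blockMonomial_injective h))
    · simp
  have hP0 : P ≠ 0 := by
    intro h
    apply hz0
    ext x
    rw [← hcoeff x, h, coeff_zero, Pi.zero_apply]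
  refine ⟨P, hP0, hdeg _ hP, ?_, ?_⟩
  · rw [hPdef]
    refine (wnorm_sum_le _ (fun _ => zero_le_one) _ _).trans ?_
    calc _ ≤ ∑ _x : {x // x ∈ S}, (S.card : ℝ) * (Fintype.card J * B) ^ (∑ l, d l) := by
          refine Finset.sum_le_sum fun x _ => ?_
          rw [wnorm_monomial, monomialWeight_one, mul_one, absInt_apply]
          simpa using hz x
      _ = (S.card : ℝ) * S.card * (Fintype.card J * B) ^ (∑ l, d l) := by
          rw [Finset.sum_const, Finset.card_univ, Fintype.card_coe, nsmul_eq_mul, mul_assoc]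
      _ ≤ (2 ^ (Fintype.card J * ∑ l, d l)) * (2 ^ (Fintype.card J * ∑ l, d l)) *
          (Fintype.card J * B) ^ (∑ l, d l) := by
          have h5 : (S.card : ℝ) ≤ 2 ^ (Fintype.card J * ∑ l, d l) := by
            exact_mod_cast card_blockExponents_le (J := J) d
          gcongr
      _ = _ := by
          rw [← mul_pow, mul_pow (4 ^ _ : ℝ), ← pow_mul]
          norm_num
  · intro v f hf
    have h1 := hdeg _ (isWeightedHomogeneous_blockSubst (M' v) hP) f hf
    refine ⟨h1, ?_⟩
    by_contra! hcon
    refine mem_support_iff.mp hf ?_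
    have hy : (fun l j => f (l, j)) ∈ bad v :=
      Finset.mem_filter.mpr ⟨mem_blockExponents.mpr h1, hcon⟩
    have h2 := congrFun hAz ⟨v, ⟨_, hy⟩⟩
    have h3 : blockMonomial (fun l j => f (l, j)) = f := by
      ext p
      rfl
    rw [Matrix.mulVec, dotProduct] at h2
    simp only [hAdef, h3, Pi.zero_apply] at h2
    rw [hPdef, map_sum, coeff_sum, ← h2]
    refine Finset.sum_congr rfl fun x _ => ?_
    have h4 : monomial (blockMonomial x.1) (z x) =
        C (z x) * monomial (blockMonomial x.1) 1 := by rw [C_mul_monomial, mul_one]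
    rw [h4, map_mul, blockSubst, coe_eval₂Hom, eval₂_C, RingHom.comp_apply, RingHom.id_apply,
      coeff_C_mul, mul_comm]

end MvPolynomial

section

open MvPolynomial

section LocalEstimate

variable {k : Type*} [Field k] {m : ℕ} {J : Type*} [Fintype J] [DecidableEq J]

omit [Fintype J] [DecidableEq J] in
theorem AbsoluteValue.intCast_le (A : AbsoluteValue k ℝ) (n : ℤ) : A (n : k) ≤ |(n : ℝ)| := by
  obtain ⟨a, rfl | rfl⟩ := n.eq_nat_or_neg
  · simpa using A.natCast_le a
  · simpa using A.natCast_le a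

/-- The linear substitution of `blockSubst` in terms of `k`-coefficients. -/
theorem eval₂Hom_blockForm_eq {M M' : Matrix J J ℤ} (hM : M' * M = 1) (o : J) (i : Fin m → J)
    (Y : Fin m → Matrix J J k) (P : MvPolynomial (Fin m × J) ℤ) :
    eval₂Hom (C.comp (Int.castRingHom k)) (blockForm o i Y) P =
      eval₂Hom (C.comp (Int.castRingHom k))
        (fun x => ∑ j, C ((M x.2 j : k)) * blockForm o i Y (x.1, j)) (blockSubst m M' P) := by
  rw [← RingHom.comp_apply]
  congr 1
  refine ringHom_ext (fun r => ?_) fun x => ?_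
  · simp [blockSubst]
  · have h1 : ∀ j', ∑ j, (M' x.2 j : k) * (M j j' : k) = if x.2 = j' then 1 else 0 := by
      intro j'
      have := congrFun (congrFun hM x.2) j'
      rw [Matrix.mul_apply, Matrix.one_apply] at this
      have h2 := congrArg (Int.cast : ℤ → k) this
      push_cast at h2
      exact h2
    rw [RingHom.comp_apply, blockSubst, eval₂Hom_X', eval₂Hom_X', map_sum]
    have h3 : ∀ j, eval₂Hom (C.comp (Int.castRingHom k))
        (fun x => ∑ j, C ((M x.2 j : k)) * blockForm o i Y (x.1, j)) (C (M' x.2 j) * X (x.1, j)) =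
        ∑ j', C ((M' x.2 j : k) * (M j j' : k)) * blockForm o i Y (x.1, j') := by
      intro j
      rw [map_mul, eval₂Hom_C, eval₂Hom_X', Finset.mul_sum]
      refine Finset.sum_congr rfl fun j' _ => ?_
      rw [C_mul, RingHom.comp_apply, eq_intCast, mul_assoc]
    rw [Finset.sum_congr rfl fun j _ => h3 j, Finset.sum_comm]
    simp only [← Finset.sum_mul, ← map_sum, h1]
    simp

theorem wnorm_linearForm_le (A : AbsoluteValue k ℝ) {M : Matrix J J ℤ} {B K : ℝ}
    (hMB : ∀ i j, |(M i j : ℝ)| ≤ B) {e : J → ℝ} (he : ∀ i, |e i| ≤ K) (o : J)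
    (i : Fin m → J) (Y : Fin m → Matrix J J k) {h : Fin m → ℝ} (hh : ∀ l, 0 ≤ h l)
    (hY : ∀ l, ∀ I ≠ o, ∀ a, A (∑ j, (M a j : k) * Y l I j) ≤ Real.exp (h l * e a))
    (x : Fin m × J) :
    wnorm A (fun y : Fin m × J => if y.2 = o then Real.exp (-K * h y.1) else 1)
        (∑ j, C ((M x.2 j : k)) * blockForm o i Y (x.1, j)) ≤
      (Fintype.card J + B) * Real.exp (h x.1 * e x.2) := by
  have hw : ∀ y : Fin m × J, (0 : ℝ) ≤ if y.2 = o then Real.exp (-K * h y.1) else 1 := by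
    intro y
    split_ifs <;> positivity
  have h1 : ∑ j, C ((M x.2 j : k)) * blockForm o i Y (x.1, j) =
      ∑ I, if I = o then C ((M x.2 (i x.1) : k)) * X (x.1, o) else
        C (∑ j, (M x.2 j : k) * Y x.1 I j) * X (x.1, I) := by
    simp only [blockForm, Finset.mul_sum]
    rw [Finset.sum_comm]
    refine Finset.sum_congr rfl fun I _ => ?_
    split_ifs with hI
    · simp
    · rw [map_sum, Finset.sum_mul]
      refine Finset.sum_congr rfl fun j _ => ?_
      rw [C_mul, mul_assoc]
  rw [h1]
  refine (wnorm_sum_le A hw _ _).trans ?_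
  have hB : 0 ≤ B := (abs_nonneg _).trans (hMB o o)
  calc _ ≤ ∑ I, (if I = o then B else 1) * Real.exp (h x.1 * e x.2) := by
        refine Finset.sum_le_sum fun I _ => ?_
        split_ifs with hI
        · refine (wnorm_mul_le A hw _ _).trans ?_
          rw [wnorm_C, wnorm_X]
          simp only [if_true]
          have h2 := (A.intCast_le (M x.2 (i x.1))).trans (hMB _ _)
          have h3 : -K * h x.1 ≤ h x.1 * e x.2 := by
            nlinarith [hh x.1, (abs_le.mp (he x.2)).1]
          exact mul_le_mul h2 (Real.exp_le_exp.mpr h3) (by positivity) hB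
        · refine (wnorm_mul_le A hw _ _).trans ?_
          rw [wnorm_C, wnorm_X]
          simp only [hI, if_false, mul_one, one_mul]
          exact hY x.1 I hI x.2
    _ ≤ ∑ I, (1 + if I = o then B else 0) * Real.exp (h x.1 * e x.2) := by
        refine Finset.sum_le_sum fun I _ => ?_
        gcongr
        split_ifs <;> linarith
    _ = _ := by
        rw [← Finset.sum_mul, Finset.sum_add_distrib]
        simp

theorem coeff_blockForm_le [Nonempty J] (A : AbsoluteValue k ℝ) {M M' : Matrix J J ℤ}
    (hM : M' * M = 1) {B K : ℝ} (hB : 1 ≤ B) (hMB : ∀ i j, |(M i j : ℝ)| ≤ B)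
    (hMB' : ∀ i j, |(M' i j : ℝ)| ≤ B)
    {e : J → ℝ} (he : ∀ i, |e i| ≤ K) {o : J} {i : Fin m → J} {Y : Fin m → Matrix J J k}
    {h : Fin m → ℝ} (hh : ∀ l, 0 ≤ h l)
    (hY : ∀ l, ∀ I ≠ o, ∀ a, A (∑ j, (M a j : k) * Y l I j) ≤ Real.exp (h l * e a))
    {d : Fin m → ℕ} (hd : ∀ l, 1 ≤ d l) {D η : ℝ} (hD : 0 ≤ D) (hdh : ∀ l, d l * h l ≤ D)
    (hdh' : ∀ l, D * (1 - η) ≤ d l * h l) {P : MvPolynomial (Fin m × J) ℤ}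
    (hP : ∀ f ∈ P.support, ∀ l, ∑ j, f (l, j) = d l) {E : ℝ}
    (hE : ∀ f ∈ (blockSubst m M' P).support, (∀ l, ∑ j, f (l, j) = d l) ∧
        ∑ l, ∑ a, e a * f (l, a) / d l ≤ E) (f : Fin m × J →₀ ℕ) :
    A (coeff f (eval₂Hom (C.comp (Int.castRingHom k)) (blockForm o i Y) P)) ≤
      (Fintype.card J * B * (Fintype.card J + B)) ^ (∑ l, d l) *
        wnorm absInt (fun _ => 1) P *
        Real.exp (D * (E + m * η * K) + K * ∑ l, h l * f (l, o)) := by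
  have hw : ∀ y : Fin m × J, (0 : ℝ) ≤ if y.2 = o then Real.exp (-K * h y.1) else 1 := by
    intro y
    split_ifs <;> positivity
  have hK : 0 ≤ K := (abs_nonneg _).trans (he o)
  have h1 := coeff_le_wnorm A hw
    (eval₂Hom (C.comp (Int.castRingHom k)) (blockForm o i Y) P) f
  have h2 : monomialWeight
      (fun y : Fin m × J => if y.2 = o then Real.exp (-K * h y.1) else 1) f =
      Real.exp (-(K * ∑ l, h l * f (l, o))) := by
    rw [monomialWeight_eq, Fintype.prod_prod_type]
    have : ∀ l, ∏ j, (if j = o then Real.exp (-K * h l) else 1) ^ f (l, j) =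
        Real.exp (-K * h l * f (l, o)) := by
      intro l
      rw [Finset.prod_eq_single o]
      · rw [if_pos rfl, ← Real.exp_nat_mul]
        ring_nf
      · intro j _ hj
        rw [if_neg hj, one_pow]
      · simp
    simp only [this]
    rw [← Real.exp_sum, Finset.mul_sum, ← Finset.sum_neg_distrib]
    congr 1
    exact Finset.sum_congr rfl fun l _ => by ring
  rw [h2] at h1
  have hN : (1 : ℝ) ≤ Fintype.card J := by exact_mod_cast Fintype.card_pos (α := J)
  have h3 : wnorm A (fun y : Fin m × J => if y.2 = o then Real.exp (-K * h y.1) else 1)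
      (eval₂Hom (C.comp (Int.castRingHom k)) (blockForm o i Y) P) ≤
      (Fintype.card J * B * (Fintype.card J + B)) ^ (∑ l, d l) *
        wnorm absInt (fun _ => 1) P * Real.exp (D * (E + m * η * K)) := by
    rw [eval₂Hom_blockForm_eq hM]
    refine (wnorm_eval₂Hom_le A absInt hw (Int.castRingHom k) (fun n => ?_) _
      (fun x => (Fintype.card J + B) * Real.exp (h x.1 * e x.2))
      (fun x => wnorm_linearForm_le A hMB he o i Y hh hY x) _).trans ?_
    · rw [absInt_apply]
      exact A.intCast_le n
    have h4 : ∀ f ∈ (blockSubst m M' P).support, monomialWeight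
        (fun x : Fin m × J => (Fintype.card J + B) * Real.exp (h x.1 * e x.2)) f ≤
        (Fintype.card J + B) ^ (∑ l, d l) * Real.exp (D * (E + m * η * K)) := by
      intro f hf
      obtain ⟨hf1, hf2⟩ := hE f hf
      rw [monomialWeight_eq]
      simp only [mul_pow]
      rw [Finset.prod_mul_distrib, Finset.prod_pow_eq_pow_sum, Fintype.sum_prod_type]
      simp only [hf1]
      gcongr
      have h5 : ∏ x : Fin m × J, Real.exp (h x.1 * e x.2) ^ f x =
          Real.exp (∑ l, ∑ a, h l * e a * f (l, a)) := by
        rw [← Fintype.sum_prod_type (f := fun x : Fin m × J => h x.1 * e x.2 * f x), Real.exp_sum]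
        refine Finset.prod_congr rfl fun x _ => ?_
        rw [← Real.exp_nat_mul]
        ring_nf
      rw [h5, Real.exp_le_exp]
      have h6 : ∀ l, ∑ a, h l * e a * f (l, a) ≤
          D * ∑ a, e a * f (l, a) / d l + D * η * K := by
        intro l
        have hdl : (0 : ℝ) < d l := by exact_mod_cast hd l
        set s := ∑ a, e a * f (l, a) / d l with hs
        have h7 : ∑ a, h l * e a * f (l, a) = d l * h l * s := by
          rw [hs, Finset.mul_sum]
          refine Finset.sum_congr rfl fun a _ => ?_
          field_simp
        have h8 : -K ≤ s := by
          have h9 : ∑ a, (f (l, a) : ℝ) / d l = 1 := by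
            rw [← Finset.sum_div, div_eq_one_iff_eq hdl.ne']
            exact_mod_cast hf1 l
          calc -K = ∑ a, -K * ((f (l, a) : ℝ) / d l) := by rw [← Finset.mul_sum, h9, mul_one]
            _ ≤ s := by
              refine Finset.sum_le_sum fun a _ => ?_
              rw [mul_div_assoc]
              exact mul_le_mul_of_nonneg_right (abs_le.mp (he a)).1 (by positivity)
        rw [h7]
        nlinarith [hdh l, hdh' l]
      calc _ ≤ ∑ l, (D * ∑ a, e a * f (l, a) / d l + D * η * K) :=
            Finset.sum_le_sum fun l _ => h6 l
        _ = D * (∑ l, ∑ a, e a * f (l, a) / d l) + m * (D * η * K) := by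
            rw [Finset.sum_add_distrib, ← Finset.mul_sum]
            simp
        _ ≤ D * E + m * (D * η * K) := by gcongr
        _ = _ := by ring
    calc wnorm absInt (fun x : Fin m × J => (Fintype.card J + B) * Real.exp (h x.1 * e x.2))
          (blockSubst m M' P)
        ≤ ∑ f ∈ (blockSubst m M' P).support, absInt (coeff f (blockSubst m M' P)) *
          ((Fintype.card J + B) ^ (∑ l, d l) * Real.exp (D * (E + m * η * K))) := by
          refine Finset.sum_le_sum fun f hf => ?_
          exact mul_le_mul_of_nonneg_left (h4 f hf) (absInt.nonneg _)
      _ = wnorm absInt (fun _ => 1) (blockSubst m M' P) *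
          ((Fintype.card J + B) ^ (∑ l, d l) * Real.exp (D * (E + m * η * K))) := by
          rw [← Finset.sum_mul, wnorm]
          simp
      _ ≤ ((Fintype.card J * B) ^ (∑ l, d l) * wnorm absInt (fun _ => 1) P) *
          ((Fintype.card J + B) ^ (∑ l, d l) * Real.exp (D * (E + m * η * K))) := by
          gcongr
          refine (wnorm_blockSubst_le M' hMB' P).trans ?_
          rw [wnorm, wnorm, Finset.mul_sum]
          refine Finset.sum_le_sum fun f hf => ?_
          rw [monomialWeight_eq, Finset.prod_pow_eq_pow_sum, Fintype.sum_prod_type]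
          simp only [hP f hf]
          simp [mul_comm]
      _ = _ := by
          rw [mul_pow (_ * B)]
          ring
  rw [Real.exp_add, ← mul_assoc]
  rw [Real.exp_neg, ← div_eq_mul_inv, div_le_iff₀ (Real.exp_pos _)] at h1
  exact h1.trans (mul_le_mul_of_nonneg_right h3 (Real.exp_pos _).le)

end LocalEstimate

section IntegralCoefficients

variable {k : Type*} [Field k] {m : ℕ} {J : Type*} [Fintype J] [DecidableEq J]

theorem coeff_blockForm_mem (R : Subring k) {o : J} {i : Fin m → J} {Y : Fin m → Matrix J J k}
    (hY : ∀ l, ∀ I ≠ o, ∀ j, Y l I j ∈ R) (P : MvPolynomial (Fin m × J) ℤ)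
    (f : Fin m × J →₀ ℕ) :
    coeff f (eval₂Hom (C.comp (Int.castRingHom k)) (blockForm o i Y) P) ∈ R := by
  let g : Fin m × J → MvPolynomial (Fin m × J) R := fun x =>
    ∑ I, if hI : I = o then (if x.2 = i x.1 then X (x.1, o) else 0) else
      C ⟨Y x.1 I x.2, hY x.1 I hI x.2⟩ * X (x.1, I)
  have h1 : eval₂Hom (C.comp (Int.castRingHom k)) (blockForm o i Y) =
      (map R.subtype).comp (eval₂Hom (C.comp (Int.castRingHom R)) g) := by
    refine ringHom_ext (fun r => by simp) fun x => ?_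
    rw [RingHom.comp_apply, coe_eval₂Hom, coe_eval₂Hom, eval₂_X, eval₂_X, map_sum, blockForm]
    refine Finset.sum_congr rfl fun I _ => ?_
    split_ifs <;> simp
  rw [h1, RingHom.comp_apply, coeff_map]
  exact SetLike.coe_mem _

end IntegralCoefficients

section RothPoints

variable {k : Type*} [Field k] {J : Type*} [Fintype J] [DecidableEq J]

/-- There is an integral vector of size at most `A` killed by the rows of `Y` other than `o`. -/
def HasSmallKernel (o : J) (Y : Matrix J J k) (A : ℝ) : Prop :=
  ∃ ξ : J → k, ξ ≠ 0 ∧ (∀ q, IsIntegral ℤ (ξ q)) ∧ (∀ q, ∀ φ : k →+* ℂ, ‖φ (ξ q)‖ ≤ A) ∧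
    ∀ I ≠ o, ∑ j, Y I j * ξ j = 0

theorem exists_kernel_vector (o : J) {Y : Matrix J J k} (hY : Y.det ≠ 0) :
    ∃ ξ : J → k, ξ ≠ 0 ∧ (∀ j, ξ j = Y.adjugate j o) ∧ ∀ I ≠ o, ∑ j, Y I j * ξ j = 0 := by
  have h1 : ∀ I, ∑ j, Y I j * Y.adjugate j o = Y.det * (1 : Matrix J J k) I o := by
    intro I
    rw [← Matrix.mul_apply, Matrix.mul_adjugate, Matrix.smul_apply, smul_eq_mul]
  refine ⟨fun j => Y.adjugate j o, ?_, fun _ => rfl, fun I hI => ?_⟩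
  · intro h0
    have h2 := h1 o
    rw [Matrix.one_apply_eq, mul_one] at h2
    refine hY (h2.symm.trans (Finset.sum_eq_zero fun j _ => ?_))
    rw [congrFun h0 j, Pi.zero_apply, mul_zero]
  · rw [h1, Matrix.one_apply_ne hI, mul_zero]

theorem exists_rothPoint_of_not_hasSmallKernel [NumberField k] (o : J) {Y : Matrix J J k}
    (hY : Y.det ≠ 0) {L : ℝ} (hL : 0 ≤ L)
    (hns : ¬ HasSmallKernel o Y (Real.exp (Fintype.card J * L))) :
    ∃ (ξ : J → k) (i q : J), q ≠ i ∧ ξ i ≠ 0 ∧ (∀ I ≠ o, ∑ j, Y I j * ξ j = 0) ∧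
      RothPoint (-ξ q / ξ i) L := by
  obtain ⟨ξ, hξ, -, hYξ⟩ := exists_kernel_vector o hY
  obtain ⟨i, hi⟩ := Function.ne_iff.mp hξ
  rw [Pi.zero_apply] at hi
  by_contra hcon
  push Not at hcon
  have hA : 1 ≤ Real.exp L := Real.one_le_exp hL
  have h1 : ∀ q, ∃ a : ℤ, a ≠ 0 ∧ |(a : ℝ)| ≤ Real.exp L ∧ IsIntegral ℤ ((a : k) * (ξ q / ξ i)) ∧
      ∀ φ : k →+* ℂ, ‖φ (a * (ξ q / ξ i))‖ ≤ Real.exp L := by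
    intro q
    by_cases hq : q = i
    · refine ⟨1, one_ne_zero, by simpa using hA, ?_, fun φ => ?_⟩
      · rw [hq, div_self hi, Int.cast_one, one_mul]
        exact isIntegral_one
      · rw [hq, div_self hi]
        simpa using hA
    · rcases rothPoint_or_small (-ξ q / ξ i) hA with ⟨a, ha0, ha, h2, h3⟩ | h2
      · refine ⟨a, ha0, ha, ?_, fun φ => ?_⟩
        · have := h2.neg
          rwa [← mul_neg, neg_div, neg_neg] at this
        · have := h3 φ
          rwa [neg_div, mul_neg, map_neg, norm_neg] at this
      · rw [Real.log_exp] at h2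
        exact (hcon ξ i q hq hi hYξ h2).elim
  choose a ha0 ha haint hanorm using h1
  refine hns ⟨fun q => (∏ j, (a j : k)) * (ξ q / ξ i), ?_, fun q => ?_, fun q φ => ?_, fun I hI => ?_⟩
  · intro h0
    have := congrFun h0 i
    simp only [div_self hi, mul_one, Pi.zero_apply] at this
    exact Finset.prod_ne_zero_iff.mpr (fun j _ => Int.cast_ne_zero.mpr (ha0 j)) this
  · beta_reduce
    rw [← Finset.mul_prod_erase _ _ (Finset.mem_univ q), mul_right_comm]
    refine (haint q).mul (IsIntegral.prod _ fun j _ => ?_)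
    exact isIntegral_algebraMap (R := ℤ) (A := k)
  · beta_reduce
    rw [← Finset.mul_prod_erase _ _ (Finset.mem_univ q), mul_right_comm, map_mul, norm_mul, map_prod,
      norm_prod]
    calc _ ≤ Real.exp L * ∏ _j ∈ Finset.univ.erase q, Real.exp L := by
          refine mul_le_mul (hanorm q φ) ?_ (by positivity) (by positivity)
          refine Finset.prod_le_prod (fun _ _ => norm_nonneg _) fun j _ => ?_
          rw [map_intCast, Complex.norm_intCast]
          exact ha j
      _ = Real.exp (Fintype.card J * L) := by
          rw [Finset.mul_prod_erase _ (fun _ => Real.exp L) (Finset.mem_univ q), Finset.prod_const,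
            Finset.card_univ, ← Real.exp_nat_mul]
  · have := hYξ I hI
    calc _ = (∏ j, (a j : k)) / ξ i * ∑ j, Y I j * ξ j := by
          rw [Finset.mul_sum]
          exact Finset.sum_congr rfl fun j _ => by ring
      _ = 0 := by rw [this, mul_zero]

end RothPoints

end

section

open MvPolynomial

section NonSmall

variable {k : Type*} [Field k] {J : Type*} [Fintype J] [DecidableEq J]
  {V : Type*} [Fintype V]

/-- The rows of `Y` other than `o` lie in `R`, and in the coordinate systems `M v` they satisfy
inequalities with exponents `e` relative to the logarithmic height `h`. -/
structure IsApproxBasis (R : Subring k) (av : V → AbsoluteValue k ℝ) (M : V → Matrix J J ℤ)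
    (e : J → V → ℝ) (o : J) (Y : Matrix J J k) (h : ℝ) : Prop where
  det_ne_zero : Y.det ≠ 0
  mem : ∀ I ≠ o, ∀ j, Y I j ∈ R
  le : ∀ v, ∀ I ≠ o, ∀ a, av v (∑ j, (M v a j : k) * Y I j) ≤ Real.exp (h * e a v)

omit [DecidableEq J] in
theorem exists_bound_entries (M : V → Matrix J J ℤ) :
    ∃ B : ℝ, 1 ≤ B ∧ ∀ v i j, |(M v i j : ℝ)| ≤ B := by
  obtain ⟨B, hB⟩ := (Set.finite_range fun x : V × J × J =>
    |(M x.1 x.2.1 x.2.2 : ℝ)|).bddAbove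
  exact ⟨max 1 B, le_max_left _ _, fun v i j =>
    (hB ⟨(v, i, j), rfl⟩).trans (le_max_right _ _)⟩

theorem product_coeff_lt_one [Nonempty J] {av : V → AbsoluteValue k ℝ} {m : ℕ}
    {M M' : V → Matrix J J ℤ} (hM : ∀ v, M' v * M v = 1) {B K : ℝ} (hB : 1 ≤ B)
    (hMB : ∀ v i j, |(M v i j : ℝ)| ≤ B) (hMB' : ∀ v i j, |(M' v i j : ℝ)| ≤ B)
    {e : J → V → ℝ} (he : ∀ i v, |e i v| ≤ K) {R : Subring k} {o : J} {i : Fin m → J}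
    {Y : Fin m → Matrix J J k} {h : Fin m → ℝ} {h0 : ℝ} (hh0 : 0 < h0) (hh : ∀ l, h0 ≤ h l)
    (hY : ∀ l, IsApproxBasis R av M e o (Y l) (h l)) (hm : 1 ≤ m)
    {d : Fin m → ℕ} (hd : ∀ l, 1 ≤ d l) {D η : ℝ} (hη : 0 < η) (hD : 0 < D)
    (hdh : ∀ l, d l * h l ≤ D)
    (hdh' : ∀ l, D * (1 - η) ≤ d l * h l) {P : MvPolynomial (Fin m × J) ℤ}
    (hP : ∀ f ∈ P.support, ∀ l, ∑ j, f (l, j) = d l) {C : ℝ} (hC : 1 ≤ C)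
    (hPn : wnorm absInt (fun _ => 1) P ≤ C ^ (∑ l, d l))
    (hE : ∀ v, ∀ f ∈ (blockSubst m (M' v) P).support, (∀ l, ∑ j, f (l, j) = d l) ∧
        ∑ l, ∑ a, e a v * f (l, a) / d l < m * ((∑ a, e a v) / Fintype.card J) + m * η)
    (hneg : Fintype.card V * (Real.log (Fintype.card J * B * (Fintype.card J + B) * C) / h0 +
      η * (1 + 2 * K)) < -(∑ v, ∑ a, e a v) / Fintype.card J)
    {f : Fin m × J →₀ ℕ} (hf : ∑ l, (f (l, o) : ℝ) / d l < η) :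
    ∏ v, av v (coeff f (eval₂Hom (MvPolynomial.C.comp (Int.castRingHom k))
      (blockForm o i Y) P)) < 1 := by
  have hN : (1 : ℝ) ≤ Fintype.card J := by exact_mod_cast Fintype.card_pos (α := J)
  have hK : 0 ≤ K ∨ IsEmpty V := by
    rcases isEmpty_or_nonempty V with hV | ⟨⟨v⟩⟩
    · exact Or.inr hV
    · exact Or.inl ((abs_nonneg _).trans (he o v))
  rcases hK with hK | hV
  swap
  · simp at hneg
  have hm' : (1 : ℝ) ≤ m := by exact_mod_cast hm
  set N : ℝ := (Fintype.card J : ℝ) with hNdef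
  have hC0 : 1 ≤ N * B * (N + B) * C := by
    refine one_le_mul_of_one_le_of_one_le (one_le_mul_of_one_le_of_one_le
      (one_le_mul_of_one_le_of_one_le hN hB) (by linarith)) hC
  set c := Real.log (N * B * (N + B) * C) with hc
  have hc0 : 0 ≤ c := Real.log_nonneg hC0
  have hexp : Real.exp c = N * B * (N + B) * C := Real.exp_log (by linarith)
  have hsum : ((∑ l, d l : ℕ) : ℝ) ≤ m * (D / h0) := by
    push_cast
    calc ∑ l, (d l : ℝ) ≤ ∑ _l : Fin m, D / h0 := by
          refine Finset.sum_le_sum fun l _ => ?_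
          rw [le_div_iff₀ hh0]
          exact (mul_le_mul_of_nonneg_left (hh l) (Nat.cast_nonneg _)).trans (hdh l)
      _ = _ := by simp
  have hfo : ∑ l, h l * (f (l, o) : ℝ) ≤ D * η := by
    calc _ ≤ ∑ l, D * ((f (l, o) : ℝ) / d l) := by
          refine Finset.sum_le_sum fun l _ => ?_
          have hdl : (0 : ℝ) < d l := by exact_mod_cast hd l
          rw [mul_div_assoc', le_div_iff₀ hdl]
          calc h l * f (l, o) * d l = (d l * h l) * f (l, o) := by ring
            _ ≤ D * f (l, o) := by gcongr; exact hdh l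
      _ ≤ D * η := by
          rw [← Finset.mul_sum]
          gcongr
  have hlocal : ∀ v, av v (coeff f (eval₂Hom (MvPolynomial.C.comp (Int.castRingHom k))
      (blockForm o i Y) P)) ≤ Real.exp (m * D * (c / h0 + η * (1 + 2 * K)) +
        m * D * ((∑ a, e a v) / N)) := by
    intro v
    refine (coeff_blockForm_le (av v) (hM v) hB (hMB v) (hMB' v) (fun i => he i v)
      (fun l => hh0.le.trans (hh l)) (fun l => (hY l).le v) hd hD.le hdh hdh' hP
      (E := m * ((∑ a, e a v) / N) + m * η) (fun f hf => ⟨(hE v f hf).1, (hE v f hf).2.le⟩)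
      f).trans ?_
    calc _ ≤ (N * B * (N + B)) ^ (∑ l, d l) * C ^ (∑ l, d l) *
          Real.exp (D * (m * ((∑ a, e a v) / N) + m * η + m * η * K) + K * (D * η)) := by
          gcongr
      _ = Real.exp ((∑ l, d l : ℕ) * c + (D * (m * ((∑ a, e a v) / N) + m * η + m * η * K) +
          K * (D * η))) := by
          rw [← mul_pow, ← hexp, ← Real.exp_nat_mul, ← Real.exp_add]
      _ ≤ _ := by
          rw [Real.exp_le_exp]
          have h1 : ((∑ l, d l : ℕ) : ℝ) * c ≤ m * D * (c / h0) := by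
            calc _ ≤ m * (D / h0) * c := by gcongr
              _ = _ := by ring
          have h2 : K * (D * η) ≤ m * (K * (D * η)) := le_mul_of_one_le_left (by positivity) hm'
          nlinarith
  calc _ ≤ ∏ v, Real.exp (m * D * (c / h0 + η * (1 + 2 * K)) + m * D * ((∑ a, e a v) / N)) :=
        Finset.prod_le_prod (fun v _ => (av v).nonneg _) fun v _ => hlocal v
    _ = Real.exp (m * D * (Fintype.card V * (c / h0 + η * (1 + 2 * K)) +
          (∑ v, ∑ a, e a v) / N)) := by
        rw [← Real.exp_sum, Finset.sum_add_distrib, ← Finset.mul_sum, ← Finset.mul_sum,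
          ← Finset.sum_div]
        simp only [Finset.sum_const, Finset.card_univ, nsmul_eq_mul]
        ring_nf
    _ < 1 := by
        rw [Real.exp_lt_one_iff]
        refine mul_neg_of_pos_of_neg (by positivity) ?_
        rw [neg_div] at hneg
        linarith

set_option maxHeartbeats 1000000 in
/-- A rapidly increasing chain of approximations must contain one with a small kernel vector. -/
theorem no_chain_without_small_kernel [NumberField k] (R : Subring k)
    (av : V → AbsoluteValue k ℝ) (hR : ∀ x ∈ R, x ≠ 0 → 1 ≤ ∏ v, av v x)
    {M M' : V → Matrix J J ℤ} (hM : ∀ v, M' v * M v = 1) (e : J → V → ℝ)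
    (he : ∑ v, ∑ a, e a v < 0) (o : J) {η : ℝ} (hη : 0 < η) :
    ∃ (m : ℕ) (Λ h0 : ℝ), ∀ (Y : Fin m → Matrix J J k) (h : Fin m → ℝ),
      (∀ l, IsApproxBasis R av M e o (Y l) (h l)) →
      (∀ l, ¬ HasSmallKernel o (Y l) (Real.exp (η * h l))) → (∀ l, h0 ≤ h l) →
      (∀ l l', l < l' → Λ * h l' ≤ h l) → False := by
  classical
  have : Nonempty J := ⟨o⟩
  obtain ⟨B1, hB1, hMB1⟩ := exists_bound_entries M
  obtain ⟨B2, hB2, hMB2⟩ := exists_bound_entries M'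
  obtain ⟨B, hB, hMB, hMB'⟩ : ∃ B : ℝ, 1 ≤ B ∧ (∀ v i j, |(M v i j : ℝ)| ≤ B) ∧
      ∀ v i j, |(M' v i j : ℝ)| ≤ B :=
    ⟨max B1 B2, hB1.trans (le_max_left _ _), fun v i j => (hMB1 v i j).trans (le_max_left _ _),
      fun v i j => (hMB2 v i j).trans (le_max_right _ _)⟩
  obtain ⟨K, hK, heK⟩ : ∃ K : ℝ, 1 ≤ K ∧ ∀ i v, |e i v| ≤ K := by
    obtain ⟨B, hB⟩ := (Set.finite_range fun x : J × V => |e x.1 x.2|).bddAbove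
    exact ⟨max 1 B, le_max_left _ _, fun i v =>
      (hB ⟨(i, v), rfl⟩).trans (le_max_right _ _)⟩
  have hN : (1 : ℝ) ≤ Fintype.card J := by exact_mod_cast Fintype.card_pos (α := J)
  set N : ℝ := (Fintype.card J : ℝ) with hNdef
  set γ := -(∑ v, ∑ a, e a v) with hγdef
  have hγ : 0 < γ := by linarith
  set W : ℝ := (Fintype.card V : ℝ) + 1 with hW
  have hW1 : (1 : ℝ) ≤ W := by rw [hW]; linarith [Nat.cast_nonneg (α := ℝ) (Fintype.card V)]
  obtain ⟨ε, hε, hε2, hεγ⟩ : ∃ ε : ℝ, 0 < ε ∧ ε ≤ 1 / 2 ∧ W * (ε * (1 + 2 * K)) ≤ γ / (4 * N) := by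
    refine ⟨min (1 / 2) (γ / (4 * N) / (W * (1 + 2 * K))), by positivity, min_le_left _ _, ?_⟩
    have h1 := min_le_right (1 / 2) (γ / (4 * N) / (W * (1 + 2 * K)))
    rw [le_div_iff₀ (by positivity)] at h1
    linarith
  obtain ⟨m, hm, hmt⟩ : ∃ m : ℕ, 1 ≤ m ∧
      2 * (Fintype.card V * (m * (2 * K) ^ 2)) ≤ (m * ε) ^ 2 := by
    obtain ⟨m, hm⟩ := exists_nat_ge (8 * Fintype.card V * K ^ 2 / ε ^ 2 + 1)
    have h1 : 0 ≤ 8 * Fintype.card V * K ^ 2 / ε ^ 2 := by positivity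
    have hm1 : (1 : ℝ) ≤ m := by linarith
    refine ⟨m, by exact_mod_cast hm1, ?_⟩
    have h2 : 8 * Fintype.card V * K ^ 2 / ε ^ 2 ≤ m := by linarith
    rw [div_le_iff₀ (by positivity)] at h2
    calc _ = m * (8 * Fintype.card V * K ^ 2) := by ring
      _ ≤ m * (m * ε ^ 2) := by gcongr
      _ = _ := by ring
  have hm' : (1 : ℝ) ≤ m := by exact_mod_cast hm
  obtain ⟨σ, hσ, hroth⟩ := roth_lemma k m ε hε
  set C : ℝ := 4 ^ Fintype.card J * (Fintype.card J * B) with hCdef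
  have hC : 1 ≤ C := one_le_mul_of_one_le_of_one_le (one_le_pow₀ (by norm_num))
    (one_le_mul_of_one_le_of_one_le hN hB)
  have hlogC : 0 ≤ Real.log C := Real.log_nonneg hC
  set c := Real.log (N * B * (N + B) * C) with hc
  have hc0 : 0 ≤ c := by
    refine Real.log_nonneg (one_le_mul_of_one_le_of_one_le (one_le_mul_of_one_le_of_one_le
      (one_le_mul_of_one_le_of_one_le hN hB) (by linarith)) hC)
  obtain ⟨h0, hh0, hh1, hh2⟩ : ∃ h0 : ℝ, 0 < h0 ∧ W * (c / h0) ≤ γ / (4 * N) ∧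
      m / h0 * (Real.log C + 1) ≤ σ * (η / N / 2) := by
    refine ⟨max (W * c / (γ / (4 * N)) + 1) (m * (Real.log C + 1) / (σ * (η / N / 2)) + 1),
      lt_max_of_lt_left (by positivity), ?_, ?_⟩
    · have h1 := le_max_left (W * c / (γ / (4 * N)) + 1)
        (m * (Real.log C + 1) / (σ * (η / N / 2)) + 1)
      set x := max (W * c / (γ / (4 * N)) + 1) (m * (Real.log C + 1) / (σ * (η / N / 2)) + 1)
      have hx : 0 < x := lt_of_lt_of_le (by positivity) h1
      have h2 : W * c / (γ / (4 * N)) ≤ x := by linarith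
      rw [div_le_iff₀ (by positivity)] at h2
      rw [mul_div_assoc', div_le_iff₀ hx]
      linarith
    · have h1 := le_max_right (W * c / (γ / (4 * N)) + 1)
        (m * (Real.log C + 1) / (σ * (η / N / 2)) + 1)
      set x := max (W * c / (γ / (4 * N)) + 1) (m * (Real.log C + 1) / (σ * (η / N / 2)) + 1)
      have hx : 0 < x := lt_of_lt_of_le (by positivity) h1
      have h2 : m * (Real.log C + 1) / (σ * (η / N / 2)) ≤ x := by linarith
      rw [div_le_iff₀ (by positivity)] at h2
      rw [div_mul_eq_mul_div, div_le_iff₀ hx]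
      linarith
  refine ⟨m, 2 / σ, h0, fun Y h hY hns hh hchain => ?_⟩
  have hhpos : ∀ l, 0 < h l := fun l => hh0.trans_le (hh l)
  obtain ⟨D, hD, hDh⟩ : ∃ D : ℝ, 0 < D ∧ ∀ l, h l ≤ ε * D := by
    have h1 : ∀ l, h l ≤ ∑ l, h l := fun l =>
      Finset.single_le_sum (fun l _ => (hhpos l).le) (Finset.mem_univ l)
    refine ⟨(∑ l, h l) / ε, div_pos ((hhpos ⟨0, hm⟩).trans_le (h1 _)) hε, fun l => ?_⟩
    rw [mul_div_cancel₀ _ hε.ne']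
    exact h1 l
  set d : Fin m → ℕ := fun l => ⌊D / h l⌋₊ with hddef
  have hdh : ∀ l, d l * h l ≤ D := fun l => by
    rw [← le_div_iff₀ (hhpos l)]
    exact Nat.floor_le (div_pos hD (hhpos l)).le
  have hdh' : ∀ l, D * (1 - ε) ≤ d l * h l := fun l => by
    have h1 := (Nat.lt_floor_add_one (D / h l)).le
    rw [div_le_iff₀ (hhpos l)] at h1
    have h2 := hDh l
    simp only [hddef]
    nlinarith
  have hd2 : ∀ l, D / 2 ≤ d l * h l := fun l => by
    have := hdh' l
    nlinarith
  have hd : ∀ l, 1 ≤ d l := fun l => by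
    rw [Nat.one_le_iff_ne_zero]
    intro h1
    have := hd2 l
    rw [h1, Nat.cast_zero, zero_mul] at this
    linarith
  obtain ⟨P, hP0, hPd, hPn, hPE⟩ := exists_auxiliary e heK M' hB hMB' (t := m * ε)
    (by positivity) hmt d hd
  have hpt : ∀ l, ∃ (ξ : J → k) (i q : J), q ≠ i ∧ ξ i ≠ 0 ∧
      (∀ I ≠ o, ∑ j, Y l I j * ξ j = 0) ∧ RothPoint (-ξ q / ξ i) (η / N * h l) := by
    intro l
    refine exists_rothPoint_of_not_hasSmallKernel o (hY l).det_ne_zero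
      (mul_nonneg (by positivity) (hhpos l).le) ?_
    convert hns l using 2
    rw [← hNdef]
    field_simp
  choose ξ i q hqi hξ hYξ hRP using hpt
  obtain ⟨Q, hQ0, hQd, hQn, hQ⟩ :=
    exists_binary_reduction hqi hξ (fun l => (hY l).det_ne_zero) hYξ P hP0 hPd
  obtain ⟨a, ha, haε⟩ := hroth d (fun l => η / N * h l) (fun l => -ξ l (q l) / ξ l (i l)) Q hQ0 hd
    (fun l l' hll => by
      have h1 := hchain l l' hll
      have h2 := hdh l
      have h3 := hd2 l'
      have h4 : (d l : ℝ) * (2 / σ * h l') ≤ 2 * (d l' * h l') := by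
        calc _ ≤ d l * h l := by gcongr
          _ ≤ D := h2
          _ ≤ _ := by linarith
      have h5 : (d l : ℝ) * (2 / σ) ≤ 2 * d l' := by
        refine le_of_mul_le_mul_right ?_ (hhpos l')
        linarith
      rw [mul_div_assoc', div_le_iff₀ hσ] at h5
      linarith) hRP hQd (fun l => by
      have h1 : Real.log (wnorm absInt (fun _ => 1) Q) ≤ (∑ l, d l : ℕ) * Real.log C := by
        rw [← Real.log_pow]
        exact Real.log_le_log (by linarith [one_le_wnorm_absInt hQ0]) (hQn.trans hPn)
      have h2 : ((∑ l, d l : ℕ) : ℝ) ≤ m * (D / h0) := by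
        push_cast
        calc ∑ l, (d l : ℝ) ≤ ∑ _l : Fin m, D / h0 := by
              refine Finset.sum_le_sum fun l _ => ?_
              rw [le_div_iff₀ hh0]
              exact (mul_le_mul_of_nonneg_left (hh l) (Nat.cast_nonneg _)).trans (hdh l)
          _ = _ := by simp
      have h3 : ∑ l', (d l' : ℝ) = ((∑ l, d l : ℕ) : ℝ) := by push_cast; rfl
      rw [h3]
      calc _ ≤ ((∑ l, d l : ℕ) : ℝ) * (Real.log C + 1) := by linarith
        _ ≤ m * (D / h0) * (Real.log C + 1) := by gcongr
        _ = D * (m / h0 * (Real.log C + 1)) := by ring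
        _ ≤ D * (σ * (η / N / 2)) := by gcongr
        _ = σ * (η / N * (D / 2)) := by ring
        _ ≤ σ * (η / N * (d l * h l)) := by gcongr; exact hd2 l
        _ = _ := by ring)
  obtain ⟨f, hf, hfa⟩ := hQ a ha
  refine absurd (hR _ (coeff_blockForm_mem R (fun l => (hY l).mem) P f) hf) (not_le.mpr ?_)
  refine product_coeff_lt_one hM hB hMB hMB' heK hh0 hh hY hm hd hε hD hdh hdh' hPd hC hPn hPE
    ?_ (f := f) (by simpa only [hfa] using haε)
  have h1 : (0 : ℝ) ≤ c / h0 := by positivity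
  calc Fintype.card V * (c / h0 + ε * (1 + 2 * K)) ≤ W * (c / h0 + ε * (1 + 2 * K)) := by
        gcongr
        rw [hW]
        linarith
    _ ≤ γ / (4 * N) + γ / (4 * N) := by rw [mul_add]; gcongr
    _ = γ / N / 2 := by field_simp; norm_num
    _ < γ / N := half_lt_self (by positivity)

end NonSmall

end

section SmallKernel

variable {k : Type*} [Field k] {J : Type*} [Fintype J] [DecidableEq J]
  {V : Type*} [Fintype V]

theorem AbsoluteValue.adjugate_le (A : AbsoluteValue k ℝ) {Z : Matrix J J k} {o : J} {b : J → ℝ}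
    (hb : ∀ i, 0 ≤ b i) (hZ : ∀ I ≠ o, ∀ i, A (Z I i) ≤ b i) (i : J) :
    A (Z.adjugate i o) ≤ (Fintype.card J).factorial * ∏ a ∈ Finset.univ.erase i, b a := by
  rw [Matrix.adjugate_apply, Matrix.det_apply]
  refine (A.sum_le _ _).trans ?_
  rw [← Fintype.card_perm, ← nsmul_eq_mul, ← Finset.card_univ]
  refine Finset.sum_le_card_nsmul _ _ _ fun s _ => ?_
  have h1 : A (s.sign • ∏ a, (Z.updateRow o (Pi.single i 1)) (s a) a) =
      ∏ a, A ((Z.updateRow o (Pi.single i 1)) (s a) a) := by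
    rw [← map_prod]
    rcases Int.units_eq_one_or s.sign with h | h
    · rw [h, one_smul]
    · rw [h, Units.neg_smul, one_smul, A.map_neg]
  rw [h1]
  have hnn : 0 ≤ ∏ a ∈ Finset.univ.erase i, b a := Finset.prod_nonneg fun a _ => hb a
  by_cases hs : s i = o
  · rw [← Finset.mul_prod_erase _ _ (Finset.mem_univ i), hs, Matrix.updateRow_self,
      Pi.single_eq_same, map_one, one_mul]
    refine Finset.prod_le_prod (fun _ _ => A.nonneg _) fun a ha => ?_
    have h2 : s a ≠ o := fun h => Finset.ne_of_mem_erase ha (s.injective (h.trans hs.symm))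
    rw [Matrix.updateRow_ne h2]
    exact hZ _ h2 a
  · refine le_of_eq_of_le (Finset.prod_eq_zero (Finset.mem_univ (s.symm o)) ?_) hnn
    rw [s.apply_symm_apply, Matrix.updateRow_self, Pi.single_eq_of_ne, map_zero]
    intro h
    exact hs (by rw [← h, s.apply_symm_apply])

theorem Subring.adjugate_mem (R : Subring k) {Y : Matrix J J k} {o : J}
    (hY : ∀ I ≠ o, ∀ i, Y I i ∈ R) (i : J) : Y.adjugate i o ∈ R := by
  rw [Matrix.adjugate_apply, Matrix.det_apply]
  refine R.sum_mem fun s _ => ?_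
  have h1 : ∏ a, (Y.updateRow o (Pi.single i 1)) (s a) a ∈ R := by
    refine R.prod_mem fun a _ => ?_
    by_cases hs : s a = o
    · rw [hs, Matrix.updateRow_self, Pi.single_apply]
      split_ifs
      exacts [R.one_mem, R.zero_mem]
    · rw [Matrix.updateRow_ne hs]
      exact hY _ hs a
  rcases Int.units_eq_one_or s.sign with h | h
  · rwa [h, one_smul]
  · rw [h, Units.neg_smul, one_smul]
    exact R.neg_mem h1

/-- A vector killed by all rows other than `o` is a multiple of the corresponding column of
the adjugate. -/
theorem eq_mul_adjugate_of_kernel {Y : Matrix J J k} (hY : Y.det ≠ 0) {o : J} {ξ : J → k}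
    (h : ∀ I ≠ o, ∑ j, Y I j * ξ j = 0) (q : J) :
    ξ q = (∑ j, Y o j * ξ j) / Y.det * Y.adjugate q o := by
  have h1 : Y.mulVec ξ = Pi.single o (∑ j, Y o j * ξ j) := by
    funext I
    by_cases hI : I = o
    · rw [hI, Pi.single_eq_same, Matrix.mulVec, dotProduct]
    · rw [Pi.single_eq_of_ne hI, Matrix.mulVec, dotProduct, h I hI]
  have h2 : Y.det * ξ q = Y.adjugate q o * ∑ j, Y o j * ξ j := by
    have h3 := congrFun (congrArg Y.adjugate.mulVec h1) q
    rw [Matrix.mulVec_mulVec, Matrix.adjugate_mul, Matrix.smul_mulVec, Matrix.one_mulVec,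
      Matrix.mulVec_single, Pi.smul_apply, smul_eq_mul] at h3
    rw [h3]
    simp
  field_simp
  linear_combination h2

omit [DecidableEq J] in
theorem AbsoluteValue.int_combination_le (A : AbsoluteValue k ℝ) {B X : ℝ} {n : J → ℤ}
    (hn : ∀ j, |(n j : ℝ)| ≤ B) {x : J → k} (hx : ∀ j, A (x j) ≤ X) (hB : 0 ≤ B) :
    A (∑ j, (n j : k) * x j) ≤ Fintype.card J * B * X := by
  refine (A.sum_le _ _).trans ?_
  rw [mul_assoc, ← nsmul_eq_mul, ← Finset.card_univ]
  refine Finset.sum_le_card_nsmul _ _ _ fun j _ => ?_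
  rw [map_mul]
  exact mul_le_mul ((A.intCast_le _).trans (hn j)) (hx j) (A.nonneg _) hB

theorem le_prod_inv_of_one_le_prod {x : V → ℝ} (hx0 : ∀ v, 0 ≤ x v) {X : ℝ} (hX : 1 ≤ X)
    (hx : ∀ v, x v ≤ X) (h : 1 ≤ ∏ v, x v) (v : V) : 1 ≤ x v * X ^ Fintype.card V := by
  classical
  rw [← Finset.mul_prod_erase _ _ (Finset.mem_univ v)] at h
  refine h.trans (mul_le_mul_of_nonneg_left ?_ (hx0 v))
  calc ∏ w ∈ Finset.univ.erase v, x w ≤ ∏ _w ∈ Finset.univ.erase v, X :=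
        Finset.prod_le_prod (fun w _ => hx0 w) fun w _ => hx w
    _ = X ^ (Finset.univ.erase v).card := by rw [Finset.prod_const]
    _ ≤ X ^ Fintype.card V := pow_le_pow_right₀ hX (Finset.card_le_univ _)

set_option maxHeartbeats 1000000 in
/-- A small kernel vector for one approximation is a kernel vector for all later ones. -/
theorem small_kernel_persists (R : Subring k)
    (av : V → AbsoluteValue k ℝ) (hR : ∀ x ∈ R, x ≠ 0 → 1 ≤ ∏ v, av v x)
    (hRint : ∀ x : k, IsIntegral ℤ x → x ∈ R)
    (hav : ∀ x : k, IsIntegral ℤ x → ∀ A : ℝ, 1 ≤ A → (∀ φ : k →+* ℂ, ‖φ x‖ ≤ A) →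
      ∀ v, av v x ≤ A)
    {M M' : V → Matrix J J ℤ} (hM : ∀ v, M' v * M v = 1) (e : J → V → ℝ)
    (he : ∑ v, ∑ a, e a v < 0) (o : J) :
    ∃ η h0 : ℝ, 0 < η ∧ ∀ (Y : Matrix J J k) (h : ℝ) (ξ : J → k),
      IsApproxBasis R av M e o Y h → h0 ≤ h → ξ ≠ 0 → (∀ q, IsIntegral ℤ (ξ q)) →
      (∀ q, ∀ φ : k →+* ℂ, ‖φ (ξ q)‖ ≤ Real.exp (η * h)) → (∀ I ≠ o, ∑ j, Y I j * ξ j = 0) →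
      ∀ (Y' : Matrix J J k) (h' : ℝ), IsApproxBasis R av M e o Y' h' → h ≤ h' →
        ∀ I ≠ o, ∑ j, Y' I j * ξ j = 0 := by
  classical
  have : Nonempty J := ⟨o⟩
  obtain ⟨B, hB, hMB⟩ := exists_bound_entries M'
  have hN : (1 : ℝ) ≤ Fintype.card J := by exact_mod_cast Fintype.card_pos (α := J)
  set N : ℝ := (Fintype.card J : ℝ) with hNdef
  set γ := -(∑ v, ∑ a, e a v) with hγdef
  have hγ : 0 < γ := by linarith
  set W : ℝ := (Fintype.card V : ℝ) with hW
  have hW0 : 0 ≤ W := Nat.cast_nonneg _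
  set F : ℝ := ((Fintype.card J).factorial : ℝ) with hF
  have hF1 : 1 ≤ F := by
    rw [hF]
    exact_mod_cast (Fintype.card J).factorial_pos
  have hNB : 1 ≤ N * B := one_le_mul_of_one_le_of_one_le hN hB
  set C1 := W * Real.log F + W * (W * Real.log (N * B)) with hC1
  set C2 := W * Real.log (N * (N * B)) with hC2
  have hlF : 0 ≤ Real.log F := Real.log_nonneg hF1
  have hlNB : 0 ≤ Real.log (N * B) := Real.log_nonneg hNB
  have hlNNB : 0 ≤ Real.log (N * (N * B)) :=
    Real.log_nonneg (one_le_mul_of_one_le_of_one_le hN hNB)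
  refine ⟨γ / (4 * (W + W * W + 1)), 4 * (C1 + C2 + 1) / γ, by positivity,
    fun Y h ξ hY hh hξ hξint hξA hYξ Y' h' hY' hhh I hI => ?_⟩
  set η := γ / (4 * (W + W * W + 1)) with hη
  have hη0 : 0 < η := by positivity
  have hηW : η * (W + W * W + 1) = γ / 4 := by rw [hη]; field_simp
  rw [div_le_iff₀ hγ] at hh
  have hC10 : 0 ≤ C1 := by positivity
  have hC20 : 0 ≤ C2 := by positivity
  have hh0 : 0 < h := by
    by_contra! hcon
    nlinarith
  have hA1 : 1 ≤ Real.exp (η * h) := Real.one_le_exp (by positivity)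
  have hξv : ∀ q v, av v (ξ q) ≤ Real.exp (η * h) := fun q v =>
    hav _ (hξint q) _ hA1 (hξA q) v
  -- coordinates of `ξ` in the dual coordinate systems
  set f : V → J → k := fun v i => ∑ q, (M' v q i : k) * ξ q with hfdef
  have hcast : ∀ v a b, ∑ i, (M' v a i : k) * (M v i b : k) = if a = b then 1 else 0 := by
    intro v a b
    have := congrFun (congrFun (hM v) a) b
    rw [Matrix.mul_apply, Matrix.one_apply] at this
    have h2 := congrArg (Int.cast : ℤ → k) this
    push_cast at h2
    exact h2
  have hpair : ∀ v (y : J → k), ∑ j, y j * ξ j = ∑ i, (∑ j, (M v i j : k) * y j) * f v i := by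
    intro v y
    have h1 : ∀ i, (∑ j, (M v i j : k) * y j) * f v i =
        ∑ j, ∑ q, (M' v q i : k) * (M v i j : k) * (y j * ξ q) := by
      intro i
      rw [hfdef, Finset.sum_mul_sum]
      exact Finset.sum_congr rfl fun j _ => Finset.sum_congr rfl fun q _ => by ring
    rw [Finset.sum_congr rfl fun i _ => h1 i, Finset.sum_comm]
    refine Finset.sum_congr rfl fun j _ => ?_
    rw [Finset.sum_comm]
    simp only [← Finset.sum_mul, hcast]
    simp
  have hf0 : ∀ v, ∃ i, f v i ≠ 0 := by
    intro v
    by_contra! hcon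
    refine hξ (funext fun q => ?_)
    have h1 := hpair v (Pi.single q 1)
    simp only [hcon, mul_zero, Finset.sum_const_zero] at h1
    simpa [Pi.single_apply] using h1
  have hmax : ∀ v, ∃ i, f v i ≠ 0 ∧ ∀ i', f v i' ≠ 0 → e i' v ≤ e i v := by
    intro v
    obtain ⟨i0, hi0⟩ := hf0 v
    obtain ⟨i, hi, hi'⟩ := Finset.exists_max_image (Finset.univ.filter fun i => f v i ≠ 0)
      (fun i => e i v) ⟨i0, by simpa using hi0⟩
    exact ⟨i, by simpa using hi, fun i' h => hi' i' (by simpa using h)⟩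
  choose ι hι hιmax using hmax
  have hfint : ∀ v i, IsIntegral ℤ (f v i) := fun v i =>
    IsIntegral.sum _ fun q _ => (isIntegral_algebraMap (R := ℤ) (A := k)).mul (hξint q)
  have hfle : ∀ v i w, av w (f v i) ≤ N * B * Real.exp (η * h) := fun v i w =>
    (av w).int_combination_le (fun q => hMB v q i) (fun q => hξv q w) (by linarith)
  -- comparison of `f` with the adjugate
  set lam := (∑ j, Y o j * ξ j) / Y.det with hlam
  have hξlam : ∀ q, ξ q = lam * Y.adjugate q o := eq_mul_adjugate_of_kernel hY.det_ne_zero hYξ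
  have hlamprod : ∏ v, av v lam ≤ Real.exp (η * h) ^ Fintype.card V := by
    obtain ⟨q, hq⟩ := Function.ne_iff.mp hξ
    rw [Pi.zero_apply, hξlam q] at hq
    have h1 := hR _ (R.adjugate_mem hY.mem q) (right_ne_zero_of_mul hq)
    calc ∏ v, av v lam ≤ (∏ v, av v lam) * ∏ v, av v (Y.adjugate q o) :=
          le_mul_of_one_le_right (Finset.prod_nonneg fun v _ => (av v).nonneg _) h1
      _ = ∏ v, av v (ξ q) := by
          rw [← Finset.prod_mul_distrib]
          exact Finset.prod_congr rfl fun v _ => by rw [hξlam q, map_mul]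
      _ ≤ ∏ _v : V, Real.exp (η * h) :=
          Finset.prod_le_prod (fun v _ => (av v).nonneg _) fun v _ => hξv q v
      _ = _ := by rw [Finset.prod_const, Finset.card_univ]
  have hfadj : ∀ v i, av v (f v i) ≤
      av v lam * (F * Real.exp (h * (∑ a, e a v - e i v))) := by
    intro v i
    set Z : Matrix J J k := Y * ((M v).map (Int.cast : ℤ → k)).transpose with hZ
    have hZap : ∀ I i, Z I i = ∑ j, (M v i j : k) * Y I j := by
      intro I i
      rw [hZ, Matrix.mul_apply]
      exact Finset.sum_congr rfl fun j _ => mul_comm _ _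
    have hdetu : IsUnit (M v).det := by
      have := congrArg Matrix.det (hM v)
      rw [Matrix.det_mul, Matrix.det_one] at this
      exact IsUnit.of_mul_eq_one_right _ this
    have hdetM : av v (((M v).map (Int.cast : ℤ → k)).transpose.det) = 1 ∧
        ((M v).map (Int.cast : ℤ → k)).transpose.det ≠ 0 := by
      have h1 : ((M v).map (Int.cast : ℤ → k)).transpose.det = (((M v).det : ℤ) : k) := by
        rw [Matrix.det_transpose]
        exact ((Int.castRingHom k).map_det (M v)).symm
      rw [h1]
      rcases Int.isUnit_iff.mp hdetu with h2 | h2 <;> rw [h2] <;> simp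
    have hZdet : Z.det ≠ 0 := by
      rw [hZ, Matrix.det_mul]
      exact mul_ne_zero hY.det_ne_zero hdetM.2
    have hZf : ∀ I, ∑ j, Z I j * f v j = ∑ j, Y I j * ξ j := by
      intro I
      rw [hpair v (Y I)]
      exact Finset.sum_congr rfl fun j _ => by rw [hZap]
    have h2 := eq_mul_adjugate_of_kernel hZdet (o := o) (ξ := f v)
      (fun I hI => by rw [hZf, hYξ I hI]) i
    rw [hZf, hZ, Matrix.det_mul, ← hZ] at h2
    rw [h2, map_mul, map_div₀, map_mul, hdetM.1, mul_one, ← map_div₀]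
    refine mul_le_mul_of_nonneg_left ?_ ((av v).nonneg _)
    refine ((av v).adjugate_le (b := fun i => Real.exp (h * e i v)) (fun _ => by positivity)
      (fun I hI i => ?_) i).trans ?_
    · rw [hZap]
      exact hY.le v I hI i
    · rw [← Real.exp_sum, ← Finset.mul_sum, ← Finset.add_sum_erase _ _ (Finset.mem_univ i),
        add_sub_cancel_left]
  set E := ∑ v, e (ι v) v with hE
  have hEneg : h * E ≤ -(h * γ) + (C1 + η * (W + W * W) * h) := by
    have h1 : ∀ v, Real.exp (-(W * (Real.log (N * B) + η * h))) ≤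
        av v lam * (F * Real.exp (h * (∑ a, e a v - e (ι v) v))) := by
      intro v
      refine le_trans ?_ (hfadj v (ι v))
      have h2 := le_prod_inv_of_one_le_prod (fun w => (av w).nonneg (f v (ι v)))
        (one_le_mul_of_one_le_of_one_le hNB hA1) (fun w => hfle v (ι v) w)
        (hR _ (hRint _ (hfint v (ι v))) (hι v)) v
      have h3 : (N * B * Real.exp (η * h)) ^ Fintype.card V =
          Real.exp (W * (Real.log (N * B) + η * h)) := by
        rw [Real.exp_nat_mul, Real.exp_add, Real.exp_log (by linarith)]
      rw [h3] at h2
      rw [Real.exp_neg, inv_le_iff_one_le_mul₀ (Real.exp_pos _)]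
      exact h2
    have h4 := Finset.prod_le_prod (s := Finset.univ) (fun v _ => (Real.exp_pos _).le)
      (fun v (_ : v ∈ Finset.univ) => h1 v)
    rw [Finset.prod_const, Finset.card_univ, ← Real.exp_nat_mul, Finset.prod_mul_distrib,
      Finset.prod_mul_distrib, Finset.prod_const, Finset.card_univ, ← Real.exp_sum,
      ← Finset.mul_sum, Finset.sum_sub_distrib] at h4
    have h5 : (∏ v, av v lam) * (F ^ Fintype.card V *
        Real.exp (h * (∑ v, ∑ a, e a v - E))) ≤
        Real.exp (W * (η * h) + (W * Real.log F + h * (-γ - E))) := by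
      rw [Real.exp_add, Real.exp_add, Real.exp_nat_mul, Real.exp_nat_mul,
        Real.exp_log (by linarith), hγdef, neg_neg]
      gcongr
    have h6 := Real.exp_le_exp.mp (h4.trans h5)
    rw [hC1]
    linarith
  have hE2 : E ≤ -γ / 2 := by
    have h1 : h * E ≤ h * (-γ / 2) := by nlinarith
    exact le_of_mul_le_mul_left h1 hh0
  by_contra hne
  have hmem : ∑ j, Y' I j * ξ j ∈ R :=
    R.sum_mem fun j _ => R.mul_mem (hY'.mem I hI j) (hRint _ (hξint j))
  refine absurd (hR _ hmem hne) (not_le.mpr ?_)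
  have h1 : ∀ v, av v (∑ j, Y' I j * ξ j) ≤
      Real.exp (Real.log (N * (N * B)) + η * h + h' * e (ι v) v) := by
    intro v
    rw [hpair v]
    refine ((av v).sum_le _ _).trans ?_
    calc _ ≤ ∑ _i : J, Real.exp (h' * e (ι v) v) * (N * B * Real.exp (η * h)) := by
          refine Finset.sum_le_sum fun i _ => ?_
          rw [map_mul]
          by_cases hfi : f v i = 0
          · rw [hfi, map_zero, mul_zero]
            positivity
          · refine mul_le_mul ((hY'.le v I hI i).trans (Real.exp_le_exp.mpr ?_)) (hfle v i v)
              ((av v).nonneg _) (Real.exp_pos _).le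
            exact mul_le_mul_of_nonneg_left (hιmax v i hfi) (hh0.le.trans hhh)
      _ = _ := by
          rw [Finset.sum_const, Finset.card_univ, nsmul_eq_mul, Real.exp_add, Real.exp_add,
            Real.exp_log (by positivity)]
          ring
  calc _ ≤ ∏ v, Real.exp (Real.log (N * (N * B)) + η * h + h' * e (ι v) v) :=
        Finset.prod_le_prod (fun v _ => (av v).nonneg _) fun v _ => h1 v
    _ = Real.exp (C2 + W * (η * h) + h' * E) := by
        rw [← Real.exp_sum, Finset.sum_add_distrib, ← Finset.mul_sum, Finset.sum_const,
          Finset.card_univ, nsmul_eq_mul, mul_add]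
    _ < 1 := by
        rw [Real.exp_lt_one_iff]
        have h2 : h' * E ≤ h' * (-γ / 2) :=
          mul_le_mul_of_nonneg_left hE2 (hh0.le.trans hhh)
        have h3 : W * (η * h) ≤ γ / 4 * h' := by
          have h4 : W * η ≤ γ / 4 := by nlinarith [mul_nonneg hη0.le (mul_nonneg hW0 hW0)]
          calc W * (η * h) = W * η * h := by ring
            _ ≤ γ / 4 * h' := mul_le_mul h4 hhh hh0.le (by positivity)
        nlinarith

theorem exists_chain {ι : Type*} {T : Set ι} (hT : T.Infinite) {h : ι → ℝ}
    (hh : ∀ B : ℝ, {j | h j ≤ B}.Finite) (Λ h0 : ℝ) (m : ℕ) :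
    ∃ f : Fin m → ι, (∀ l, f l ∈ T) ∧ (∀ l, h0 ≤ h (f l)) ∧
      ∀ l l', l < l' → Λ * h (f l') ≤ h (f l) := by
  induction m with
  | zero => exact ⟨Fin.elim0, fun l => l.elim0, fun l => l.elim0, fun l => l.elim0⟩
  | succ m ih =>
    obtain ⟨f, hf, hf0, hfc⟩ := ih
    obtain ⟨B, hB⟩ := (Set.finite_range fun l => Λ * h (f l)).bddAbove
    obtain ⟨j, hj, hjB⟩ := (hT.sdiff (hh (max h0 B))).nonempty
    rw [Set.mem_ofPred_eq, not_le, max_lt_iff] at hjB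
    refine ⟨Fin.cons j f, Fin.cases (by simpa using hj) fun l => by simpa using hf l,
      Fin.cases (by simpa using hjB.1.le) fun l => by simpa using hf0 l, ?_⟩
    intro l l' hll
    obtain ⟨p, rfl⟩ := Fin.exists_succ_eq.mpr (Fin.ne_zero_of_lt hll)
    rw [Fin.cons_succ]
    induction l using Fin.cases with
    | zero => rw [Fin.cons_zero]; exact (hB ⟨p, rfl⟩).trans hjB.2.le
    | succ l => rw [Fin.cons_succ]; exact hfc l p (Fin.succ_lt_succ_iff.mp hll)

/-- The subspace theorem in the penultimate minimum case. -/
theorem exists_common_kernel [NumberField k] (R : Subring k)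
    (av : V → AbsoluteValue k ℝ) (hR : ∀ x ∈ R, x ≠ 0 → 1 ≤ ∏ v, av v x)
    (hRint : ∀ x : k, IsIntegral ℤ x → x ∈ R)
    (hav : ∀ x : k, IsIntegral ℤ x → ∀ A : ℝ, 1 ≤ A → (∀ φ : k →+* ℂ, ‖φ x‖ ≤ A) →
      ∀ v, av v x ≤ A)
    {M M' : V → Matrix J J ℤ} (hM : ∀ v, M' v * M v = 1) (e : J → V → ℝ)
    (he : ∑ v, ∑ a, e a v < 0) (o : J) {ι : Type*} {T : Set ι} (hT : T.Infinite) {h : ι → ℝ}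
    (hh : ∀ B : ℝ, {j | h j ≤ B}.Finite) {Y : ι → Matrix J J k}
    (hY : ∀ j ∈ T, IsApproxBasis R av M e o (Y j) (h j)) :
    ∃ ξ : J → k, ξ ≠ 0 ∧ {j ∈ T | ∀ I ≠ o, ∑ q, Y j I q * ξ q = 0}.Infinite := by
  obtain ⟨η, h0, hη, hpers⟩ := small_kernel_persists R av hR hRint hav hM e he o
  obtain ⟨m, Λ, h1, hno⟩ := no_chain_without_small_kernel R av hR hM e he o hη
  obtain ⟨j, hjT, hj0, ξ, hξ0, hξint, hξA, hξY⟩ :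
      ∃ j ∈ T, h0 ≤ h j ∧ HasSmallKernel o (Y j) (Real.exp (η * h j)) := by
    by_contra! hcon
    obtain ⟨f, hf, hf0, hfc⟩ := exists_chain hT hh Λ (max h0 h1) m
    exact hno (fun l => Y (f l)) (fun l => h (f l)) (fun l => hY _ (hf l))
      (fun l => hcon _ (hf l) ((le_max_left _ _).trans (hf0 l)))
      (fun l => (le_max_right _ _).trans (hf0 l)) hfc
  refine ⟨ξ, hξ0, (hT.sdiff (hh (h j))).mono fun j' hj' => ⟨hj'.1, fun I hI => ?_⟩⟩
  exact hpers (Y j) (h j) ξ (hY j hjT) hj0 hξ0 hξint hξA hξY (Y j') (h j') (hY j' hj'.1)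
    (not_le.mp hj'.2).le I hI

end SmallKernel

section CauchyBinet

variable {R : Type*} [CommRing R]

/-- Increasing sequences of `p` indices. -/
abbrev SubIndex (p n : ℕ) := {f : Fin p → Fin n // StrictMono f}

open scoped Classical in
noncomputable instance (p n : ℕ) : Fintype (SubIndex p n) := Subtype.fintype _

/-- An injective sequence is an increasing one up to a permutation. -/
noncomputable def subIndexEquiv (p n : ℕ) :
    SubIndex p n × Equiv.Perm (Fin p) ≃ {f : Fin p → Fin n // Function.Injective f} :=
  Equiv.ofBijective (fun x => ⟨x.1.1 ∘ x.2, x.1.2.injective.comp x.2.injective⟩) <| by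
    constructor
    · rintro ⟨⟨K, hK⟩, s⟩ ⟨⟨K', hK'⟩, s'⟩ h
      have h1 : K ∘ s = K' ∘ s' := congrArg Subtype.val h
      have h2 : Set.range K = Set.range K' := by
        have := congrArg Set.range h1
        rwa [s.surjective.range_comp, s'.surjective.range_comp] at this
      have h3 : K = K' := hK.range_inj hK' |>.mp h2
      subst h3
      have h4 : s = s' := by
        ext i
        exact congrArg Fin.val (hK.injective (congrFun h1 i))
      rw [h4]
    · rintro ⟨f, hf⟩
      refine ⟨⟨⟨f ∘ Tuple.sort f, (Tuple.monotone_sort f).strictMono_of_injective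
        (hf.comp (Tuple.sort f).injective)⟩, (Tuple.sort f)⁻¹⟩, Subtype.ext ?_⟩
      funext i
      simp

/-- The Cauchy–Binet formula. -/
theorem Matrix.det_mul_eq_sum_subIndex {p n : ℕ} (A : Matrix (Fin p) (Fin n) R)
    (B : Matrix (Fin n) (Fin p) R) :
    (A * B).det = ∑ I : SubIndex p n, (A.submatrix id I.1).det * (B.submatrix I.1 id).det := by
  classical
  have h1 : (A * B).det = ∑ f : Fin p → Fin n, (A.submatrix id f).det * ∏ i, B (f i) i := by
    have h2 : ∀ s : Equiv.Perm (Fin p), ∏ i, (A * B) (s i) i =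
        ∑ f : Fin p → Fin n, ∏ i, (A (s i) (f i) * B (f i) i) := by
      intro s
      simp only [Matrix.mul_apply]
      rw [Finset.prod_univ_sum, Fintype.piFinset_univ]
    rw [Matrix.det_apply]
    simp only [h2, Matrix.det_apply, Finset.sum_mul, Finset.smul_sum]
    rw [Finset.sum_comm]
    refine Finset.sum_congr rfl fun f _ => Finset.sum_congr rfl fun s _ => ?_
    rw [Finset.prod_mul_distrib, smul_mul_assoc]
    rfl
  have h3 : ∑ f : Fin p → Fin n, (A.submatrix id f).det * ∏ i, B (f i) i =
      ∑ f : {f : Fin p → Fin n // Function.Injective f},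
        (A.submatrix id f.1).det * ∏ i, B (f.1 i) i := by
    rw [← Finset.sum_subtype (Finset.univ.filter fun f : Fin p → Fin n => Function.Injective f)
      (by simp) fun f => (A.submatrix id f).det * ∏ i, B (f i) i]
    refine (Finset.sum_filter_of_ne ?_).symm
    intro f _ hf
    by_contra hinj
    rw [Function.Injective] at hinj
    push Not at hinj
    obtain ⟨i, j, hij, hne⟩ := hinj
    refine hf ?_
    rw [Matrix.det_zero_of_column_eq hne (fun a => by simp [hij]), zero_mul]
  rw [h1, h3, ← (subIndexEquiv p n).sum_comp, Fintype.sum_prod_type]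
  refine Finset.sum_congr rfl fun I _ => ?_
  have h4 : ∀ s : Equiv.Perm (Fin p),
      (A.submatrix id ((subIndexEquiv p n (I, s)).1)).det =
        (Equiv.Perm.sign s : ℤ) * (A.submatrix id I.1).det := by
    intro s
    exact Matrix.det_permute' s (A.submatrix id I.1)
  simp only [h4]
  rw [Matrix.det_apply' (B.submatrix I.1 id), Finset.mul_sum]
  refine Finset.sum_congr rfl fun s _ => ?_
  simp only [Matrix.submatrix_apply, id]
  rw [mul_comm (((Equiv.Perm.sign s : ℤ) : R)), mul_assoc]
  rfl

/-- The matrix of `p × p` minors. -/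
noncomputable def Matrix.compound {n : ℕ} (p : ℕ) (A : Matrix (Fin n) (Fin n) R) :
    Matrix (SubIndex p n) (SubIndex p n) R :=
  Matrix.of fun I K => (A.submatrix I.1 K.1).det

theorem Matrix.compound_mul {n : ℕ} (p : ℕ) (A B : Matrix (Fin n) (Fin n) R) :
    (A * B).compound p = A.compound p * B.compound p := by
  ext I K
  rw [Matrix.mul_apply]
  exact Matrix.det_mul_eq_sum_subIndex (A.submatrix I.1 id) (B.submatrix id K.1)

open scoped Classical in
theorem Matrix.compound_one {n : ℕ} (p : ℕ) :
    (1 : Matrix (Fin n) (Fin n) R).compound p = 1 := by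
  ext I K
  rw [Matrix.one_apply]
  split_ifs with h
  · subst h
    have : (1 : Matrix (Fin n) (Fin n) R).submatrix I.1 I.1 = 1 := by
      ext a b
      simp [Matrix.one_apply, I.2.injective.eq_iff]
    rw [Matrix.compound, Matrix.of_apply, this, Matrix.det_one]
  · have h1 : ∃ t, ∀ s, I.1 t ≠ K.1 s := by
      by_contra! hcon
      refine h (Subtype.ext ?_)
      refine (I.2.range_inj K.2).mp ?_
      have hsub : Finset.univ.image I.1 ⊆ Finset.univ.image K.1 := by
        intro a ha
        obtain ⟨t, -, rfl⟩ := Finset.mem_image.mp ha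
        obtain ⟨s, hs⟩ := hcon t
        exact Finset.mem_image.mpr ⟨s, Finset.mem_univ _, hs.symm⟩
      have := Finset.eq_of_subset_of_card_le hsub (by
        rw [Finset.card_image_of_injective _ I.2.injective,
          Finset.card_image_of_injective _ K.2.injective])
      simpa using congrArg (fun s : Finset (Fin n) => (s : Set (Fin n))) this
    obtain ⟨t, ht⟩ := h1
    exact Matrix.det_eq_zero_of_row_eq_zero t fun s => by simp [ht s]

/-- The increasing sequence of the last `p` indices. -/
def SubIndex.top {p n l : ℕ} (h : l + p = n) : SubIndex p n :=
  ⟨fun t => ⟨l + t, by omega⟩, fun s t hst => by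
    rw [Fin.lt_def] at hst ⊢
    simpa using hst⟩

theorem SubIndex.exists_lt_of_ne_top {p n l : ℕ} (h : l + p = n) {I : SubIndex p n}
    (hI : I ≠ SubIndex.top h) : ∃ t, (I.1 t : ℕ) < l := by
  by_contra! hcon
  refine hI (Subtype.ext (funext fun t => Fin.ext ?_))
  have h1 : ∀ a : ℕ, ∀ ha : a < p, l + a ≤ I.1 ⟨a, ha⟩ := by
    intro a
    induction a with
    | zero => exact fun ha => hcon _
    | succ a ih =>
      intro ha
      have := I.2 (show (⟨a, by omega⟩ : Fin p) < ⟨a + 1, ha⟩ by simp [Fin.lt_def])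
      rw [Fin.lt_def] at this
      have := ih (by omega)
      omega
  have h2 : ∀ b a : ℕ, ∀ ha : a < p, a + b + 1 = p → (I.1 ⟨a, ha⟩ : ℕ) + b + 1 ≤ n := by
    intro b
    induction b with
    | zero => exact fun a ha _ => (I.1 ⟨a, ha⟩).2
    | succ b ih =>
      intro a ha hab
      have := I.2 (show (⟨a, ha⟩ : Fin p) < ⟨a + 1, by omega⟩ by simp [Fin.lt_def])
      rw [Fin.lt_def] at this
      have := ih (a + 1) (by omega) (by omega)
      omega
  have h3 := h1 t t.2
  have h4 := h2 (p - 1 - t) t t.2 (by omega)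
  simp only [SubIndex.top]
  simp only [Fin.eta] at h3 h4
  omega

/-- Every index occurs equally often in the increasing sequences. -/
theorem exists_sum_subIndex (p n : ℕ) : ∃ κ : ℕ, ∀ w : Fin n → ℝ,
    ∑ I : SubIndex p n, ∑ t, w (I.1 t) = κ * ∑ a, w a := by
  classical
  have h0 : ∀ w : Fin n → ℝ, ∑ I : SubIndex p n, ∑ t, w (I.1 t) =
      ∑ s ∈ Finset.powersetCard p (Finset.univ : Finset (Fin n)), ∑ a ∈ s, w a := by
    intro w
    refine Finset.sum_bij (fun I _ => Finset.univ.image I.1) ?_ ?_ ?_ ?_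
    · intro I _
      rw [Finset.mem_powersetCard, Finset.card_image_of_injective _ I.2.injective]
      simp
    · intro I _ K _ h
      refine Subtype.ext ((I.2.range_inj K.2).mp ?_)
      simpa using congrArg (fun s : Finset (Fin n) => (s : Set (Fin n))) h
    · intro s hs
      have hs' := (Finset.mem_powersetCard.mp hs).2
      refine ⟨⟨s.orderEmbOfFin hs', (s.orderEmbOfFin hs').strictMono⟩, Finset.mem_univ _, ?_⟩
      simp
    · intro I _
      rw [Finset.sum_image fun a _ b _ h => I.2.injective h]
  have hk : ∀ a b : Fin n,
      ((Finset.powersetCard p (Finset.univ : Finset (Fin n))).filter fun s => a ∈ s).card =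
      ((Finset.powersetCard p (Finset.univ : Finset (Fin n))).filter fun s => b ∈ s).card := by
    intro a b
    refine Finset.card_bij (fun s _ => s.map (Equiv.swap a b).toEmbedding) ?_ ?_ ?_
    · intro s hs
      rw [Finset.mem_filter, Finset.mem_powersetCard] at hs ⊢
      refine ⟨⟨Finset.subset_univ _, by rw [Finset.card_map, hs.1.2]⟩, ?_⟩
      exact Finset.mem_map.mpr ⟨a, hs.2, Equiv.swap_apply_left a b⟩
    · intro s _ t _ h
      exact Finset.map_injective _ h
    · intro s hs
      rw [Finset.mem_filter, Finset.mem_powersetCard] at hs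
      refine ⟨s.map (Equiv.swap a b).toEmbedding, ?_, ?_⟩
      · rw [Finset.mem_filter, Finset.mem_powersetCard]
        refine ⟨⟨Finset.subset_univ _, by rw [Finset.card_map, hs.1.2]⟩, ?_⟩
        exact Finset.mem_map.mpr ⟨b, hs.2, Equiv.swap_apply_right a b⟩
      · ext c
        simp
  rcases isEmpty_or_nonempty (Fin n) with hn | ⟨⟨a0⟩⟩
  · refine ⟨0, fun w => ?_⟩
    rw [h0, Nat.cast_zero, zero_mul]
    exact Finset.sum_eq_zero fun s _ => by rw [Finset.eq_empty_of_isEmpty s, Finset.sum_empty]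
  · refine ⟨((Finset.powersetCard p (Finset.univ : Finset (Fin n))).filter
      fun s => a0 ∈ s).card, fun w => ?_⟩
    rw [h0, Finset.mul_sum]
    have h1 : ∀ s : Finset (Fin n), ∑ a ∈ s, w a = ∑ a, if a ∈ s then w a else 0 := by
      intro s
      simp
    simp only [h1]
    rw [Finset.sum_comm]
    refine Finset.sum_congr rfl fun a _ => ?_
    rw [← Finset.sum_filter, Finset.sum_const, nsmul_eq_mul, hk a a0]

end CauchyBinet

section Places

open NumberField

variable {k : Type*} [Field k] [NumberField k]

/-- The complex embeddings of `k` together with a finite set of finite places. -/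
abbrev PlaceIndex (S : Finset (FinitePlace k)) := (k →+* ℂ) ⊕ S

/-- The absolute values attached to the complex embeddings and to the places in `S`. -/
noncomputable def placeAbs (S : Finset (FinitePlace k)) : PlaceIndex S → AbsoluteValue k ℝ :=
  Sum.elim (fun φ => (InfinitePlace.mk φ).1) fun w => w.1.1

@[simp] theorem placeAbs_inl (S : Finset (FinitePlace k)) (φ : k →+* ℂ) (x : k) :
    placeAbs S (Sum.inl φ) x = ‖φ x‖ := rfl

@[simp] theorem placeAbs_inr (S : Finset (FinitePlace k)) (w : S) (x : k) :
    placeAbs S (Sum.inr w) x = w.1 x := rfl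

/-- The ring of `S`-integers. -/
def sIntegers (S : Finset (FinitePlace k)) : Subring k where
  carrier := {x | ∀ w : FinitePlace k, w ∉ S → w x ≤ 1}
  mul_mem' := fun hx hy w hw => by
    rw [map_mul]
    exact mul_le_one₀ (hx w hw) (apply_nonneg w _) (hy w hw)
  one_mem' := fun w _ => by rw [map_one]
  add_mem' := fun hx hy w hw => (w.add_le _ _).trans (max_le (hx w hw) (hy w hw))
  zero_mem' := fun w _ => by rw [map_zero]; exact zero_le_one
  neg_mem' := fun hx w hw => by rw [map_neg_eq_map]; exact hx w hw

/-- The `S`-units. -/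
def IsSUnit (S : Finset (FinitePlace k)) (x : k) : Prop :=
  x ≠ 0 ∧ ∀ w : FinitePlace k, w ∉ S → w x = 1

theorem IsSUnit.mem_sIntegers {S : Finset (FinitePlace k)} {x : k} (hx : IsSUnit S x) :
    x ∈ sIntegers S := fun w hw => (hx.2 w hw).le

theorem NumberField.FinitePlace.le_one_of_isIntegral (w : FinitePlace k) {x : k} (hx : IsIntegral ℤ x) :
    w x ≤ 1 := by
  rw [← w.norm_embedding_eq]
  exact NumberField.FinitePlace.norm_le_one (K := k) w.maximalIdeal (⟨x, hx⟩ : 𝓞 k)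

theorem mem_sIntegers_of_isIntegral (S : Finset (FinitePlace k)) {x : k} (hx : IsIntegral ℤ x) :
    x ∈ sIntegers S := fun w _ => FinitePlace.le_one_of_isIntegral w hx

theorem placeAbs_le_of_isIntegral (S : Finset (FinitePlace k)) {x : k} (hx : IsIntegral ℤ x)
    {A : ℝ} (hA : 1 ≤ A) (h : ∀ φ : k →+* ℂ, ‖φ x‖ ≤ A) (v : PlaceIndex S) :
    placeAbs S v x ≤ A := by
  rcases v with φ | w
  · exact h φ
  · exact (FinitePlace.le_one_of_isIntegral w.1 hx).trans hA

theorem prod_embeddings_eq_prod_pow_mult (f : InfinitePlace k → ℝ) :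
    ∏ φ : k →+* ℂ, f (InfinitePlace.mk φ) = ∏ w, f w ^ w.mult := by
  classical
  rw [← Finset.prod_fiberwise Finset.univ (fun φ : k →+* ℂ => InfinitePlace.mk φ)]
  refine Finset.prod_congr rfl fun w _ => ?_
  rw [← InfinitePlace.card_filter_mk_eq w]
  refine Finset.prod_eq_pow_card fun φ hφ => ?_
  rw [(Finset.mem_filter.mp hφ).2]

theorem finprod_finitePlace_eq_prod {S : Finset (FinitePlace k)} {f : FinitePlace k → ℝ}
    (hf : ∀ w ∉ S, f w = 1) : ∏ᶠ w, f w = ∏ w : S, f w := by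
  rw [finprod_eq_prod_of_mulSupport_subset (s := S), Finset.prod_coe_sort S f]
  intro w hw
  by_contra h
  exact hw (hf w h)

theorem one_le_prod_placeAbs {S : Finset (FinitePlace k)} {x : k} (hx : x ∈ sIntegers S)
    (hx0 : x ≠ 0) : 1 ≤ ∏ v, placeAbs S v x := by
  have h := prod_abs_eq_one hx0
  rw [← prod_embeddings_eq_prod_pow_mult fun w => w x] at h
  rw [Fintype.prod_sum_type, ← h]
  refine mul_le_mul_of_nonneg_left ?_ (Finset.prod_nonneg fun φ _ => apply_nonneg _ _)
  have hfin := FinitePlace.hasFiniteMulSupport hx0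
  classical
  set T : Finset (FinitePlace k) := S ∪ hfin.toFinset with hT
  rw [finprod_eq_prod_of_mulSupport_subset (s := T)]
  · simp only [placeAbs_inr]
    rw [Finset.prod_coe_sort S fun w => w x, ← Finset.prod_sdiff (Finset.subset_union_left :
      S ⊆ T)]
    refine mul_le_of_le_one_left (Finset.prod_nonneg fun w _ => apply_nonneg _ _) ?_
    exact Finset.prod_le_one (fun w _ => apply_nonneg _ _) fun w hw =>
      hx w (Finset.mem_sdiff.mp hw).2
  · intro w hw
    simp only [hT, Finset.coe_union]
    exact Or.inr (hfin.mem_toFinset.mpr hw)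

theorem prod_placeAbs_eq_one {S : Finset (FinitePlace k)} {x : k} (hx : IsSUnit S x) :
    ∏ v, placeAbs S v x = 1 := by
  have h := prod_abs_eq_one hx.1
  rw [← prod_embeddings_eq_prod_pow_mult fun w => w x,
    finprod_finitePlace_eq_prod (S := S) hx.2] at h
  rw [Fintype.prod_sum_type]
  exact h

theorem mulHeight₁_eq_prod_placeAbs {S : Finset (FinitePlace k)} {x : k} (hx : IsSUnit S x) :
    Height.mulHeight₁ x = ∏ v, max (placeAbs S v x) 1 := by
  rw [NumberField.mulHeight₁_eq, ← prod_embeddings_eq_prod_pow_mult fun w => max (w x) 1,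
    finprod_finitePlace_eq_prod (S := S) (fun w hw => by rw [hx.2 w hw, max_self]),
    Fintype.prod_sum_type]
  rfl

/-- Finitely generated groups consist of `S`-units for a finite set `S`. -/
theorem exists_isSUnit_of_fg {Γ : Subgroup kˣ} (hΓ : Γ.FG) :
    ∃ S : Finset (FinitePlace k), ∀ u ∈ Γ, IsSUnit S (u : k) := by
  classical
  obtain ⟨G, rfl⟩ := hΓ
  refine ⟨G.biUnion fun g => (FinitePlace.hasFiniteMulSupport g.ne_zero).toFinset,
    fun u hu => ⟨u.ne_zero, fun w hw => ?_⟩⟩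
  induction hu using Subgroup.closure_induction with
  | mem g hg =>
    by_contra h
    exact hw (Finset.mem_biUnion.mpr ⟨g, hg, Set.Finite.mem_toFinset _ |>.mpr h⟩)
  | one => simp
  | mul a b _ _ ha hb => rw [Units.val_mul, map_mul, ha, hb, one_mul]
  | inv a _ ha => rw [Units.val_inv_eq_inv_val, map_inv₀, ha, inv_one]

/-- The maximum of the absolute values of the coordinates. -/
noncomputable def localHeight {n : ℕ} (S : Finset (FinitePlace k)) (v : PlaceIndex S)
    (x : Fin (n + 1) → k) : ℝ :=
  Finset.univ.sup' Finset.univ_nonempty fun i => placeAbs S v (x i)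

theorem placeAbs_le_localHeight {n : ℕ} (S : Finset (FinitePlace k)) (v : PlaceIndex S)
    (x : Fin (n + 1) → k) (i : Fin (n + 1)) : placeAbs S v (x i) ≤ localHeight S v x :=
  Finset.le_sup' (fun i => placeAbs S v (x i)) (Finset.mem_univ i)

theorem exists_localHeight_eq {n : ℕ} (S : Finset (FinitePlace k)) (v : PlaceIndex S)
    (x : Fin (n + 1) → k) : ∃ i, localHeight S v x = placeAbs S v (x i) := by
  obtain ⟨i, -, hi⟩ := Finset.exists_mem_eq_sup' Finset.univ_nonempty
    fun i => placeAbs S v (x i)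
  exact ⟨i, hi⟩

theorem finite_isSUnit_localHeight_le {n : ℕ} (S : Finset (FinitePlace k)) (B : ℝ) :
    {x : Fin (n + 1) → k | (∀ i, IsSUnit S (x i)) ∧ x (Fin.last n) = -1 ∧
      ∏ v, localHeight S v x ≤ B}.Finite := by
  have hfin := NumberField.finite_setOfPred_mulHeight₁_le (K := k) B
  refine (Set.Finite.pi' fun _ : Fin (n + 1) => hfin).subset ?_
  rintro x ⟨hx, hl, hB⟩ i
  rw [Set.mem_ofPred_eq, mulHeight₁_eq_prod_placeAbs (hx i)]
  refine le_trans (Finset.prod_le_prod (fun v _ => by positivity) fun v _ => ?_) hB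
  refine max_le (placeAbs_le_localHeight S v x i) ?_
  have := placeAbs_le_localHeight S v x (Fin.last n)
  rwa [hl, AbsoluteValue.map_neg, map_one] at this

end Places

section Packing

open MeasureTheory Module Metric
open scoped ENNReal

theorem card_le_of_separated_of_norm_le {E : Type*} [NormedAddCommGroup E] [NormedSpace ℝ E]
    [FiniteDimensional ℝ E] {s : Finset E} {R ρ : ℝ} (hρ : 0 < ρ) (hρR : ρ ≤ R)
    (hs : ∀ c ∈ s, ‖c‖ ≤ R) (h : ∀ c ∈ s, ∀ d ∈ s, c ≠ d → ρ ≤ ‖c - d‖) :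
    (s.card : ℝ) ≤ (3 * R / ρ) ^ finrank ℝ E := by
  borelize E
  let μ : Measure E := Measure.addHaar
  have hδ : 0 < ρ / 2 := by linarith
  have hR : 0 < 3 * R / 2 := by linarith
  have D : Set.Pairwise (s : Set E) (Function.onFun Disjoint fun c => ball (c : E) (ρ / 2)) := by
    rintro c hc d hd hcd
    apply ball_disjoint_ball
    rw [dist_eq_norm]
    linarith [h c hc d hd hcd]
  have hsub : (⋃ c ∈ s, ball (c : E) (ρ / 2)) ⊆ ball (0 : E) (3 * R / 2) := by
    refine Set.iUnion₂_subset fun x hx => ball_subset_ball' ?_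
    rw [dist_zero_right]
    linarith [hs x hx]
  have hI : (s.card : ℝ≥0∞) * ENNReal.ofReal ((ρ / 2) ^ finrank ℝ E) * μ (ball 0 1) ≤
      ENNReal.ofReal ((3 * R / 2) ^ finrank ℝ E) * μ (ball 0 1) := by
    have h1 := measure_mono (μ := μ) hsub
    rw [measure_biUnion_finset D fun c _ => measurableSet_ball, μ.addHaar_ball_of_pos _ hR] at h1
    simpa only [μ.addHaar_ball_of_pos _ hδ, Finset.sum_const, nsmul_eq_mul, mul_assoc] using h1
  have hJ := (ENNReal.mul_le_mul_iff_left (measure_ball_pos μ _ zero_lt_one).ne'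
    measure_ball_lt_top.ne).1 hI
  have hK := ENNReal.toReal_le_of_le_ofReal (pow_nonneg hR.le _) hJ
  rw [ENNReal.toReal_mul, ENNReal.toReal_natCast, ENNReal.toReal_ofReal (by positivity)] at hK
  rw [← le_div_iff₀ (by positivity), ← div_pow] at hK
  refine hK.trans (le_of_eq ?_)
  congr 1
  field_simp

/-- A bounded finite set has a member with many close neighbours. -/
theorem exists_card_le_card_filter {V F : Type*} [AddCommGroup V] [Module ℚ V]
    [FiniteDimensional ℚ V] [NormedAddCommGroup F] [NormedSpace ℝ F] (φ : V →+ F) {s : Finset V}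
    (hs : s.Nonempty) {R ρ : ℝ} (hρ : 0 < ρ) (hρR : ρ ≤ R) (hR : ∀ a ∈ s, ‖φ a‖ ≤ R) :
    ∃ a₀ ∈ s, (s.card : ℝ) ≤
      (3 * R / ρ) ^ finrank ℚ V * (s.filter fun a => ‖φ (a - a₀)‖ < ρ).card := by
  classical
  let b := Module.finBasis ℚ V
  let E : Submodule ℝ F := Submodule.span ℝ (Set.range fun i => φ (b i))
  have hE : ∀ v, φ v ∈ E := by
    intro v
    rw [← b.sum_repr v, map_sum]
    refine Submodule.sum_mem _ fun i _ => ?_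
    have := map_ratCast_smul φ ℚ ℝ (b.repr v i) (b i)
    rw [Rat.cast_id] at this
    rw [this]
    exact E.smul_mem _ (Submodule.subset_span ⟨i, rfl⟩)
  have : FiniteDimensional ℝ E := FiniteDimensional.span_of_finite ℝ (Set.finite_range _)
  have hdim : finrank ℝ E ≤ finrank ℚ V := by
    refine (finrank_range_le_card (R := ℝ) fun i => φ (b i)).trans ?_
    rw [Fintype.card_fin]
  let P : Finset V → Prop := fun t => ∀ c ∈ t, ∀ d ∈ t, c ≠ d → ρ ≤ ‖φ (c - d)‖
  obtain ⟨t, ht, hmax⟩ := Finset.exists_max_image (s.powerset.filter P) Finset.card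
    ⟨∅, by simp [P]⟩
  rw [Finset.mem_filter, Finset.mem_powerset] at ht
  obtain ⟨hts, htP⟩ := ht
  have hcov : ∀ a ∈ s, ∃ c ∈ t, ‖φ (a - c)‖ < ρ := by
    intro a ha
    by_contra! hcon
    have hat : a ∉ t := fun h => by
      have := hcon a h
      rw [sub_self, map_zero, norm_zero] at this
      linarith
    have := hmax (insert a t) (Finset.mem_filter.mpr ⟨Finset.mem_powerset.mpr
      (Finset.insert_subset ha hts), fun c hc d hd hcd => by
        rcases Finset.mem_insert.mp hc with rfl | hc'
        · rcases Finset.mem_insert.mp hd with rfl | hd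
          · exact absurd rfl hcd
          · exact hcon d hd
        · rcases Finset.mem_insert.mp hd with rfl | hd
          · rw [← neg_sub, map_neg, norm_neg]
            exact hcon c hc'
          · exact htP c hc' d hd hcd⟩)
    rw [Finset.card_insert_of_notMem hat] at this
    omega
  have htcard : (t.card : ℝ) ≤ (3 * R / ρ) ^ finrank ℚ V := by
    have hinj : Set.InjOn (fun c => (⟨φ c, hE c⟩ : E)) t := by
      intro c hc d hd hcd
      by_contra hne
      have h1 := htP c hc d hd hne
      have h2 : φ c = φ d := congrArg Subtype.val hcd
      rw [map_sub, h2, sub_self, norm_zero] at h1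
      linarith
    have h1 := card_le_of_separated_of_norm_le (s := t.image fun c => (⟨φ c, hE c⟩ : E)) hρ hρR
      (by
        intro c hc
        obtain ⟨a, ha, rfl⟩ := Finset.mem_image.mp hc
        exact hR a (hts ha))
      (by
        intro c hc d hd hcd
        obtain ⟨a, ha, rfl⟩ := Finset.mem_image.mp hc
        obtain ⟨a', ha', rfl⟩ := Finset.mem_image.mp hd
        have := htP a ha a' ha' (fun h => hcd (by rw [h]))
        rw [map_sub] at this
        exact this)
    rw [Finset.card_image_of_injOn hinj] at h1
    refine h1.trans (pow_le_pow_right₀ ?_ hdim)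
    rw [le_div_iff₀ hρ]
    linarith
  obtain ⟨a, ha⟩ := hs
  obtain ⟨c₁, hc₁, -⟩ := hcov a ha
  obtain ⟨a₀, ha₀, hbest⟩ := Finset.exists_max_image t
    (fun c => (s.filter fun a => ‖φ (a - c)‖ < ρ).card) ⟨c₁, hc₁⟩
  refine ⟨a₀, hts ha₀, ?_⟩
  have h1 : s ⊆ t.biUnion fun c => s.filter fun a => ‖φ (a - c)‖ < ρ := by
    intro a ha
    obtain ⟨c, hc, h⟩ := hcov a ha
    exact Finset.mem_biUnion.mpr ⟨c, hc, Finset.mem_filter.mpr ⟨ha, h⟩⟩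
  have h2 := (Finset.card_le_card h1).trans
    (Finset.card_biUnion_le_card_mul t _ _ hbest)
  calc (s.card : ℝ) ≤ (t.card : ℝ) * _ := by exact_mod_cast h2
    _ ≤ _ := mul_le_mul_of_nonneg_right htcard (Nat.cast_nonneg _)

end Packing

section Flag

open Module

variable {K E : Type*} [Field K] [AddCommGroup E] [Module K E]

/-- The span of the first `l` members of a sequence of vectors. -/
def flag (K : Type*) {E : Type*} [Field K] [AddCommGroup E] [Module K E] (z : ℕ → E) (l : ℕ) :
    Submodule K E := Submodule.span K (z '' Set.Iio l)

theorem mem_flag_of_lt (z : ℕ → E) {i l : ℕ} (h : i < l) : z i ∈ flag K z l :=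
  Submodule.subset_span ⟨i, h, rfl⟩

theorem flag_mono (z : ℕ → E) {i l : ℕ} (h : i ≤ l) : flag K z i ≤ flag K z l :=
  Submodule.span_mono (Set.image_mono (Set.Iio_subset_Iio h))

theorem flag_zero (z : ℕ → E) : flag K z 0 = ⊥ := by
  simp [flag]

theorem mem_flag_succ {z : ℕ → E} {l : ℕ} {x : E} :
    x ∈ flag K z (l + 1) ↔ ∃ a : K, x - a • z l ∈ flag K z l := by
  have h : z '' Set.Iio (l + 1) = insert (z l) (z '' Set.Iio l) := by
    rw [← Set.image_insert_eq]
    congr 1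
    ext i
    simp only [Set.mem_Iio, Set.mem_insert_iff]
    omega
  rw [flag, h, Submodule.mem_span_insert]
  constructor
  · rintro ⟨a, e, he, rfl⟩
    exact ⟨a, by simpa [flag] using he⟩
  · rintro ⟨a, h⟩
    exact ⟨a, _, h, by abel⟩

theorem flag_congr {z z' : ℕ → E} {l : ℕ} (h : ∀ i < l, z i = z' i) : flag K z l = flag K z' l := by
  rw [flag, flag, Set.image_congr (s := Set.Iio l) fun i hi => h i hi]

instance (z : ℕ → E) (l : ℕ) : FiniteDimensional K (flag K z l) :=
  FiniteDimensional.span_of_finite K ((Set.finite_Iio l).image z)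

theorem finrank_flag_le (z : ℕ → E) (l : ℕ) : finrank K (flag K z l) ≤ l := by
  classical
  have h := finrank_span_finset_le_card (R := K) ((Finset.range l).image z)
  rw [Finset.coe_image, Finset.coe_range] at h
  exact h.trans (Finset.card_image_le.trans (Finset.card_range l).le)

theorem finrank_flag {z : ℕ → E} {l : ℕ} (h : ∀ i < l, z i ∉ flag K z i) :
    finrank K (flag K z l) = l := by
  refine le_antisymm (finrank_flag_le z l) ?_
  induction l with
  | zero => exact Nat.zero_le _
  | succ l ih =>
    have h1 : flag K z l < flag K z (l + 1) :=
      lt_of_le_of_ne (flag_mono z (Nat.le_succ l)) fun heq =>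
        h l (Nat.lt_succ_self l) (heq ▸ mem_flag_of_lt z (Nat.lt_succ_self l))
    have h2 := Submodule.finrank_lt_finrank_of_lt h1
    have h3 := ih fun i hi => h i (by omega)
    omega

end Flag

section House

open Module NumberField

variable {k : Type*} [Field k] [NumberField k]

/-- All complex conjugates of the coordinates of a vector. -/
noncomputable def embVec {N : ℕ} : (Fin N → k) →+ (Fin N → (k →+* ℂ) → ℂ) where
  toFun z i φ := φ (z i)
  map_zero' := by ext; simp
  map_add' _ _ := by ext; simp

/-- The largest absolute value of a conjugate of a coordinate. -/
noncomputable def vecHouse {N : ℕ} (z : Fin N → k) : ℝ := ‖embVec z‖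

theorem vecHouse_nonneg {N : ℕ} (z : Fin N → k) : 0 ≤ vecHouse z := norm_nonneg _

theorem norm_le_vecHouse {N : ℕ} (z : Fin N → k) (i : Fin N) (φ : k →+* ℂ) :
    ‖φ (z i)‖ ≤ vecHouse z :=
  (norm_le_pi_norm (embVec z i) φ).trans (norm_le_pi_norm (embVec z) i)

theorem vecHouse_le {N : ℕ} {z : Fin N → k} {B : ℝ} (hB : 0 ≤ B)
    (h : ∀ i, ∀ φ : k →+* ℂ, ‖φ (z i)‖ ≤ B) : vecHouse z ≤ B :=
  (pi_norm_le_iff_of_nonneg hB).mpr fun i => (pi_norm_le_iff_of_nonneg hB).mpr fun φ => h i φ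

theorem finite_vecHouse_le (N : ℕ) (B : ℝ) :
    {z : Fin N → k | (∀ i, IsIntegral ℤ (z i)) ∧ vecHouse z ≤ B}.Finite := by
  refine (Set.Finite.pi' fun _ : Fin N => Embeddings.finite_of_norm_le k ℂ B).subset ?_
  rintro z ⟨hz, hB⟩ i
  exact ⟨hz i, fun φ => (norm_le_vecHouse z i φ).trans hB⟩

theorem one_le_prod_norm_of_isIntegral {x : k} (hx : IsIntegral ℤ x) (hx0 : x ≠ 0) :
    1 ≤ ∏ φ : k →+* ℂ, ‖φ x‖ := by
  have h := one_le_prod_placeAbs (mem_sIntegers_of_isIntegral ∅ hx) hx0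
  rw [Fintype.prod_sum_type] at h
  simpa using h

theorem one_le_vecHouse {N : ℕ} {z : Fin N → k} (hz : ∀ i, IsIntegral ℤ (z i)) (h0 : z ≠ 0) :
    1 ≤ vecHouse z := by
  obtain ⟨i, hi⟩ := Function.ne_iff.mp h0
  by_contra! hlt
  have h1 := one_le_prod_norm_of_isIntegral (hz i) hi
  obtain ⟨φ₀⟩ : Nonempty (k →+* ℂ) := inferInstance
  have h2 : ∏ φ : k →+* ℂ, ‖φ (z i)‖ < 1 := by
    have h3 := Finset.prod_lt_prod_of_nonempty (s := Finset.univ) (f := fun φ : k →+* ℂ => ‖φ (z i)‖)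
      (g := fun _ => 1) (fun φ _ => by
        rw [norm_pos_iff, map_ne_zero]
        exact hi) (fun φ _ => (norm_le_vecHouse z i φ).trans_lt hlt) ⟨φ₀, Finset.mem_univ _⟩
    simpa using h3
  linarith

/-- The integral relations between the coordinates of a vector. -/
def IsIntRel {N : ℕ} (x z : Fin N → k) : Prop :=
  (∀ i, IsIntegral ℤ (z i)) ∧ ∑ i, x i * z i = 0

omit [NumberField k] in
theorem IsIntRel.add {N : ℕ} {x z w : Fin N → k} (hz : IsIntRel x z) (hw : IsIntRel x w) :
    IsIntRel x (z + w) :=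
  ⟨fun i => (hz.1 i).add (hw.1 i), by
    simp only [Pi.add_apply, mul_add, Finset.sum_add_distrib, hz.2, hw.2, add_zero]⟩

omit [NumberField k] in
theorem IsIntRel.smul {N : ℕ} {x z : Fin N → k} (hz : IsIntRel x z) {q : k}
    (hq : IsIntegral ℤ q) : IsIntRel x (q • z) :=
  ⟨fun i => hq.mul (hz.1 i), by
    simp only [Pi.smul_apply, smul_eq_mul, mul_left_comm _ q, ← Finset.mul_sum, hz.2, mul_zero]⟩

omit [NumberField k] in
theorem IsIntRel.sub {N : ℕ} {x z w : Fin N → k} (hz : IsIntRel x z) (hw : IsIntRel x w) :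
    IsIntRel x (z - w) :=
  ⟨fun i => (hz.1 i).sub (hw.1 i), by
    simp only [Pi.sub_apply, mul_sub, Finset.sum_sub_distrib, hz.2, hw.2, sub_zero]⟩

/-- The space of relations between the coordinates of a vector. -/
noncomputable def relSpace {N : ℕ} (x : Fin N → k) : Submodule k (Fin N → k) :=
  LinearMap.ker (∑ i, x i • (LinearMap.proj i : (Fin N → k) →ₗ[k] k))

omit [NumberField k] in
theorem mem_relSpace {N : ℕ} {x z : Fin N → k} : z ∈ relSpace x ↔ ∑ i, x i * z i = 0 := by
  simp [relSpace]

theorem finrank_relSpace {n : ℕ} {x : Fin (n + 1) → k} (hx : x ≠ 0) :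
    finrank k (relSpace x) = n := by
  have h := Module.Dual.finrank_ker_add_one_of_ne_zero
    (f := ∑ i, x i • (LinearMap.proj i : (Fin (n + 1) → k) →ₗ[k] k)) (fun h0 => hx ?_)
  · rw [Module.finrank_fin_fun] at h
    exact Nat.succ_injective h
  · funext j
    simpa [Pi.single_apply] using LinearMap.congr_fun h0 (Pi.single j 1)

theorem exists_isIntRel_notMem {N : ℕ} {x : Fin N → k} {W : Submodule k (Fin N → k)}
    (h : ¬ relSpace x ≤ W) : ∃ w, IsIntRel x w ∧ w ∉ W := by
  obtain ⟨w, hw, hwW⟩ := SetLike.not_le_iff_exists.mp h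
  obtain ⟨b, hb⟩ := IsLocalization.exist_integer_multiples_of_finite (nonZeroDivisors (𝓞 k)) w
  have hb0 : ((b : 𝓞 k) : k) ≠ 0 := RingOfIntegers.coe_ne_zero_iff.mpr (nonZeroDivisors.ne_zero b.2)
  refine ⟨((b : 𝓞 k) : k) • w, ⟨fun i => ?_, ?_⟩, fun hcon => hwW ?_⟩
  · obtain ⟨a, ha⟩ := hb i
    have : (((b : 𝓞 k) : k) • w) i = (a : k) := by
      rw [Pi.smul_apply, smul_eq_mul, RingOfIntegers.coe_eq_algebraMap a, ha, Algebra.smul_def]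
    rw [this]
    exact a.isIntegral_coe
  · rw [mem_relSpace] at hw
    simp only [Pi.smul_apply, smul_eq_mul, mul_left_comm _ ((b : 𝓞 k) : k), ← Finset.mul_sum, hw,
      mul_zero]
  · have := W.smul_mem ((b : 𝓞 k) : k)⁻¹ hcon
    rwa [inv_smul_smul₀ hb0] at this

/-- Successively minimal integral relations. -/
structure IsMinimalRel {n : ℕ} (x : Fin (n + 1) → k) (z : ℕ → Fin (n + 1) → k) (m : ℕ) : Prop where
  zero : z 0 = 1
  rel : ∀ l < m, IsIntRel x (z l)
  notMem : ∀ l < m, z l ∉ flag k z l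
  le : ∀ l < m, ∀ w, IsIntRel x w → w ∉ flag k z l → vecHouse (z l) ≤ vecHouse w

theorem exists_isMinimalRel {n : ℕ} {x : Fin (n + 1) → k} (hx : x ≠ 0) (hsum : ∑ i, x i = 0) :
    ∃ z, IsMinimalRel x z n := by
  have key : ∀ m, m ≤ n → ∃ z, IsMinimalRel x z m := by
    intro m
    induction m with
    | zero => exact fun _ => ⟨fun _ => 1, rfl, by simp, by simp, by simp⟩
    | succ m ih =>
      intro hm
      obtain ⟨z, hz⟩ := ih (by omega)
      rcases Nat.eq_zero_or_pos m with rfl | hmpos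
      · refine ⟨fun _ => 1, rfl, fun l hl => ?_, fun l hl => ?_, fun l hl w hw hwm => ?_⟩
        · exact ⟨fun i => isIntegral_one, by simpa using hsum⟩
        · obtain rfl : l = 0 := by omega
          rw [flag_zero, Submodule.mem_bot]
          exact one_ne_zero
        · obtain rfl : l = 0 := by omega
          rw [flag_zero, Submodule.mem_bot] at hwm
          exact (vecHouse_le zero_le_one (by simp)).trans (one_le_vecHouse hw.1 hwm)
      · have hnot : ¬ relSpace x ≤ flag k z m := by
          intro hle
          have h1 := Submodule.finrank_mono hle
          rw [finrank_relSpace hx] at h1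
          have := finrank_flag_le (K := k) z m
          omega
        obtain ⟨w₀, hw₀, hw₀m⟩ := exists_isIntRel_notMem hnot
        have hfin : {w : Fin (n + 1) → k | (IsIntRel x w ∧ w ∉ flag k z m) ∧
            vecHouse w ≤ vecHouse w₀}.Finite :=
          (finite_vecHouse_le (n + 1) (vecHouse w₀)).subset fun w hw => ⟨hw.1.1.1, hw.2⟩
        obtain ⟨w₁, hw₁, hmin⟩ := Set.exists_min_image _ vecHouse hfin
          ⟨w₀, ⟨hw₀, hw₀m⟩, le_rfl⟩
        have hne : ∀ i < m, Function.update z m w₁ i = z i := fun i hi =>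
          Function.update_of_ne (by omega) _ _
        have hflag : ∀ l ≤ m, flag k (Function.update z m w₁) l = flag k z l := fun l hl =>
          flag_congr fun i hi => hne i (by omega)
        refine ⟨Function.update z m w₁, ?_, fun l hl => ?_, fun l hl => ?_, fun l hl w hw hwm => ?_⟩
        · rw [hne 0 hmpos, hz.zero]
        · rcases Nat.lt_succ_iff_lt_or_eq.mp hl with h | rfl
          · rw [hne l h]
            exact hz.rel l h
          · rw [Function.update_self]
            exact hw₁.1.1
        · rw [hflag l (by omega)]
          rcases Nat.lt_succ_iff_lt_or_eq.mp hl with h | rfl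
          · rw [hne l h]
            exact hz.notMem l h
          · rw [Function.update_self]
            exact hw₁.1.2
        · rw [hflag l (by omega)] at hwm
          rcases Nat.lt_succ_iff_lt_or_eq.mp hl with h | rfl
          · rw [hne l h]
            exact hz.le l h w hw hwm
          · rw [Function.update_self]
            rcases le_total (vecHouse w) (vecHouse w₀) with h | h
            · exact hmin w ⟨⟨hw, hwm⟩, h⟩
            · exact hw₁.2.trans h
  exact key n le_rfl

theorem IsMinimalRel.monotone {n m : ℕ} {x : Fin (n + 1) → k} {z : ℕ → Fin (n + 1) → k}
    (hz : IsMinimalRel x z m) {i l : ℕ} (hil : i ≤ l) (hl : l < m) :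
    vecHouse (z i) ≤ vecHouse (z l) :=
  hz.le i (by omega) _ (hz.rel l hl) fun h => hz.notMem l hl (flag_mono z hil h)

theorem IsMinimalRel.one_le {n m : ℕ} {x : Fin (n + 1) → k} {z : ℕ → Fin (n + 1) → k}
    (hz : IsMinimalRel x z m) {l : ℕ} (hl : l < m) : 1 ≤ vecHouse (z l) := by
  refine one_le_vecHouse (hz.rel l hl).1 fun h => hz.notMem l hl ?_
  rw [h]
  exact Submodule.zero_mem _

theorem IsMinimalRel.mem_flag {n : ℕ} {x : Fin (n + 1) → k} {z : ℕ → Fin (n + 1) → k} (hx : x ≠ 0)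
    (hz : IsMinimalRel x z n) {w : Fin (n + 1) → k} (hw : ∑ i, x i * w i = 0) :
    w ∈ flag k z n := by
  have h1 : flag k z n ≤ relSpace x := by
    refine Submodule.span_le.mpr ?_
    rintro _ ⟨i, hi, rfl⟩
    exact mem_relSpace.mpr (hz.rel i hi).2
  have h2 : flag k z n = relSpace x := by
    refine Submodule.eq_of_le_of_finrank_eq h1 ?_
    rw [finrank_relSpace hx, finrank_flag hz.notMem]
  rw [h2]
  exact mem_relSpace.mpr hw

end House

section Counting

open Module NumberField

variable {k : Type*} [Field k] [NumberField k]

theorem finite_relBall {N : ℕ} (x : Fin N → k) (z : ℕ → Fin N → k) (l : ℕ) (R : ℝ) :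
    {w : Fin N → k | IsIntRel x w ∧ w ∈ flag k z l ∧ vecHouse w ≤ R}.Finite :=
  (finite_vecHouse_le N R).subset fun _ hw => ⟨hw.1.1, hw.2.2⟩

/-- The integral relations of bounded size in a member of a flag. -/
noncomputable def relBall {N : ℕ} (x : Fin N → k) (z : ℕ → Fin N → k) (l : ℕ) (R : ℝ) :
    Finset (Fin N → k) := (finite_relBall x z l R).toFinset

theorem mem_relBall {N : ℕ} {x : Fin N → k} {z : ℕ → Fin N → k} {l : ℕ} {R : ℝ} {w : Fin N → k} :
    w ∈ relBall x z l R ↔ IsIntRel x w ∧ w ∈ flag k z l ∧ vecHouse w ≤ R := by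
  rw [relBall, Set.Finite.mem_toFinset, Set.mem_ofPred_eq]

omit [NumberField k] in
theorem isIntRel_zero {N : ℕ} (x : Fin N → k) : IsIntRel x 0 :=
  ⟨fun _ => isIntegral_zero, by simp⟩

theorem vecHouse_zero {N : ℕ} : vecHouse (0 : Fin N → k) = 0 := by
  rw [vecHouse, map_zero, norm_zero]

theorem mul_prod_le_of_step {N N' P Q μ R : ℝ} {l d : ℕ} (hμ : 0 < μ) (hμR : μ ≤ R) (hP : 0 ≤ P)
    (h : N ≤ (3 * R / μ) ^ ((l + 1) * d) * N') (h' : N' * P ≤ Q * μ ^ (l * d)) :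
    N * (P * μ ^ d) ≤ (Q * 3 ^ ((l + 1) * d)) * R ^ ((l + 1) * d) := by
  have hR : 0 < R := hμ.trans_le hμR
  calc N * (P * μ ^ d) ≤ ((3 * R / μ) ^ ((l + 1) * d) * N') * (P * μ ^ d) :=
        mul_le_mul_of_nonneg_right h (by positivity)
    _ = (3 * R / μ) ^ ((l + 1) * d) * μ ^ d * (N' * P) := by ring
    _ ≤ (3 * R / μ) ^ ((l + 1) * d) * μ ^ d * (Q * μ ^ (l * d)) :=
        mul_le_mul_of_nonneg_left h' (by positivity)
    _ = Q * ((3 * R / μ) ^ ((l + 1) * d) * μ ^ ((l + 1) * d)) := by ring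
    _ = _ := by
      rw [← mul_pow, div_mul_cancel₀ _ hμ.ne', mul_pow]
      ring

theorem card_relBall_mul_prod_le {n m : ℕ} {x : Fin (n + 1) → k} {z : ℕ → Fin (n + 1) → k}
    (hz : IsMinimalRel x z m) (l : ℕ) (hl : l ≤ m) {R : ℝ} (hR : ∀ i < l, vecHouse (z i) ≤ R) :
    ((relBall x z l R).card : ℝ) * ∏ i ∈ Finset.range l, vecHouse (z i) ^ finrank ℚ k ≤
      (∏ i ∈ Finset.range l, (3 : ℝ) ^ ((i + 1) * finrank ℚ k)) * R ^ (l * finrank ℚ k) := by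
  classical
  set d := finrank ℚ k with hd
  induction l generalizing R with
  | zero =>
    have h1 : relBall x z 0 R ⊆ {0} := by
      intro w hw
      rw [mem_relBall, flag_zero, Submodule.mem_bot] at hw
      exact Finset.mem_singleton.mpr hw.2.1
    have h2 := Finset.card_le_card h1
    rw [Finset.card_singleton] at h2
    simpa using (by exact_mod_cast h2 : ((relBall x z 0 R).card : ℝ) ≤ 1)
  | succ l ih =>
    set μ := vecHouse (z l) with hμ
    have hμ1 : 1 ≤ μ := hz.one_le (by omega)
    have hμR : μ ≤ R := hR l (Nat.lt_succ_self l)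
    have ih' := ih (by omega) (R := μ) fun i hi => hz.monotone hi.le (by omega)
    let V := flag k z (l + 1)
    let s : Finset V := (relBall x z (l + 1) R).subtype (· ∈ V)
    have hscard : s.card = (relBall x z (l + 1) R).card := by
      rw [Finset.card_subtype, Finset.filter_true_of_mem]
      exact fun w hw => (mem_relBall.mp hw).2.1
    have hsmem : ∀ a : V, a ∈ s ↔ IsIntRel x a.1 ∧ vecHouse a.1 ≤ R := by
      intro a
      rw [Finset.mem_subtype, mem_relBall]
      exact ⟨fun h => ⟨h.1, h.2.2⟩, fun h => ⟨h.1, a.2, h.2⟩⟩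
    have hfin : FiniteDimensional ℚ V := Module.Finite.trans k V
    obtain ⟨a₀, ha₀, hcard⟩ := exists_card_le_card_filter
      (embVec.comp V.subtype.toAddMonoidHom) (s := s)
      ⟨0, (hsmem 0).mpr ⟨isIntRel_zero x, by
        rw [Submodule.coe_zero, vecHouse_zero]; linarith⟩⟩ (R := R) (ρ := μ)
      (by linarith) hμR fun a ha => ((hsmem a).mp ha).2
    have hdim : finrank ℚ V ≤ (l + 1) * d := by
      rw [← Module.finrank_mul_finrank ℚ k V, mul_comm]
      exact Nat.mul_le_mul_right _ (finrank_flag_le z (l + 1))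
    obtain ⟨t, ht⟩ : ∃ t, t = s.filter fun a =>
      ‖(embVec.comp V.subtype.toAddMonoidHom) (a - a₀)‖ < μ := ⟨_, rfl⟩
    rw [← ht] at hcard
    have htcard : t.card ≤ (relBall x z l μ).card := by
      refine Finset.card_le_card_of_injOn (fun a => a.1 - a₀.1) ?_ ?_
      · intro a ha
        rw [ht, Finset.mem_coe, Finset.mem_filter] at ha
        have h1 : IsIntRel x (a.1 - a₀.1) := ((hsmem a).mp ha.1).1.sub ((hsmem a₀).mp ha₀).1
        have h2 : vecHouse (a.1 - a₀.1) < μ := ha.2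
        refine mem_relBall.mpr ⟨h1, ?_, h2.le⟩
        by_contra hcon
        exact absurd (hz.le l (by omega) _ h1 hcon) (not_le.mpr h2)
      · intro a _ b _ hab
        have h1 : a.1 - a₀.1 = b.1 - a₀.1 := hab
        exact Subtype.ext (sub_left_inj.mp h1)
    have hratio : 1 ≤ 3 * R / μ := by
      rw [le_div_iff₀ (by linarith)]
      linarith
    have h1 : ((relBall x z (l + 1) R).card : ℝ) ≤
        (3 * R / μ) ^ ((l + 1) * d) * (relBall x z l μ).card := by
      rw [← hscard]
      have h2 : (t.card : ℝ) ≤ (relBall x z l μ).card := Nat.cast_le.mpr htcard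
      have h3 : (0 : ℝ) ≤ (3 * R / μ) ^ ((l + 1) * d) := pow_nonneg (by linarith) _
      exact hcard.trans (mul_le_mul (pow_le_pow_right₀ hratio hdim) h2 (Nat.cast_nonneg _) h3)
    rw [Finset.prod_range_succ, Finset.prod_range_succ]
    exact mul_prod_le_of_step (by linarith) hμR
      (Finset.prod_nonneg fun i _ => pow_nonneg (vecHouse_nonneg _) _) h1 ih'

theorem exists_integral_box (k : Type*) [Field k] [NumberField k] : ∃ D : ℝ, 0 < D ∧
    ∀ (N : ℕ) (A : ℝ), 0 ≤ A → ∃ s : Finset (Fin N → k),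
      (∀ z ∈ s, (∀ i, IsIntegral ℤ (z i)) ∧ vecHouse z ≤ A) ∧
      (A / D) ^ (N * finrank ℚ k) ≤ s.card := by
  classical
  let ω := integralBasis k
  let D : ℝ := 1 + ∑ j, ∑ φ : k →+* ℂ, ‖φ (ω j)‖
  have hD : 0 < D := by positivity
  refine ⟨D, hD, fun N A hA => ?_⟩
  set m := ⌊A / D⌋₊ with hm
  let f : (Fin N → Free.ChooseBasisIndex ℤ (𝓞 k) → Fin (m + 1)) → Fin N → k :=
    fun a i => ∑ j, ((a i j : ℕ) : ℚ) • ω j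
  have hf : Function.Injective f := by
    intro a b hab
    funext i j
    have h1 := congrArg (fun y => ω.repr y j) (congrFun hab i)
    simp only [f, ω.repr_sum_self] at h1
    exact Fin.ext (by exact_mod_cast h1)
  refine ⟨Finset.univ.image f, fun z hz => ?_, ?_⟩
  · obtain ⟨a, -, rfl⟩ := Finset.mem_image.mp hz
    refine ⟨fun i => IsIntegral.sum _ fun j _ => ?_, vecHouse_le hA fun i φ => ?_⟩
    · rw [Nat.cast_smul_eq_nsmul]
      refine IsIntegral.nsmul ?_ _
      rw [integralBasis_apply]
      exact RingOfIntegers.isIntegral_coe _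
    · have h1 : ∀ j, ‖φ (((a i j : ℕ) : ℚ) • ω j)‖ ≤ m * ‖φ (ω j)‖ := by
        intro j
        rw [Nat.cast_smul_eq_nsmul, map_nsmul, nsmul_eq_mul, norm_mul, Complex.norm_natCast]
        refine mul_le_mul_of_nonneg_right ?_ (norm_nonneg _)
        exact_mod_cast Nat.lt_succ_iff.mp (a i j).2
      have h2 : ∑ j, ‖φ (ω j)‖ ≤ D := by
        have : ∑ j, ‖φ (ω j)‖ ≤ ∑ j, ∑ ψ : k →+* ℂ, ‖ψ (ω j)‖ :=
          Finset.sum_le_sum fun j _ => Finset.single_le_sum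
            (f := fun ψ : k →+* ℂ => ‖ψ (ω j)‖) (fun _ _ => norm_nonneg _) (Finset.mem_univ φ)
        simp only [D]
        linarith
      simp only [f, map_sum]
      calc ‖∑ j, φ (((a i j : ℕ) : ℚ) • ω j)‖ ≤ ∑ j, (m : ℝ) * ‖φ (ω j)‖ :=
            (norm_sum_le _ _).trans (Finset.sum_le_sum fun j _ => h1 j)
        _ = m * ∑ j, ‖φ (ω j)‖ := by rw [Finset.mul_sum]
        _ ≤ A / D * D := mul_le_mul (Nat.floor_le (by positivity)) h2
            (Finset.sum_nonneg fun _ _ => norm_nonneg _) (by positivity)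
        _ = A := div_mul_cancel₀ _ hD.ne'
  · rw [Finset.card_image_of_injective _ hf, Finset.card_univ, Fintype.card_fun, Fintype.card_fun,
      Fintype.card_fin, Fintype.card_fin, ← Module.finrank_eq_card_basis ω, ← pow_mul,
      mul_comm (finrank ℚ k) N]
    push_cast
    exact pow_le_pow_left₀ (by positivity) (Nat.lt_floor_add_one _).le _

end Counting

section SUnitSolutions

open Module NumberField

variable {k : Type*} [Field k] [NumberField k]

/-- The solutions in `S`-units of a homogeneous equation with last coordinate `-1`. -/
structure IsSUnitSol (S : Finset (FinitePlace k)) {n : ℕ} (x : Fin (n + 1) → k) : Prop where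
  unit : ∀ i, IsSUnit S (x i)
  last : x (Fin.last n) = -1
  sum : ∑ i, x i = 0

/-- The height of a vector. -/
noncomputable def totalHeight {n : ℕ} (S : Finset (FinitePlace k)) (x : Fin (n + 1) → k) : ℝ :=
  ∏ v, localHeight S v x

variable {S : Finset (FinitePlace k)} {n : ℕ} {x : Fin (n + 1) → k}

theorem IsSUnitSol.ne_zero (hx : IsSUnitSol S x) : x ≠ 0 := fun h =>
  (hx.unit 0).1 (congrFun h 0)

theorem IsSUnitSol.one_le_localHeight (hx : IsSUnitSol S x) (v : PlaceIndex S) :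
    1 ≤ localHeight S v x := by
  have := placeAbs_le_localHeight S v x (Fin.last n)
  rwa [hx.last, AbsoluteValue.map_neg, map_one] at this

theorem IsSUnitSol.one_le_totalHeight (hx : IsSUnitSol S x) : 1 ≤ totalHeight S x :=
  Finset.prod_induction _ (fun y : ℝ => 1 ≤ y) (fun _ _ => one_le_mul_of_one_le_of_one_le) le_rfl
    fun v _ => hx.one_le_localHeight v

theorem IsSUnitSol.sum_mem_sIntegers (hx : IsSUnitSol S x) {z : Fin (n + 1) → k}
    (hz : ∀ i, IsIntegral ℤ (z i)) : ∑ i, x i * z i ∈ sIntegers S :=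
  (sIntegers S).sum_mem fun i _ => (sIntegers S).mul_mem (hx.unit i).mem_sIntegers
    (mem_sIntegers_of_isIntegral S (hz i))

theorem IsSUnitSol.placeAbs_inr_sum_le (hx : IsSUnitSol S x) {z : Fin (n + 1) → k}
    (hz : ∀ i, IsIntegral ℤ (z i)) (w : S) :
    placeAbs S (Sum.inr w) (∑ i, x i * z i) ≤ localHeight S (Sum.inr w) x := by
  refine Finset.sum_induction _ (fun y => placeAbs S (Sum.inr w) y ≤ localHeight S (Sum.inr w) x)
    (fun a b ha hb => (w.1.add_le a b).trans (max_le ha hb)) ?_ fun i _ => ?_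
  · rw [map_zero]
    exact zero_le_one.trans (hx.one_le_localHeight _)
  · rw [map_mul]
    refine le_trans ?_ (placeAbs_le_localHeight S (Sum.inr w) x i)
    exact mul_le_of_le_one_right (apply_nonneg _ _) (FinitePlace.le_one_of_isIntegral w.1 (hz i))

theorem IsSUnitSol.one_le_pow_mul_totalHeight (hx : IsSUnitSol S x) {z : Fin (n + 1) → k}
    (hz : ∀ i, IsIntegral ℤ (z i)) (h0 : ∑ i, x i * z i ≠ 0) {σ : ℝ}
    (hσ : ∀ φ : k →+* ℂ, ‖φ (∑ i, x i * z i)‖ ≤ σ * localHeight S (Sum.inl φ) x) :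
    1 ≤ σ ^ finrank ℚ k * totalHeight S x := by
  refine (one_le_prod_placeAbs (hx.sum_mem_sIntegers hz) h0).trans ?_
  rw [totalHeight, Fintype.prod_sum_type, Fintype.prod_sum_type, ← mul_assoc,
    ← Embeddings.card k ℂ, ← Finset.card_univ, ← Finset.prod_const, ← Finset.prod_mul_distrib]
  refine mul_le_mul (Finset.prod_le_prod (fun φ _ => apply_nonneg _ _) fun φ _ => hσ φ)
    (Finset.prod_le_prod (fun w _ => apply_nonneg _ _) fun w _ => hx.placeAbs_inr_sum_le hz w)
    (Finset.prod_nonneg fun w _ => apply_nonneg _ _) (Finset.prod_nonneg fun φ _ => ?_)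
  exact (norm_nonneg _).trans (hσ φ)

/-- The conjugates of an element, scaled by given factors. -/
noncomputable def scaledEmb (X : (k →+* ℂ) → ℝ) : k →+ ((k →+* ℂ) → ℂ) where
  toFun y φ := φ y / X φ
  map_zero' := by ext; simp
  map_add' _ _ := by ext; simp [add_div]

theorem IsSUnitSol.card_values_le (hx : IsSUnitSol S x) {A : ℝ} (hA : 1 ≤ A) {t : Finset k}
    (ht : ∀ y ∈ t, ∃ z : Fin (n + 1) → k, (∀ i, IsIntegral ℤ (z i)) ∧ vecHouse z ≤ A ∧
      y = ∑ i, x i * z i) :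
    (t.card : ℝ) ≤ (3 * ((n + 1) * A)) ^ finrank ℚ k * totalHeight S x := by
  classical
  set d := finrank ℚ k with hd
  have hd0 : d ≠ 0 := finrank_pos.ne'
  set H := totalHeight S x with hH
  have hH1 : 1 ≤ H := hx.one_le_totalHeight
  rcases t.eq_empty_or_nonempty with rfl | hne
  · rw [Finset.card_empty, Nat.cast_zero]
    positivity
  set ρ : ℝ := (H⁻¹) ^ ((d : ℝ)⁻¹) with hρ
  have hρpos : 0 < ρ := Real.rpow_pos_of_pos (by positivity) _
  have hρd : ρ ^ d = H⁻¹ := Real.rpow_inv_natCast_pow (by positivity) hd0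
  have hρ1 : ρ ≤ 1 := Real.rpow_le_one (by positivity) (inv_le_one_of_one_le₀ hH1) (by positivity)
  have hXpos : ∀ φ : k →+* ℂ, 0 < localHeight S (Sum.inl φ) x := fun φ =>
    zero_lt_one.trans_le (hx.one_le_localHeight _)
  obtain ⟨a₀, ha₀, hcard⟩ := exists_card_le_card_filter
    (scaledEmb fun φ : k →+* ℂ => localHeight S (Sum.inl φ) x) hne (R := (n + 1) * A) (ρ := ρ)
    hρpos (by nlinarith [(Nat.cast_nonneg n : (0 : ℝ) ≤ n)]) (by
      intro y hy
      obtain ⟨z, hz, hzA, rfl⟩ := ht y hy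
      refine (pi_norm_le_iff_of_nonneg (by positivity)).mpr fun φ => ?_
      change ‖φ (∑ i, x i * z i) / ((localHeight S (Sum.inl φ) x : ℝ) : ℂ)‖ ≤ _
      rw [norm_div, Complex.norm_real, Real.norm_of_nonneg (hXpos φ).le, div_le_iff₀ (hXpos φ),
        map_sum]
      refine (norm_sum_le _ _).trans ((Finset.sum_le_card_nsmul _ _
        (A * localHeight S (Sum.inl φ) x) fun i _ => ?_).trans_eq ?_)
      · rw [map_mul, norm_mul, mul_comm]
        exact mul_le_mul ((norm_le_vecHouse z i φ).trans hzA)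
          (placeAbs_le_localHeight S (Sum.inl φ) x i) (norm_nonneg _) (by linarith)
      · rw [Finset.card_univ, Fintype.card_fin, nsmul_eq_mul]
        push_cast
        ring)
  have hfilter : (t.filter fun a => ‖(scaledEmb fun φ : k →+* ℂ =>
      localHeight S (Sum.inl φ) x) (a - a₀)‖ < ρ) ⊆ {a₀} := by
    intro a ha
    obtain ⟨hat, hlt⟩ := Finset.mem_filter.mp ha
    rw [Finset.mem_singleton]
    by_contra hne'
    obtain ⟨z, hz, -, hza⟩ := ht a hat
    obtain ⟨z₀, hz₀, -, hza₀⟩ := ht a₀ ha₀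
    set σ := ‖(scaledEmb fun φ : k →+* ℂ => localHeight S (Sum.inl φ) x) (a - a₀)‖ with hσ
    have hdiff : a - a₀ = ∑ i, x i * (z - z₀) i := by
      rw [hza, hza₀, ← Finset.sum_sub_distrib]
      exact Finset.sum_congr rfl fun i _ => by rw [Pi.sub_apply, mul_sub]
    have h1 := hx.one_le_pow_mul_totalHeight (z := z - z₀) (fun i => (hz i).sub (hz₀ i))
      (by rw [← hdiff]; exact sub_ne_zero.mpr hne') (σ := σ) (by
        intro φ
        rw [← hdiff]
        have h2 := norm_le_pi_norm ((scaledEmb fun φ : k →+* ℂ =>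
          localHeight S (Sum.inl φ) x) (a - a₀)) φ
        change ‖φ (a - a₀) / ((localHeight S (Sum.inl φ) x : ℝ) : ℂ)‖ ≤ _ at h2
        rwa [norm_div, Complex.norm_real, Real.norm_of_nonneg (hXpos φ).le,
          div_le_iff₀ (hXpos φ)] at h2)
    have h3 : σ ^ d < ρ ^ d := pow_lt_pow_left₀ hlt (norm_nonneg _) hd0
    rw [hρd] at h3
    have h4 : σ ^ d * H < H⁻¹ * H := mul_lt_mul_of_pos_right h3 (by linarith)
    rw [inv_mul_cancel₀ (by linarith)] at h4
    linarith
  have hf1 := Finset.card_le_card hfilter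
  rw [Finset.card_singleton] at hf1
  have hf1' : ((t.filter fun a => ‖(scaledEmb fun φ : k →+* ℂ =>
      localHeight S (Sum.inl φ) x) (a - a₀)‖ < ρ).card : ℝ) ≤ 1 := by exact_mod_cast hf1
  refine hcard.trans ((mul_le_of_le_one_right (by positivity) hf1').trans_eq ?_)
  rw [div_pow, hρd, div_inv_eq_mul]

theorem IsSUnitSol.pow_le_card_relBall (hx : IsSUnitSol S x) {z : ℕ → Fin (n + 1) → k}
    (hz : IsMinimalRel x z n) {D : ℝ} {A : ℝ} (hA : 1 ≤ A) {s : Finset (Fin (n + 1) → k)}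
    (hs : ∀ w ∈ s, (∀ i, IsIntegral ℤ (w i)) ∧ vecHouse w ≤ A)
    (hcard : (A / D) ^ ((n + 1) * finrank ℚ k) ≤ s.card) (hD : 0 < D) :
    A ^ (n * finrank ℚ k) ≤ D ^ ((n + 1) * finrank ℚ k) * (3 * (n + 1)) ^ finrank ℚ k *
      totalHeight S x * (relBall x z n (2 * A)).card := by
  classical
  set d := finrank ℚ k with hd
  have h1 : s.card ≤ (relBall x z n (2 * A)).card *
      (s.image fun w => ∑ i, x i * w i).card := by
    refine Finset.card_le_mul_card_image s _ fun b hb => ?_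
    obtain ⟨w₀, hw₀, rfl⟩ := Finset.mem_image.mp hb
    refine Finset.card_le_card_of_injOn (fun w => w - w₀) ?_ fun a _ b _ hab =>
      sub_left_inj.mp hab
    intro w hw
    obtain ⟨hws, hwe⟩ := Finset.mem_filter.mp (Finset.mem_coe.mp hw)
    have hrel : ∑ i, x i * (w - w₀) i = 0 := by
      simp only [Pi.sub_apply, mul_sub, Finset.sum_sub_distrib, hwe, sub_self]
    refine mem_relBall.mpr ⟨⟨fun i => ((hs w hws).1 i).sub ((hs w₀ hw₀).1 i), hrel⟩,
      hz.mem_flag hx.ne_zero hrel, ?_⟩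
    rw [vecHouse, map_sub]
    refine (norm_sub_le _ _).trans ?_
    have h2 := (hs w hws).2
    have h3 := (hs w₀ hw₀).2
    rw [vecHouse] at h2 h3
    linarith
  have h2 := hx.card_values_le hA (t := s.image fun w => ∑ i, x i * w i) (by
    intro y hy
    obtain ⟨w, hw, rfl⟩ := Finset.mem_image.mp hy
    exact ⟨w, (hs w hw).1, (hs w hw).2, rfl⟩)
  have h1' : (s.card : ℝ) ≤ (relBall x z n (2 * A)).card *
      (s.image fun w => ∑ i, x i * w i).card := by exact_mod_cast h1
  have hApos : 0 < A ^ d := by positivity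
  refine le_of_mul_le_mul_right ?_ hApos
  have h3 := hcard.trans (h1'.trans (mul_le_mul_of_nonneg_left h2 (Nat.cast_nonneg _)))
  rw [div_pow, div_le_iff₀ (by positivity)] at h3
  calc A ^ (n * d) * A ^ d = A ^ ((n + 1) * d) := by ring
    _ ≤ _ := h3
    _ = _ := by rw [mul_pow, mul_pow, mul_pow]; ring

/-- The product of the successive minima is at most the height, up to a constant. -/
theorem exists_prod_vecHouse_le (k : Type*) [Field k] [NumberField k] (n : ℕ) : ∃ C : ℝ, 1 ≤ C ∧
    ∀ (S : Finset (FinitePlace k)) (x : Fin (n + 1) → k) (z : ℕ → Fin (n + 1) → k),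
      IsSUnitSol S x → IsMinimalRel x z n →
        ∏ i ∈ Finset.range n, vecHouse (z i) ^ finrank ℚ k ≤ C * totalHeight S x := by
  obtain ⟨D, hD, hbox⟩ := exists_integral_box k
  set d := finrank ℚ k with hd
  set C₁ : ℝ := D ^ ((n + 1) * d) * (3 * (n + 1)) ^ d with hC₁
  set C₂ : ℝ := (∏ i ∈ Finset.range n, (3 : ℝ) ^ ((i + 1) * d)) * 2 ^ (n * d) with hC₂
  have hC₁0 : 0 < C₁ := by positivity
  have hC₂0 : 0 < C₂ := by positivity
  refine ⟨max 1 (C₁ * C₂), le_max_left _ _, fun S x z hx hz => ?_⟩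
  have hH1 : 1 ≤ totalHeight S x := hx.one_le_totalHeight
  rcases Nat.eq_zero_or_pos n with rfl | hn
  · rw [Finset.range_zero, Finset.prod_empty]
    nlinarith [le_max_left 1 (C₁ * C₂)]
  set A := vecHouse (z (n - 1)) with hA
  have hA1 : 1 ≤ A := hz.one_le (by omega)
  obtain ⟨s, hs, hscard⟩ := hbox (n + 1) A (by linarith)
  have h1 := hx.pow_le_card_relBall hz hA1 hs hscard hD
  have h2 := card_relBall_mul_prod_le hz n le_rfl (R := 2 * A) fun i hi =>
    (hz.monotone (show i ≤ n - 1 by omega) (by omega)).trans (by linarith)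
  rw [← hd] at h1 h2
  set N : ℝ := ((relBall x z n (2 * A)).card : ℝ) with hN
  set P : ℝ := ∏ i ∈ Finset.range n, vecHouse (z i) ^ d with hP
  have hP0 : 0 ≤ P := Finset.prod_nonneg fun i _ => pow_nonneg (vecHouse_nonneg _) _
  have hAp : 0 < A ^ (n * d) := by positivity
  have h3 : P * A ^ (n * d) ≤ (C₁ * C₂ * totalHeight S x) * A ^ (n * d) := by
    calc P * A ^ (n * d) ≤ P * (C₁ * totalHeight S x * N) := mul_le_mul_of_nonneg_left h1 hP0
      _ = C₁ * totalHeight S x * (N * P) := by ring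
      _ ≤ C₁ * totalHeight S x * ((∏ i ∈ Finset.range n, (3 : ℝ) ^ ((i + 1) * d)) *
          (2 * A) ^ (n * d)) := mul_le_mul_of_nonneg_left h2 (by positivity)
      _ = _ := by rw [mul_pow, hC₂]; ring
  refine (le_of_mul_le_mul_right h3 hAp).trans ?_
  exact mul_le_mul_of_nonneg_right (le_max_right _ _) (by linarith)

omit [NumberField k] in
theorem det_ne_zero_of_forall_mem_flag {z : ℕ → Fin (n + 1) → k} (hx : x (Fin.last n) = -1)
    (h : ∀ w, ∑ i, x i * w i = 0 → w ∈ flag k z n) :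
    (Matrix.of fun (l : Fin n) (i : Fin n) => z l i.castSucc).det ≠ 0 := by
  classical
  intro h0
  obtain ⟨c, hc0, hc⟩ := Matrix.exists_mulVec_eq_zero_iff.mpr h0
  refine hc0 (funext fun i => ?_)
  let L : (Fin (n + 1) → k) →ₗ[k] k := ∑ j : Fin n, c j • LinearMap.proj j.castSucc
  have hL : ∀ w, L w = ∑ j : Fin n, c j * w j.castSucc := by
    intro w
    simp [L, LinearMap.sum_apply]
  have h1 : flag k z n ≤ LinearMap.ker L := by
    refine Submodule.span_le.mpr ?_
    rintro _ ⟨l, hl, rfl⟩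
    rw [SetLike.mem_coe, LinearMap.mem_ker, hL]
    have h2 := congrFun hc ⟨l, hl⟩
    rw [Matrix.mulVec, dotProduct] at h2
    rw [← h2.trans (Pi.zero_apply _)]
    exact Finset.sum_congr rfl fun j _ => mul_comm _ _
  let w : Fin (n + 1) → k := Fin.snoc (Pi.single i 1) (x i.castSucc)
  have hw : ∑ j, x j * w j = 0 := by
    rw [Fin.sum_univ_castSucc, hx]
    simp [w, Pi.single_apply]
  have h3 := h1 (h w hw)
  rw [LinearMap.mem_ker, hL] at h3
  simpa [w, Pi.single_apply] using h3

/-- A system of relations determines the solution, so one of them must be large. -/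
theorem IsSUnitSol.totalHeight_le (hx : IsSUnitSol S x) {z : ℕ → Fin (n + 1) → k}
    (hz : IsMinimalRel x z n) {μ : ℝ} (hμ : 1 ≤ μ) (hzμ : ∀ i < n, vecHouse (z i) ≤ μ) :
    totalHeight S x ≤ (n.factorial * μ ^ n) ^ finrank ℚ k := by
  classical
  set Z : Matrix (Fin n) (Fin n) k := Matrix.of fun l i => z l i.castSucc with hZ
  set b : Fin n → k := fun l => z l (Fin.last n) with hb
  have hmul : Z.mulVec (fun i => x i.castSucc) = b := by
    funext l
    have h1 := (hz.rel l l.2).2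
    rw [Fin.sum_univ_castSucc, hx.last] at h1
    rw [Matrix.mulVec, dotProduct, hb]
    simp only [hZ, Matrix.of_apply]
    rw [Finset.sum_congr rfl fun i _ => mul_comm (z (l : ℕ) (Fin.castSucc i)) (x (Fin.castSucc i))]
    linear_combination h1
  have hdet : Z.det ≠ 0 :=
    det_ne_zero_of_forall_mem_flag hx.last fun w hw => hz.mem_flag hx.ne_zero hw
  have hcr : ∀ i : Fin n, Z.det * x i.castSucc = (Z.updateCol i b).det := by
    intro i
    have h1 : Z.det • (fun i : Fin n => x i.castSucc) = Z.cramer b := by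
      rw [Matrix.cramer_eq_adjugate_mulVec, ← hmul, Matrix.mulVec_mulVec, Matrix.adjugate_mul,
        Matrix.smul_mulVec, Matrix.one_mulVec]
    have h2 := congrFun h1 i
    rwa [Pi.smul_apply, smul_eq_mul, Matrix.cramer_apply] at h2
  have hint : ∀ i, IsIntegral ℤ (Z.det * x i) ∧
      ∀ φ : k →+* ℂ, ‖φ (Z.det * x i)‖ ≤ n.factorial * μ ^ n := by
    have hgen : ∀ W : Matrix (Fin n) (Fin n) k,
        (∀ l i, IsIntegral ℤ (W l i) ∧ ∀ φ : k →+* ℂ, ‖φ (W l i)‖ ≤ μ) →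
        IsIntegral ℤ W.det ∧ ∀ φ : k →+* ℂ, ‖φ W.det‖ ≤ n.factorial * μ ^ n := by
      intro W hW
      refine ⟨IsIntegral.det fun l i => (hW l i).1, fun φ => ?_⟩
      have h1 := Matrix.det_le (A := W) (abv := placeAbs ∅ (Sum.inl φ)) (x := μ)
        fun l i => (hW l i).2 φ
      rwa [Fintype.card_fin, nsmul_eq_mul] at h1
    have hzent : ∀ (l : Fin n) i, IsIntegral ℤ (z l i) ∧ ∀ φ : k →+* ℂ, ‖φ (z l i)‖ ≤ μ :=
      fun l i => ⟨(hz.rel l l.2).1 i, fun φ => (norm_le_vecHouse _ i φ).trans (hzμ l l.2)⟩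
    intro i
    refine Fin.lastCases ?_ (fun i => ?_) i
    · have h1 := hgen Z fun l i => hzent l i.castSucc
      rw [hx.last, mul_neg_one]
      refine ⟨h1.1.neg, fun φ => ?_⟩
      rw [map_neg, norm_neg]
      exact h1.2 φ
    · rw [hcr i]
      refine hgen _ fun l j => ?_
      rw [Matrix.updateCol_apply]
      split_ifs
      · exact hzent l _
      · exact hzent l _
  have hZint : IsIntegral ℤ Z.det := by
    have := (hint (Fin.last n)).1
    rw [hx.last, mul_neg_one] at this
    simpa using this.neg
  have h1 : 1 ≤ ∏ v, placeAbs S v Z.det :=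
    one_le_prod_placeAbs (mem_sIntegers_of_isIntegral S hZint) hdet
  have hH0 : 0 ≤ totalHeight S x := zero_le_one.trans hx.one_le_totalHeight
  calc totalHeight S x ≤ (∏ v, placeAbs S v Z.det) * totalHeight S x :=
        le_mul_of_one_le_left hH0 h1
    _ = ∏ v, placeAbs S v Z.det * localHeight S v x := by
        rw [totalHeight, Finset.prod_mul_distrib]
    _ ≤ (n.factorial * μ ^ n) ^ finrank ℚ k := ?_
  have hloc : ∀ v, ∃ i, placeAbs S v Z.det * localHeight S v x = placeAbs S v (Z.det * x i) := by
    intro v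
    obtain ⟨i, hi⟩ := exists_localHeight_eq S v x
    exact ⟨i, by rw [hi, map_mul]⟩
  rw [Fintype.prod_sum_type, ← Embeddings.card k ℂ, ← Finset.card_univ, ← Finset.prod_const]
  refine le_of_le_of_eq ?_ (mul_one _)
  refine mul_le_mul (Finset.prod_le_prod (fun φ _ => ?_) fun φ _ => ?_)
    (Finset.prod_le_one (fun w _ => ?_) fun w _ => ?_) (Finset.prod_nonneg fun w _ => ?_)
    (by positivity)
  · obtain ⟨i, hi⟩ := hloc (Sum.inl φ)
    rw [hi]
    exact apply_nonneg _ _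
  · obtain ⟨i, hi⟩ := hloc (Sum.inl φ)
    rw [hi]
    exact (hint i).2 φ
  · obtain ⟨i, hi⟩ := hloc (Sum.inr w)
    rw [hi]
    exact apply_nonneg _ _
  · obtain ⟨i, hi⟩ := hloc (Sum.inr w)
    rw [hi]
    exact FinitePlace.le_one_of_isIntegral w.1 (hint i).1
  · obtain ⟨i, hi⟩ := hloc (Sum.inr w)
    rw [hi]
    exact apply_nonneg _ _

end SUnitSolutions

section Reduction

open Module NumberField

variable {k : Type*} [Field k]

theorem flag_map {E F : Type*} [AddCommGroup E] [Module k E] [AddCommGroup F] [Module k F]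
    (L : E →ₗ[k] F) (z : ℕ → E) (l : ℕ) :
    flag k (fun i => L (z i)) l = (flag k z l).map L := by
  rw [flag, flag, Submodule.map_span, ← Set.image_comp]
  rfl

theorem exists_partial_elimination {n m : ℕ} (av : AbsoluteValue k ℝ) {z u : ℕ → Fin n → k}
    {μ : ℝ} {π : ℕ → Fin n} (hμ : ∀ j, av (z m j) ≤ μ)
    (hu : ∀ l < m, u l - z l ∈ flag k z l ∧ (∀ i < l, u l (π i) = 0) ∧
      (∀ j, av (u l j) ≤ av (u l (π l))) ∧ u l (π l) ≠ 0) (p : ℕ) (hp : p ≤ m) :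
    ∃ y : Fin n → k, y - z m ∈ flag k z m ∧ (∀ i < p, y (π i) = 0) ∧
      ∀ j, av (y j) ≤ 2 ^ p * μ := by
  induction p with
  | zero => exact ⟨z m, by simp, by simp, by simpa using hμ⟩
  | succ p ih =>
    obtain ⟨y, hy, hy0, hyμ⟩ := ih (by omega)
    obtain ⟨h1, h2, h3, h4⟩ := hu p (by omega)
    refine ⟨y - (y (π p) / u p (π p)) • u p, ?_, fun i hi => ?_, fun j => ?_⟩
    · rw [sub_right_comm]
      refine Submodule.sub_mem _ hy (Submodule.smul_mem _ _ ?_)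
      have h5 := Submodule.add_mem _ (flag_mono z (show p ≤ m by omega) h1)
        (mem_flag_of_lt (K := k) z (show p < m by omega))
      rwa [sub_add_cancel] at h5
    · rw [Pi.sub_apply, Pi.smul_apply, smul_eq_mul]
      rcases Nat.lt_succ_iff_lt_or_eq.mp hi with h | rfl
      · rw [hy0 i h, h2 i h, mul_zero, sub_zero]
      · rw [div_mul_cancel₀ _ h4, sub_self]
    · rw [Pi.sub_apply, Pi.smul_apply, smul_eq_mul]
      have hpos : 0 < av (u p (π p)) := av.pos h4
      have h5 : av (y (π p) / u p (π p) * u p j) ≤ 2 ^ p * μ := by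
        rw [map_mul, map_div₀]
        calc av (y (π p)) / av (u p (π p)) * av (u p j)
            ≤ av (y (π p)) / av (u p (π p)) * av (u p (π p)) :=
              mul_le_mul_of_nonneg_left (h3 j) (div_nonneg (av.nonneg _) hpos.le)
          _ = av (y (π p)) := div_mul_cancel₀ _ hpos.ne'
          _ ≤ _ := hyμ _
      calc av (y j - y (π p) / u p (π p) * u p j)
          ≤ av (y j) + av (y (π p) / u p (π p) * u p j) := av.sub_le_add _ _
        _ ≤ 2 ^ p * μ + 2 ^ p * μ := add_le_add (hyμ j) h5
        _ = _ := by ring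

/-- Gaussian elimination with pivots of maximal absolute value. -/
theorem exists_elimination {n m : ℕ} (av : AbsoluteValue k ℝ) {z : ℕ → Fin n → k} {μ : ℕ → ℝ}
    (hz : ∀ l < m, z l ∉ flag k z l) (hμ : ∀ l < m, ∀ j, av (z l j) ≤ μ l) (hn : 0 < n) :
    ∃ (u : ℕ → Fin n → k) (π : ℕ → Fin n), ∀ l < m, u l - z l ∈ flag k z l ∧
      (∀ i < l, u l (π i) = 0) ∧ (∀ j, av (u l j) ≤ av (u l (π l))) ∧ u l (π l) ≠ 0 ∧
      ∀ j, av (u l j) ≤ 2 ^ l * μ l := by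
  classical
  induction m with
  | zero => exact ⟨fun _ => 0, fun _ => ⟨0, hn⟩, by simp⟩
  | succ m ih =>
    obtain ⟨u, π, hu⟩ := ih (fun l hl => hz l (by omega)) fun l hl => hμ l (by omega)
    obtain ⟨y, hy, hy0, hyμ⟩ := exists_partial_elimination av (hμ m (by omega))
      (fun l hl => ⟨(hu l hl).1, (hu l hl).2.1, (hu l hl).2.2.1, (hu l hl).2.2.2.1⟩) m le_rfl
    have hne : y ≠ 0 := by
      rintro rfl
      rw [zero_sub, Submodule.neg_mem_iff] at hy
      exact hz m (by omega) hy
    obtain ⟨j₀, -, hj₀⟩ := Finset.exists_max_image Finset.univ (fun j => av (y j))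
      ⟨⟨0, hn⟩, Finset.mem_univ _⟩
    have hyj₀ : y j₀ ≠ 0 := by
      intro h0
      refine hne (funext fun j => ?_)
      have := hj₀ j (Finset.mem_univ _)
      rw [h0, map_zero] at this
      exact av.eq_zero.mp (le_antisymm this (av.nonneg _))
    refine ⟨Function.update u m y, Function.update π m j₀, fun l hl => ?_⟩
    have hπ : ∀ i < m, Function.update π m j₀ i = π i := fun i hi =>
      Function.update_of_ne (by omega) _ _
    rcases Nat.lt_succ_iff_lt_or_eq.mp hl with h | rfl
    · rw [Function.update_of_ne h.ne, hπ l h]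
      obtain ⟨h1, h2, h3⟩ := hu l h
      refine ⟨h1, fun i hi => ?_, h3⟩
      rw [hπ i (by omega)]
      exact h2 i hi
    · rw [Function.update_self, Function.update_self]
      refine ⟨hy, fun i hi => ?_, fun j => hj₀ j (Finset.mem_univ _), hyj₀, hyμ⟩
      rw [hπ i hi]
      exact hy0 i hi

variable [NumberField k]

/-- Simultaneous approximation by algebraic integers at the infinite places. -/
theorem exists_isIntegral_approx (k : Type*) [Field k] [NumberField k] : ∃ C : ℝ, 0 ≤ C ∧
    ∀ c : InfinitePlace k → k, ∃ q : k, IsIntegral ℤ q ∧ ∀ w : InfinitePlace k, w (q - c w) ≤ C := by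
  classical
  let b := mixedEmbedding.latticeBasis k
  refine ⟨∑ i, ‖b i‖, Finset.sum_nonneg fun i _ => norm_nonneg _, fun c => ?_⟩
  let y : mixedEmbedding.mixedSpace k :=
    (fun w => (mixedEmbedding k (c w)).1 w, fun w => (mixedEmbedding k (c w)).2 w)
  have hmem : (ZSpan.floor b y : mixedEmbedding.mixedSpace k) ∈
      ((mixedEmbedding k).comp (algebraMap (𝓞 k) k)).range :=
    (mixedEmbedding.mem_span_latticeBasis k).mp (ZSpan.floor b y).2
  obtain ⟨q, hq⟩ := hmem
  refine ⟨q, RingOfIntegers.isIntegral_coe q, fun w => ?_⟩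
  have h1 : ‖ZSpan.fract b y‖ ≤ ∑ i, ‖b i‖ := ZSpan.norm_fract_le b y
  have h2 : ZSpan.fract b y = y - mixedEmbedding k (q : k) := by
    rw [ZSpan.fract_apply, ← hq]
    rfl
  have h3 : mixedEmbedding.normAtPlace w (y - mixedEmbedding k (q : k)) ≤ ‖ZSpan.fract b y‖ := by
    rw [h2, mixedEmbedding.norm_eq_sup'_normAtPlace]
    exact Finset.le_sup' (fun w => mixedEmbedding.normAtPlace w (y - mixedEmbedding k (q : k)))
      (Finset.mem_univ w)
  have h4 : mixedEmbedding.normAtPlace w (y - mixedEmbedding k (q : k)) = w (c w - q) := by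
    rw [← mixedEmbedding.normAtPlace_apply, (mixedEmbedding k).map_sub]
    rcases w.isReal_or_isComplex with hw | hw
    · rw [mixedEmbedding.normAtPlace_apply_of_isReal hw,
        mixedEmbedding.normAtPlace_apply_of_isReal hw]
      rfl
    · rw [mixedEmbedding.normAtPlace_apply_of_isComplex hw,
        mixedEmbedding.normAtPlace_apply_of_isComplex hw]
      rfl
  have h5 : w (q - c w) = w (c w - q) := w.1.map_sub _ _
  rw [h5, ← h4]
  exact h3.trans h1

/-- One reduction of a vector against the earlier members of a flag, at all infinite places. -/
theorem exists_reduction {n N l : ℕ} {C K : ℝ} (hC : 0 ≤ C)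
    (happrox : ∀ c : InfinitePlace k → k, ∃ q : k, IsIntegral ℤ q ∧ ∀ w : InfinitePlace k, w (q - c w) ≤ C)
    {x : Fin N → k} {z : ℕ → Fin N → k} {μ : ℕ → ℝ} (hz : ∀ i ≤ l, IsIntRel x (z i))
    (hμ : ∀ i j, i ≤ j → j ≤ l → μ i ≤ μ j) (hμ0 : 0 ≤ μ 0)
    (L : InfinitePlace k → (Fin N → k) →ₗ[k] (Fin n → k))
    {u : InfinitePlace k → ℕ → Fin n → k} {π : InfinitePlace k → Fin n → Fin n}
    (hu : ∀ w, ∀ i ≤ l, u w i - L w (z i) ∈ flag k (fun i => L w (z i)) i)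
    (hu0 : ∀ w, ∀ i ≤ l, ∀ a : Fin n, (a : ℕ) < i → u w i (π w a) = 0)
    (huμ : ∀ w : InfinitePlace k, ∀ i ≤ l, ∀ j, w (u w i j) ≤ K * μ i) (p : ℕ) (hp : p ≤ l) :
    ∃ y, IsIntRel x y ∧ y - z l ∈ flag k z l ∧ ∀ w : InfinitePlace k, ∃ t : Fin n → k,
      L w y - t ∈ flag k (fun i => L w (z i)) (l - p) ∧
      ∀ a, w (t (π w a)) ≤ (1 + p * C) * (K * μ (min a l)) := by
  have hKμ : ∀ i ≤ l, 0 ≤ K * μ i ∨ n = 0 := by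
    intro i hi
    rcases Nat.eq_zero_or_pos n with h | h
    · exact Or.inr h
    · exact Or.inl ((apply_nonneg _ _).trans (huμ (Classical.arbitrary _) i hi ⟨0, h⟩))
  have hK : ∀ (_ : Fin n) i j, i ≤ j → j ≤ l → K * μ i ≤ K * μ j := by
    intro a i j hij hj
    rcases lt_or_ge K 0 with hneg | hpos
    · rcases hKμ j hj with h | h
      · have h1 : 0 ≤ μ j := hμ0.trans (hμ 0 j (Nat.zero_le _) hj)
        have h2 : 0 ≤ μ i := hμ0.trans (hμ 0 i (Nat.zero_le _) (hij.trans hj))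
        have h3 : K * μ i ≤ 0 := mul_nonpos_of_nonpos_of_nonneg hneg.le h2
        linarith
      · exact absurd a.2 (by omega)
    · exact mul_le_mul_of_nonneg_left (hμ i j hij hj) hpos
  induction p with
  | zero =>
    refine ⟨z l, hz l le_rfl, by simp, fun w => ⟨u w l, ?_, fun a => ?_⟩⟩
    · rw [← neg_sub]
      exact Submodule.neg_mem _ (hu w l le_rfl)
    · rcases lt_or_ge (a : ℕ) l with h | h
      · rw [hu0 w l le_rfl a h, map_zero]
        rcases hKμ (min a l) (min_le_right _ _) with h' | h'
        · simpa using h'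
        · exact absurd a.2 (by omega)
      · rw [min_eq_right h]
        simpa using huμ w l le_rfl (π w a)
  | succ p ih =>
    obtain ⟨y, hy, hyl, hyt⟩ := ih (by omega)
    choose t ht hta using hyt
    obtain ⟨m, hm⟩ : ∃ m, m = l - (p + 1) := ⟨_, rfl⟩
    have hm1 : l - p = m + 1 := by omega
    have hc : ∀ w, ∃ c : k, L w y - t w - c • L w (z m) ∈ flag k (fun i => L w (z i)) m := by
      intro w
      have := ht w
      rw [hm1, mem_flag_succ] at this
      exact this
    choose c hc using hc
    obtain ⟨q, hq, hqc⟩ := happrox c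
    refine ⟨y - q • z m, hy.sub ((hz m (by omega)).smul hq), ?_, fun w =>
      ⟨t w - (q - c w) • u w m, ?_, fun a => ?_⟩⟩
    · rw [sub_right_comm]
      exact Submodule.sub_mem _ hyl (Submodule.smul_mem _ _ (mem_flag_of_lt z (by omega)))
    · rw [← hm]
      have h1 := Submodule.add_mem _ (hc w) (Submodule.smul_mem _ (q - c w) (hu w m (by omega)))
      convert h1 using 1
      rw [map_sub, map_smul, smul_sub, sub_smul, sub_smul]
      abel
    · rw [Pi.sub_apply, Pi.smul_apply, smul_eq_mul]
      have h1 : w ((q - c w) * u w m (π w a)) ≤ C * (K * μ (min a l)) := by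
        rcases lt_or_ge (a : ℕ) m with h | h
        · rw [hu0 w m (by omega) a h, mul_zero, map_zero]
          rcases hKμ (min a l) (min_le_right _ _) with h' | h'
          · exact mul_nonneg hC h'
          · exact absurd a.2 (by omega)
        · rw [map_mul]
          exact mul_le_mul (hqc w) ((huμ w m (by omega) _).trans
            (hK a _ _ (le_min h (by omega)) (min_le_right _ _))) (apply_nonneg _ _) hC
      have h2 : w (t w (π w a) - (q - c w) * u w m (π w a)) ≤
          w (t w (π w a)) + w ((q - c w) * u w m (π w a)) := w.1.sub_le_add _ _
      push_cast
      linarith [hta w a]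

/-- A system of minimal relations can be modified so that at every infinite place its coordinates
are bounded in a triangular fashion. -/
theorem exists_reduced_relations (k : Type*) [Field k] [NumberField k] (n : ℕ) : ∃ C : ℝ, 1 ≤ C ∧
    ∀ (x : Fin (n + 1) → k) (z : ℕ → Fin (n + 1) → k), (∀ i, x i ≠ 0) → IsMinimalRel x z n →
    ∀ i₀ : InfinitePlace k → Fin (n + 1), ∃ (z' : ℕ → Fin (n + 1) → k)
      (π : InfinitePlace k → Fin n → Fin (n + 1)),
      (∀ w, Function.Injective (π w) ∧ ∀ a, π w a ≠ i₀ w) ∧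
      ∀ l < n, IsIntRel x (z' l) ∧ z' l - z l ∈ flag k z l ∧
        ∀ w : InfinitePlace k, ∀ a, w (z' l (π w a)) ≤ C * vecHouse (z (min a l)) := by
  classical
  obtain ⟨C, hC, happrox⟩ := exists_isIntegral_approx k
  refine ⟨(1 + n * C) * 2 ^ n, ?_, fun x z hx hz i₀ => ?_⟩
  · have h1 : (1 : ℝ) ≤ 2 ^ n := one_le_pow₀ (by norm_num)
    have h2 : (0 : ℝ) ≤ n * C := by positivity
    nlinarith
  rcases Nat.eq_zero_or_pos n with rfl | hn
  · exact ⟨z, fun w a => a.elim0, fun w => ⟨fun a => a.elim0, fun a => a.elim0⟩, by simp⟩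
  let L : InfinitePlace k → (Fin (n + 1) → k) →ₗ[k] (Fin n → k) := fun w =>
    LinearMap.funLeft k k (i₀ w).succAbove
  have hL : ∀ w y a, L w y a = y ((i₀ w).succAbove a) := fun w y a => rfl
  have hx0 : x ≠ 0 := fun h => hx 0 (congrFun h 0)
  have hflag : ∀ l ≤ n, flag k z l ≤ relSpace x := by
    intro l hl
    refine Submodule.span_le.mpr ?_
    rintro _ ⟨i, hi, rfl⟩
    exact mem_relSpace.mpr (hz.rel i (lt_of_lt_of_le hi hl)).2
  have hind : ∀ w, ∀ l < n, L w (z l) ∉ flag k (fun i => L w (z i)) l := by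
    intro w l hl hmem
    rw [flag_map] at hmem
    obtain ⟨y, hy, hyL⟩ := Submodule.mem_map.mp hmem
    refine hz.notMem l hl ?_
    have h1 : y - z l ∈ relSpace x := Submodule.sub_mem _ (hflag l hl.le hy)
      (mem_relSpace.mpr (hz.rel l hl).2)
    have h2 : y - z l = 0 := by
      have h3 : ∀ a, (y - z l) ((i₀ w).succAbove a) = 0 := by
        intro a
        have := congrFun hyL a
        rw [hL, hL] at this
        rw [Pi.sub_apply, this, sub_self]
      rw [mem_relSpace, Fin.sum_univ_succAbove _ (i₀ w)] at h1
      simp only [h3, mul_zero, Finset.sum_const_zero, add_zero] at h1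
      funext i
      rcases Fin.eq_self_or_eq_succAbove (i₀ w) i with rfl | ⟨a, rfl⟩
      · exact (mul_eq_zero.mp h1).resolve_left (hx _)
      · exact h3 a
    rw [← sub_eq_zero.mp h2]
    exact hy
  have helim : ∀ w : InfinitePlace k, ∃ (u : ℕ → Fin n → k) (π : ℕ → Fin n), ∀ l < n,
      u l - L w (z l) ∈ flag k (fun i => L w (z i)) l ∧
      (∀ i < l, u l (π i) = 0) ∧ (∀ j, w.1 (u l j) ≤ w.1 (u l (π l))) ∧ u l (π l) ≠ 0 ∧
      ∀ j, w.1 (u l j) ≤ 2 ^ l * vecHouse (z l) := by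
    intro w
    refine exists_elimination w.1 (hind w) (fun l hl j => ?_) hn
    rw [hL]
    have h1 := norm_le_vecHouse (z l) ((i₀ w).succAbove j) w.embedding
    rwa [InfinitePlace.norm_embedding_eq] at h1
  choose u π hu using helim
  have hπ : ∀ w, Function.Injective fun a : Fin n => π w a := by
    intro w
    have key : ∀ a b : Fin n, a < b → π w a ≠ π w b := fun a b hab h => by
      have h1 := (hu w b b.2).2.1 a hab
      rw [h] at h1
      exact (hu w b b.2).2.2.2.1 h1
    intro a b hab
    rcases lt_trichotomy a b with h | h | h
    · exact absurd hab (key a b h)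
    · exact h
    · exact absurd hab.symm (key b a h)
  have hred : ∀ l, ∃ y, l < n → IsIntRel x y ∧ y - z l ∈ flag k z l ∧
      ∀ w : InfinitePlace k, ∀ a : Fin n, w (y ((i₀ w).succAbove (π w a))) ≤
        (1 + n * C) * 2 ^ n * vecHouse (z (min a l)) := by
    intro l
    by_cases hl : l < n
    swap
    · exact ⟨0, fun h => absurd h hl⟩
    obtain ⟨y, hy, hyl, hyt⟩ := exists_reduction (K := 2 ^ n) (l := l) hC happrox (x := x) (z := z)
      (μ := fun i => vecHouse (z i)) (fun i hi => hz.rel i (by omega))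
      (fun i j hij hj => hz.monotone hij (by omega)) (vecHouse_nonneg _) L (u := u)
      (π := fun w a => π w a) (fun w i hi => (hu w i (by omega)).1)
      (fun w i hi a ha => (hu w i (by omega)).2.1 a ha)
      (fun w i hi j => ((hu w i (by omega)).2.2.2.2 j).trans
        (mul_le_mul_of_nonneg_right (pow_le_pow_right₀ (by norm_num) (by omega))
          (vecHouse_nonneg _))) l le_rfl
    refine ⟨y, fun _ => ⟨hy, hyl, fun w a => ?_⟩⟩
    obtain ⟨t, ht, hta⟩ := hyt w
    rw [Nat.sub_self, flag_zero, Submodule.mem_bot, sub_eq_zero] at ht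
    rw [← hL w y (π w a), ht, mul_assoc]
    refine (hta a).trans (mul_le_mul_of_nonneg_right ?_ (mul_nonneg (by positivity)
      (vecHouse_nonneg _)))
    have h1 : (l : ℝ) ≤ n := Nat.cast_le.mpr hl.le
    have h2 := mul_le_mul_of_nonneg_right h1 hC
    linarith
  choose z' hz' using hred
  refine ⟨z', fun w a => (i₀ w).succAbove (π w a), fun w => ⟨?_, fun a => ?_⟩, fun l hl =>
    hz' l hl⟩
  · exact Fin.succAbove_right_injective.comp (hπ w)
  · exact Fin.succAbove_ne _ _

end Reduction

section ReducedSystem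

open Module NumberField

variable {k : Type*} [Field k] [NumberField k] {n : ℕ}

/-- The sequence of sizes at the archimedean places, trivial at the other places. -/
noncomputable def placeWeight (S : Finset (FinitePlace k)) (μ : ℕ → ℝ) : PlaceIndex S → ℕ → ℝ :=
  Sum.elim (fun _ => μ) fun _ _ => 1

@[simp] theorem placeWeight_inl (S : Finset (FinitePlace k)) (μ : ℕ → ℝ) (φ : k →+* ℂ) (i : ℕ) :
    placeWeight S μ (Sum.inl φ) i = μ i := rfl

@[simp] theorem placeWeight_inr (S : Finset (FinitePlace k)) (μ : ℕ → ℝ) (w : S) (i : ℕ) :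
    placeWeight S μ (Sum.inr w) i = 1 := rfl

/-- A reduced system of integral relations for a solution of the unit equation. -/
structure IsReducedSystem (S : Finset (FinitePlace k)) (C : ℝ) (x : Fin (n + 1) → k)
    (z : ℕ → Fin (n + 1) → k) (μ : ℕ → ℝ) (i₀ : PlaceIndex S → Fin (n + 1))
    (π : PlaceIndex S → Fin n → Fin (n + 1)) : Prop where
  zero : z 0 = 1
  rel : ∀ l < n, IsIntRel x (z l)
  det_ne_zero : (Matrix.of fun (l : Fin n) (i : Fin n) => z l i.castSucc).det ≠ 0
  injective : ∀ v, Function.Injective (π v)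
  ne : ∀ v a, π v a ≠ i₀ v
  eq_localHeight : ∀ v, localHeight S v x = placeAbs S v (x (i₀ v))
  le : ∀ l < n, ∀ v (a : Fin n), placeAbs S v (z l (π v a)) ≤ C * placeWeight S μ v (min a l)
  weight_zero : μ 0 = 1
  weight_mono : ∀ i j, i ≤ j → j < n → μ i ≤ μ j
  prod_le : ∏ i ∈ Finset.range n, μ i ^ finrank ℚ k ≤ C * totalHeight S x
  height_le : totalHeight S x ≤ (C * μ (n - 1) ^ n) ^ finrank ℚ k

omit [NumberField k] in
theorem flag_le_flag_of_sub_mem {E : Type*} [AddCommGroup E] [Module k E] {z z' : ℕ → E} {m : ℕ}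
    (h : ∀ l < m, z' l - z l ∈ flag k z l) : flag k z m ≤ flag k z' m := by
  induction m with
  | zero =>
    rw [flag_zero]
    exact bot_le
  | succ m ih =>
    intro y hy
    have ih' := ih fun l hl => h l (by omega)
    obtain ⟨a, ha⟩ := mem_flag_succ.mp hy
    have h1 : y = (y - a • z m) + a • (z' m - (z' m - z m)) := by
      rw [sub_sub_cancel, sub_add_cancel]
    rw [h1]
    have hle : flag k z' m ≤ flag k z' (m + 1) := flag_mono z' (Nat.le_succ m)
    exact Submodule.add_mem _ (hle (ih' ha)) (Submodule.smul_mem _ _ (Submodule.sub_mem _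
      (mem_flag_of_lt z' (Nat.lt_succ_self m)) (hle (ih' (h m (Nat.lt_succ_self m))))))

theorem exists_isReducedSystem (k : Type*) [Field k] [NumberField k] (n : ℕ) (hn : 0 < n) :
    ∃ C : ℝ, 1 ≤ C ∧ ∀ (S : Finset (FinitePlace k)) (x : Fin (n + 1) → k), IsSUnitSol S x →
      ∃ z μ i₀ π, IsReducedSystem S C x z μ i₀ π := by
  classical
  obtain ⟨C₁, hC₁, h₁⟩ := exists_prod_vecHouse_le k n
  obtain ⟨C₂, hC₂, h₂⟩ := exists_reduced_relations k n
  have hfac : (1 : ℝ) ≤ n.factorial := by exact_mod_cast Nat.factorial_pos n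
  set C : ℝ := max (max C₁ C₂) n.factorial with hC
  have hCC₁ : C₁ ≤ C := (le_max_left _ _).trans (le_max_left _ _)
  have hCC₂ : C₂ ≤ C := (le_max_right _ _).trans (le_max_left _ _)
  have hCf : (n.factorial : ℝ) ≤ C := le_max_right _ _
  refine ⟨C, hC₁.trans hCC₁, fun S x hx => ?_⟩
  obtain ⟨z, hz⟩ := exists_isMinimalRel hx.ne_zero hx.sum
  have hH1 := hx.one_le_totalHeight
  have hloc : ∀ w : InfinitePlace k, ∃ i, ∀ j, w (x j) ≤ w (x i) := by
    intro w
    obtain ⟨i, -, hi⟩ := Finset.exists_max_image Finset.univ (fun j => w (x j)) Finset.univ_nonempty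
    exact ⟨i, fun j => hi j (Finset.mem_univ j)⟩
  choose iinf hiinf using hloc
  choose ifin hifin using fun w : S => exists_localHeight_eq S (Sum.inr w) x
  obtain ⟨z', π, hπ, hz'⟩ := h₂ x z (fun i => (hx.unit i).1) hz iinf
  refine ⟨z', fun i => vecHouse (z i), Sum.elim (fun φ => iinf (InfinitePlace.mk φ)) ifin,
    Sum.elim (fun φ => π (InfinitePlace.mk φ)) fun w => (ifin w).succAbove, ?_, ?_, ?_, ?_, ?_, ?_,
    ?_, ?_, ?_, ?_, ?_⟩
  · have h := (hz' 0 hn).2.1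
    rw [flag_zero, Submodule.mem_bot, sub_eq_zero] at h
    rw [h, hz.zero]
  · exact fun l hl => (hz' l hl).1
  · exact det_ne_zero_of_forall_mem_flag hx.last fun w hw =>
      flag_le_flag_of_sub_mem (fun l hl => (hz' l hl).2.1) (hz.mem_flag hx.ne_zero hw)
  · rintro (φ | w)
    · exact (hπ _).1
    · exact Fin.succAbove_right_injective
  · rintro (φ | w) a
    · exact (hπ _).2 a
    · exact Fin.succAbove_ne _ _
  · rintro (φ | w)
    · exact le_antisymm (Finset.sup'_le _ _ fun j _ => hiinf (InfinitePlace.mk φ) j)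
        (placeAbs_le_localHeight S _ x _)
    · exact hifin w
  · rintro l hl (φ | w) a
    · exact ((hz' l hl).2.2 (InfinitePlace.mk φ) a).trans
        (mul_le_mul_of_nonneg_right hCC₂ (vecHouse_nonneg _))
    · rw [placeWeight_inr, mul_one]
      exact (FinitePlace.le_one_of_isIntegral w.1 ((hz' l hl).1.1 _)).trans (hC₁.trans hCC₁)
  · refine le_antisymm ?_ (hz.one_le hn)
    rw [hz.zero]
    exact vecHouse_le zero_le_one (by simp)
  · exact fun i j hij hj => hz.monotone hij hj
  · exact (h₁ S x z hx hz).trans (mul_le_mul_of_nonneg_right hCC₁ (by linarith))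
  · refine (hx.totalHeight_le hz (hz.one_le (l := n - 1) (by omega)) fun i hi =>
      hz.monotone (show i ≤ n - 1 by omega) (by omega)).trans ?_
    exact pow_le_pow_left₀ (mul_nonneg (by linarith) (pow_nonneg (vecHouse_nonneg _) _))
      (mul_le_mul_of_nonneg_right hCf (pow_nonneg (vecHouse_nonneg _) _)) _

end ReducedSystem

section Exponents

theorem Set.Infinite.exists_infinite_fiber {α β : Type*} {s : Set α} (hs : s.Infinite) {f : α → β}
    {t : Set β} (ht : t.Finite) (hf : Set.MapsTo f s t) : ∃ b ∈ t, {a ∈ s | f a = b}.Infinite := by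
  by_contra! H
  refine hs ((ht.biUnion fun b hb => H b hb).subset fun a ha => ?_)
  exact Set.mem_biUnion (hf ha) ⟨ha, rfl⟩

theorem exists_gap {μ : ℕ → ℝ} {n d : ℕ} (hn : 1 < n) (h0 : μ 0 = 1)
    (hmono : ∀ i j, i ≤ j → j < n → μ i ≤ μ j) {C H : ℝ} (hC : 1 ≤ C) (hH : 1 ≤ H)
    (hle : H ≤ (C * μ (n - 1) ^ n) ^ d) :
    ∃ l, 0 < l ∧ l < n ∧
      Real.log H ≤ d * Real.log C + n ^ 2 * (d * (Real.log (μ l) - Real.log (μ (l - 1)))) := by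
  have h1 : ∀ i < n, 1 ≤ μ i := fun i hi => h0 ▸ hmono 0 i (Nat.zero_le _) hi
  set Λ := Real.log (μ (n - 1)) with hΛ
  have hΛ0 : 0 ≤ Λ := Real.log_nonneg (h1 _ (by omega))
  have htel : ∑ i ∈ Finset.range (n - 1), (Real.log (μ (i + 1)) - Real.log (μ i)) = Λ := by
    rw [Finset.sum_range_sub (fun i => Real.log (μ i)), h0, Real.log_one, sub_zero]
  obtain ⟨i, hi, hile⟩ : ∃ i ∈ Finset.range (n - 1),
      Λ / (n - 1 : ℕ) ≤ Real.log (μ (i + 1)) - Real.log (μ i) := by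
    refine Finset.exists_le_of_sum_le ⟨0, Finset.mem_range.mpr (by omega)⟩ ?_
    rw [htel, Finset.sum_const, Finset.card_range, nsmul_eq_mul, mul_div_cancel₀]
    exact Nat.cast_ne_zero.mpr (by omega)
  have hi' := Finset.mem_range.mp hi
  refine ⟨i + 1, Nat.succ_pos i, by omega, ?_⟩
  have hlog : Real.log H ≤ d * (Real.log C + n * Λ) := by
    have hμp : 0 < μ (n - 1) := zero_lt_one.trans_le (h1 _ (by omega))
    have h2 := Real.log_le_log (by linarith) hle
    rwa [Real.log_pow, Real.log_mul (by linarith) (pow_pos hμp n).ne', Real.log_pow] at h2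
  have h3 : Λ ≤ n * (Real.log (μ (i + 1)) - Real.log (μ i)) := by
    have hpos : (0 : ℝ) < (n - 1 : ℕ) := Nat.cast_pos.mpr (by omega)
    rw [div_le_iff₀ hpos] at hile
    have h4 : ((n - 1 : ℕ) : ℝ) ≤ n := Nat.cast_le.mpr (Nat.sub_le _ _)
    have h5 : 0 ≤ Real.log (μ (i + 1)) - Real.log (μ i) :=
      sub_nonneg.mpr (Real.log_le_log (zero_lt_one.trans_le (h1 _ (by omega)))
        (hmono _ _ (Nat.le_succ i) (by omega)))
    nlinarith
  rw [Nat.add_sub_cancel]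
  have h6 : (d : ℝ) * (n * Λ) ≤ d * (n * (n * (Real.log (μ (i + 1)) - Real.log (μ i)))) :=
    mul_le_mul_of_nonneg_left (mul_le_mul_of_nonneg_left h3 (Nat.cast_nonneg _)) (Nat.cast_nonneg _)
  nlinarith

/-- Bounds depending on a parameter can be made uniform relative to the parameter on an infinite
subset. -/
theorem exists_common_exponents {ι A : Type*} [Fintype A] {T : Set ι} (hT : T.Infinite)
    {h : ι → ℝ} (hh : ∀ B : ℝ, {j | h j ≤ B}.Finite) {E : ι → A → ℝ} {K γ C b : ℝ} (hγ : 0 < γ)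
    (hE : ∀ j ∈ T, ∀ a, |E j a| ≤ K + K * h j)
    (hsum : ∀ j ∈ T, ∑ a, E j a ≤ C - γ * h j) :
    ∃ e : A → ℝ, ∑ a, e a < 0 ∧ {j ∈ T | ∀ a, E j a + b ≤ h j * e a}.Infinite := by
  classical
  set N : ℝ := (Fintype.card A : ℝ) with hN
  have hN0 : 0 ≤ N := Nat.cast_nonneg _
  obtain ⟨ε, hε⟩ : ∃ ε, ε = γ / (8 * (N + 1)) := ⟨_, rfl⟩
  have hε0 : 0 < ε := by rw [hε]; positivity
  have hεN : N * (2 * ε) ≤ γ / 4 := by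
    have h1 : ε * (8 * (N + 1)) = γ := by
      rw [hε]
      exact div_mul_cancel₀ _ (by positivity)
    nlinarith
  obtain ⟨B, hB⟩ : ∃ B, B = max (max 1 (|b| / ε)) (4 * |C| / γ) := ⟨_, rfl⟩
  have hT' : (T \ {j | h j ≤ B}).Infinite := hT.sdiff (hh B)
  have hlarge : ∀ j ∈ T \ {j | h j ≤ B}, 1 ≤ h j ∧ b ≤ ε * h j ∧ C ≤ γ / 4 * h j := by
    intro j hj
    have h1 : B < h j := not_le.mp hj.2
    have h2 : 1 ≤ B := hB ▸ (le_max_left _ _).trans (le_max_left _ _)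
    have h3 : |b| / ε ≤ B := hB ▸ (le_max_right _ _).trans (le_max_left _ _)
    have h4 : 4 * |C| / γ ≤ B := hB ▸ le_max_right _ _
    rw [div_le_iff₀ hε0] at h3
    rw [div_le_iff₀ hγ] at h4
    refine ⟨by linarith, ?_, ?_⟩
    · nlinarith [le_abs_self b]
    · nlinarith [le_abs_self C]
  let c : ι → A → ℤ := fun j a => ⌈E j a / (ε * h j)⌉
  obtain ⟨R, hR⟩ : ∃ R : ℤ, R = ⌈2 * |K| / ε⌉ := ⟨_, rfl⟩
  have hmaps : Set.MapsTo c (T \ {j | h j ≤ B}) (Set.pi Set.univ fun _ => Set.Icc (-R) (R + 1)) := by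
    intro j hj a _
    obtain ⟨h1, -, -⟩ := hlarge j hj
    have hεh : 0 < ε * h j := mul_pos hε0 (by linarith)
    have h2 : |E j a / (ε * h j)| ≤ R := by
      rw [abs_div, abs_of_pos hεh, div_le_iff₀ hεh]
      have h3 : 2 * |K| ≤ R * ε := by
        have := Int.le_ceil (2 * |K| / ε)
        rwa [← hR, div_le_iff₀ hε0] at this
      have h4 := hE j hj.1 a
      nlinarith [le_abs_self K, abs_nonneg K]
    obtain ⟨h5, h6⟩ := abs_le.mp h2
    constructor
    · exact_mod_cast h5.trans (Int.le_ceil _)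
    · have := Int.ceil_le.mpr h6
      simp only [c]
      linarith
  obtain ⟨c₀, -, hc₀⟩ := hT'.exists_infinite_fiber
    (Set.Finite.pi fun _ => Set.finite_Icc _ _) hmaps
  have hup : ∀ j ∈ {j ∈ T \ {j | h j ≤ B} | c j = c₀}, ∀ a,
      E j a ≤ ε * h j * c₀ a ∧ ε * h j * c₀ a ≤ E j a + ε * h j := by
    rintro j ⟨hj, hjc⟩ a
    obtain ⟨h1, -, -⟩ := hlarge j hj
    have hεh : 0 < ε * h j := mul_pos hε0 (by linarith)
    have hca : c₀ a = ⌈E j a / (ε * h j)⌉ := (congrFun hjc a).symm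
    have h2 : E j a / (ε * h j) * (ε * h j) = E j a := div_mul_cancel₀ _ hεh.ne'
    have h3 := Int.le_ceil (E j a / (ε * h j))
    have h4 := (Int.ceil_lt_add_one (E j a / (ε * h j))).le
    rw [← hca] at h3 h4
    constructor <;> nlinarith
  refine ⟨fun a => ε * (c₀ a + 1), ?_, hc₀.mono fun j hj => ⟨hj.1.1, fun a => ?_⟩⟩
  · obtain ⟨j, hj⟩ := hc₀.nonempty
    obtain ⟨h1, -, h3⟩ := hlarge j hj.1
    have h4 : h j * ∑ a, ε * ((c₀ a : ℝ) + 1) ≤ ∑ a, (E j a + 2 * (ε * h j)) := by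
      rw [Finset.mul_sum]
      exact Finset.sum_le_sum fun a _ => by linarith [(hup j hj a).2]
    rw [Finset.sum_add_distrib, Finset.sum_const, Finset.card_univ, nsmul_eq_mul] at h4
    have h5 := hsum j hj.1.1
    have h6 : N * (2 * ε) * h j ≤ γ / 4 * h j := mul_le_mul_of_nonneg_right hεN (by linarith)
    by_contra! hneg
    nlinarith [mul_nonneg (by linarith : 0 ≤ h j) hneg]
  · obtain ⟨-, h2, -⟩ := hlarge j hj.1
    linarith [(hup j hj a).1]

end Exponents

section Minors

variable {k : Type*} [Field k]

/-- The matrix expressing a selection of the coordinates of a vector with vanishing coordinate sum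
in terms of all coordinates but the last one. -/
def selectionMatrix {n : ℕ} (π : Fin n → Fin (n + 1)) : Matrix (Fin n) (Fin n) ℤ :=
  Matrix.of fun a b => (if π a = b.castSucc then 1 else 0) - if π a = Fin.last n then 1 else 0

theorem sum_selectionMatrix_mul {n : ℕ} (π : Fin n → Fin (n + 1)) {y : Fin (n + 1) → k}
    (hy : ∑ i, y i = 0) (a : Fin n) :
    ∑ b, (selectionMatrix π a b : k) * y b.castSucc = y (π a) := by
  rw [Fin.sum_univ_castSucc] at hy
  simp only [selectionMatrix, Matrix.of_apply, Int.cast_sub, Int.cast_ite, Int.cast_one,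
    Int.cast_zero, sub_mul, ite_mul, one_mul, zero_mul, Finset.sum_sub_distrib]
  induction h : π a using Fin.lastCases with
  | last =>
    simp [(Fin.castSucc_ne_last _).symm]
    linear_combination -hy
  | cast j => simp [Fin.castSucc_inj, Fin.castSucc_ne_last]

theorem exists_mul_selectionMatrix_eq_one {n : ℕ} {π : Fin n → Fin (n + 1)}
    (hπ : Function.Injective π) : ∃ M' : Matrix (Fin n) (Fin n) ℤ, M' * selectionMatrix π = 1 := by
  classical
  refine ⟨Matrix.of fun b a => (if π a = b.castSucc then 1 else 0) -
    if b.castSucc ∈ Set.range π then 0 else 1, ?_⟩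
  ext b c
  obtain ⟨y, hy⟩ : ∃ y : Fin (n + 1) → ℤ, y = fun i =>
    (if i = c.castSucc then 1 else 0) - if i = Fin.last n then 1 else 0 := ⟨_, rfl⟩
  have hy0 : ∑ i, y i = 0 := by simp [hy]
  have hM : ∀ a, selectionMatrix π a c = y (π a) := fun a => by rw [hy]; rfl
  have hyb : y b.castSucc = (1 : Matrix (Fin n) (Fin n) ℤ) b c := by
    simp [hy, Matrix.one_apply, Fin.castSucc_inj, Fin.castSucc_ne_last]
  rw [Matrix.mul_apply, ← hyb]
  simp only [hM, Matrix.of_apply]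
  by_cases hb : b.castSucc ∈ Set.range π
  · obtain ⟨a₀, ha₀⟩ := hb
    simp only [← ha₀, Set.mem_range_self, if_true, sub_zero, hπ.eq_iff]
    simp
  · have h1 : ∀ a, π a ≠ b.castSucc := fun a ha => hb ⟨a, ha⟩
    have h2 : Finset.univ.image π = Finset.univ.erase b.castSucc := by
      refine Finset.eq_of_subset_of_card_le (fun i hi => ?_) ?_
      · obtain ⟨a, -, rfl⟩ := Finset.mem_image.mp hi
        exact Finset.mem_erase.mpr ⟨h1 a, Finset.mem_univ _⟩
      · rw [Finset.card_image_of_injective _ hπ, Finset.card_erase_of_mem (Finset.mem_univ _)]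
        simp
    have h3 : ∑ a, y (π a) = ∑ i ∈ Finset.univ.erase b.castSucc, y i := by
      rw [← h2, Finset.sum_image fun a _ a' _ h => hπ h]
    have h4 := Finset.add_sum_erase Finset.univ y (Finset.mem_univ b.castSucc)
    simp only [hb, h1, if_false, zero_sub, neg_mul, one_mul, Finset.sum_neg_distrib, h3]
    linarith

theorem AbsoluteValue.det_le_of_forall_perm {p : ℕ} (av : AbsoluteValue k ℝ)
    (D : Matrix (Fin p) (Fin p) k) {B : ℝ}
    (h : ∀ s : Equiv.Perm (Fin p), ∏ t, av (D (s t) t) ≤ B) : av D.det ≤ p.factorial * B := by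
  rw [Matrix.det_apply']
  refine (av.sum_le _ _).trans ((Finset.sum_le_card_nsmul _ _ B fun s _ => ?_).trans_eq ?_)
  · rw [map_mul, map_prod]
    rcases Int.units_eq_one_or (Equiv.Perm.sign s) with h' | h' <;> simp [h', h s]
  · rw [Finset.card_univ, Fintype.card_perm, Fintype.card_fin, nsmul_eq_mul]

/-- The exponent in the upper bound for the minors of a reduced system. -/
noncomputable def minorExponent {p n l : ℕ} (h : l + p = n) (X : Fin n → ℝ) (m : ℕ → ℝ)
    (a : SubIndex p n) : ℝ :=
  open Classical in
  ∑ t, (Real.log (X (a.1 t)) + Real.log (m (a.1 t))) -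
    if a = SubIndex.top h then Real.log (m l) - Real.log (m (l - 1)) else 0

theorem det_le_exp_minorExponent {p n l : ℕ} (h : l + p = n) (hp : 0 < p) (hl : 0 < l)
    (av : AbsoluteValue k ℝ)
    {X : Fin n → ℝ} (hX : ∀ a, 0 < X a) {m : ℕ → ℝ} (hm0 : ∀ i < n, 0 < m i)
    (hm : ∀ i j, i ≤ j → j < n → m i ≤ m j) {C : ℝ} (hC : 1 ≤ C) {w : Fin n → Fin n → k}
    (hw : ∀ i a : Fin n, av (w i a) ≤ X a * (C * m (min a i))) {I a : SubIndex p n}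
    (hI : I ≠ SubIndex.top h) :
    av (Matrix.of fun s t => w (I.1 s) (a.1 t)).det ≤
      Real.exp (minorExponent h X m a + Real.log (p.factorial * C ^ p)) := by
  classical
  have hC0 : 0 < C := by linarith
  have hmt : ∀ t, 0 < m (a.1 t) := fun t => hm0 _ (a.1 t).2
  have hb : ∀ s : Equiv.Perm (Fin p),
      ∏ t, av ((Matrix.of fun s t => w (I.1 s) (a.1 t)) (s t) t) ≤
        C ^ p * ∏ t, (X (a.1 t) * m (a.1 t)) := by
    intro s
    calc _ ≤ ∏ t, C * (X (a.1 t) * m (a.1 t)) := by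
          refine Finset.prod_le_prod (fun t _ => apply_nonneg av _) fun t _ => ?_
          have h1 := hm _ _ (min_le_left (a.1 t : ℕ) (I.1 (s t) : ℕ)) (a.1 t).2
          have h2 := hw (I.1 (s t)) (a.1 t)
          have h3 := mul_le_mul_of_nonneg_left h1 (mul_pos hC0 (hX (a.1 t))).le
          simp only [Matrix.of_apply]
          linarith
      _ = _ := by rw [Finset.prod_mul_distrib, Finset.prod_const, Finset.card_univ, Fintype.card_fin]
  have hexp : Real.exp (∑ t, (Real.log (X (a.1 t)) + Real.log (m (a.1 t)))) =
      ∏ t, (X (a.1 t) * m (a.1 t)) := by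
    rw [Real.exp_sum]
    refine Finset.prod_congr rfl fun t _ => ?_
    rw [Real.exp_add, Real.exp_log (hX _), Real.exp_log (hmt t)]
  have hfac : 0 < (p.factorial : ℝ) * C ^ p :=
    mul_pos (Nat.cast_pos.mpr p.factorial_pos) (pow_pos hC0 p)
  rw [Real.exp_add, Real.exp_log hfac, minorExponent, Real.exp_sub, hexp]
  by_cases ha : a = SubIndex.top h
  · have hml : 0 < m l := hm0 l (by omega)
    have hml' : 0 < m (l - 1) := hm0 (l - 1) (by omega)
    rw [if_pos ha, Real.exp_sub, Real.exp_log hml, Real.exp_log hml']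
    obtain ⟨t₀, ht₀⟩ := SubIndex.exists_lt_of_ne_top h hI
    have hb' : ∀ s : Equiv.Perm (Fin p),
        ∏ t, av ((Matrix.of fun s t => w (I.1 s) (a.1 t)) (s t) t) ≤
          C ^ p * ((∏ t, (X (a.1 t) * m (a.1 t))) / (m l / m (l - 1))) := by
      intro s
      have hal : ∀ t, l ≤ a.1 t := fun t => by rw [ha]; exact Nat.le_add_right _ _
      have hfactor : ∀ t ∈ Finset.univ, av ((Matrix.of fun s t => w (I.1 s) (a.1 t)) (s t) t) ≤
          C * (X (a.1 t) * m (a.1 t)) * if t = s.symm t₀ then (m l / m (l - 1))⁻¹ else 1 := by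
        intro t _
        have h2 := hw (I.1 (s t)) (a.1 t)
        simp only [Matrix.of_apply]
        refine h2.trans ?_
        rw [mul_left_comm, mul_assoc, mul_assoc]
        refine mul_le_mul_of_nonneg_left (mul_le_mul_of_nonneg_left ?_ (hX _).le) hC0.le
        split_ifs with hts
        · rw [hts, Equiv.apply_symm_apply, inv_div, ← mul_div_assoc, le_div_iff₀ hml]
          have h4 := hm (min (a.1 (s.symm t₀) : ℕ) (I.1 t₀ : ℕ)) (l - 1)
            ((min_le_right _ _).trans (by omega)) (by omega)
          have h5 := hm l (a.1 (s.symm t₀)) (hal _) (a.1 _).2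
          rw [mul_comm (m (a.1 (s.symm t₀)))]
          exact mul_le_mul h4 h5 hml.le hml'.le
        · rw [mul_one]
          exact hm _ _ (min_le_left _ _) (a.1 t).2
      refine (Finset.prod_le_prod (fun t _ => apply_nonneg av _) hfactor).trans_eq ?_
      rw [Finset.prod_mul_distrib, Finset.prod_mul_distrib, Finset.prod_const, Finset.card_univ,
        Fintype.card_fin, Finset.prod_ite_eq' Finset.univ, if_pos (Finset.mem_univ _),
        mul_assoc, div_eq_mul_inv (∏ t, (X (a.1 t) * m (a.1 t)))]
    refine (av.det_le_of_forall_perm _ hb').trans_eq (by ring)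
  · rw [if_neg ha, Real.exp_zero, div_one]
    refine (av.det_le_of_forall_perm _ hb).trans_eq (by ring)

/-- A common kernel vector of the minors avoiding a row yields a linear relation for the entries
of this row. -/
theorem exists_relation_of_compound {q n : ℕ} {ξ : SubIndex (q + 1) n → k} (hξ : ξ ≠ 0) :
    ∃ c : Fin n → k, c ≠ 0 ∧ ∀ (Y : Matrix (Fin n) (Fin n) k) (o : Fin n) (T : SubIndex (q + 1) n),
      Y.det ≠ 0 → (∀ t, T.1 t ≠ o) → (∀ I ≠ T, ∑ K, Y.compound (q + 1) I K * ξ K = 0) →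
        ∑ b, c b * Y o b = 0 := by
  classical
  obtain ⟨K₀, hK₀⟩ := Function.ne_iff.mp hξ
  obtain ⟨B, hB⟩ : ∃ B : Matrix (Fin (q + 1)) (Fin n) k,
    B = (1 : Matrix (Fin n) (Fin n) k).submatrix K₀.1 id := ⟨_, rfl⟩
  obtain ⟨L, hL⟩ : ∃ L : (Fin n → k) →ₗ[k] k, ∀ w,
      L w = ∑ K : SubIndex (q + 1) n, ξ K * ((B.updateRow 0 w).submatrix id K.1).det := by
    refine ⟨∑ K : SubIndex (q + 1) n, ξ K •
      (((Matrix.detRowAlternating (R := k) (n := Fin (q + 1))).toMultilinearMap.toLinearMap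
        (B.submatrix id K.1) 0) ∘ₗ LinearMap.funLeft k k K.1), fun w => ?_⟩
    rw [LinearMap.sum_apply]
    refine Finset.sum_congr rfl fun K _ => ?_
    rw [LinearMap.smul_apply, smul_eq_mul]
    congr 1
    have h1 : (B.updateRow 0 w).submatrix id K.1 =
        (B.submatrix id K.1).updateRow 0 (w ∘ K.1) := by
      ext i j
      by_cases hi : i = 0
      · subst hi
        simp
      · simp [hi]
    rw [h1]
    rfl
  have hLsum : ∀ w, L w = ∑ b, L (Pi.single b 1) * w b := by
    intro w
    rw [LinearMap.pi_apply_eq_sum_univ L w]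
    refine Finset.sum_congr rfl fun b _ => ?_
    rw [smul_eq_mul, mul_comm]
    congr 2
    ext i
    simp [Pi.single_apply, eq_comm]
  refine ⟨fun b => L (Pi.single b 1), fun h0 => ?_, fun Y o T hY hT hker => ?_⟩
  · have h1 : L (Pi.single (K₀.1 0) 1) = ξ K₀ := by
      have h2 : B.updateRow 0 (Pi.single (K₀.1 0) 1) = B := by
        rw [← Matrix.updateRow_eq_self B 0, Matrix.updateRow_idem]
        congr 1
        ext b
        simp [hB, Matrix.one_apply, Pi.single_apply, eq_comm]
      have h3 : ∀ K : SubIndex (q + 1) n, (B.submatrix id K.1).det =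
          (1 : Matrix (SubIndex (q + 1) n) (SubIndex (q + 1) n) k) K₀ K := by
        intro K
        rw [← Matrix.compound_one, hB]
        rfl
      rw [hL, h2]
      simp [h3, Matrix.one_apply]
    exact hK₀ (h1 ▸ congrFun h0 (K₀.1 0))
  · rw [← hLsum (Y o), hL]
    have hYu : IsUnit Y.det := isUnit_iff_ne_zero.mpr hY
    obtain ⟨A, hA⟩ : ∃ A, A = B.updateRow 0 (Y o) * Y⁻¹ := ⟨_, rfl⟩
    have hAY : B.updateRow 0 (Y o) = A * Y := by
      rw [hA, Matrix.mul_assoc, Matrix.nonsing_inv_mul Y hYu, Matrix.mul_one]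
    have hA0 : ∀ j, A 0 j = (1 : Matrix (Fin n) (Fin n) k) o j := by
      intro j
      rw [hA, Matrix.mul_apply, ← Matrix.mul_nonsing_inv Y hYu, Matrix.mul_apply]
      simp
    have h1 : ∀ K : SubIndex (q + 1) n, ((B.updateRow 0 (Y o)).submatrix id K.1).det =
        ∑ I : SubIndex (q + 1) n, (A.submatrix id I.1).det * Y.compound (q + 1) I K := by
      intro K
      rw [hAY]
      exact Matrix.det_mul_eq_sum_subIndex A (Y.submatrix id K.1)
    simp only [h1, Finset.mul_sum]
    rw [Finset.sum_comm]
    refine Finset.sum_eq_zero fun I _ => ?_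
    have h2 : ∑ K, ξ K * ((A.submatrix id I.1).det * Y.compound (q + 1) I K) =
        (A.submatrix id I.1).det * ∑ K, Y.compound (q + 1) I K * ξ K := by
      rw [Finset.mul_sum]
      exact Finset.sum_congr rfl fun K _ => by ring
    rw [h2]
    by_cases hI : I = T
    · rw [Matrix.det_eq_zero_of_row_eq_zero 0 fun t => ?_, zero_mul]
      rw [Matrix.submatrix_apply, id, hA0, hI, Matrix.one_apply_ne (hT t).symm]
    · rw [hker I hI, mul_zero]

end Minors

section Relation

open Module NumberField

theorem Matrix.det_compound_ne_zero {k : Type*} [Field k] {n : ℕ} (p : ℕ)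
    {Y : Matrix (Fin n) (Fin n) k} (hY : Y.det ≠ 0) : (Y.compound p).det ≠ 0 := by
  classical
  have h : Y.compound p * (Y⁻¹).compound p = 1 := by
    rw [← Matrix.compound_mul, Matrix.mul_nonsing_inv Y (isUnit_iff_ne_zero.mpr hY),
      Matrix.compound_one]
  exact fun h0 => by simpa [h0] using congrArg Matrix.det h

theorem Subring.det_mem {A : Type*} [CommRing A] (R : Subring A) {p : ℕ}
    {D : Matrix (Fin p) (Fin p) A} (h : ∀ s t, D s t ∈ R) : D.det ∈ R := by
  rw [Matrix.det_apply']
  exact R.sum_mem fun s _ => R.mul_mem (intCast_mem R _) (R.prod_mem fun t _ => h _ _)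

variable {k : Type*} [Field k] {n : ℕ}

/-- The matrix of the products of the coordinates of a solution and of its relations. -/
def relationMatrix (x : Fin (n + 1) → k) (z : ℕ → Fin (n + 1) → k) : Matrix (Fin n) (Fin n) k :=
  Matrix.of fun l b => x b.castSucc * z l b.castSucc

theorem sum_compound_selectionMatrix_mul {x : Fin (n + 1) → k} {z : ℕ → Fin (n + 1) → k}
    (hz : ∀ l < n, ∑ i, x i * z l i = 0) (π : Fin n → Fin (n + 1)) {p : ℕ} (I a : SubIndex p n) :
    ∑ J, ((selectionMatrix π).compound p a J : k) * (relationMatrix x z).compound p I J =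
      (Matrix.of fun s t => x (π (a.1 t)) * z (I.1 s) (π (a.1 t))).det := by
  obtain ⟨N, hN⟩ : ∃ N : Matrix (Fin n) (Fin n) k, N = (selectionMatrix π).map (Int.cast) :=
    ⟨_, rfl⟩
  have h1 : ∀ J : SubIndex p n, ((selectionMatrix π).compound p a J : k) =
      ((N.submatrix a.1 id).submatrix id J.1).det := by
    intro J
    rw [Matrix.compound, Matrix.of_apply, Int.cast_det, hN]
    rfl
  have h2 : ∀ J : SubIndex p n, (relationMatrix x z).compound p I J =
      ((((relationMatrix x z).submatrix I.1 id).transpose).submatrix J.1 id).det := by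
    intro J
    rw [Matrix.compound, Matrix.of_apply, ← Matrix.det_transpose]
    rfl
  simp only [h1, h2]
  rw [← Matrix.det_mul_eq_sum_subIndex, ← Matrix.det_transpose]
  congr 1
  ext s t
  rw [Matrix.transpose_apply, Matrix.mul_apply, Matrix.of_apply,
    ← sum_selectionMatrix_mul π (hz (I.1 s) (I.1 s).2) (a.1 t)]
  exact Finset.sum_congr rfl fun b _ => by rw [hN]; rfl

variable [NumberField k] {S : Finset (FinitePlace k)} {C : ℝ} {x : Fin (n + 1) → k}
  {z : ℕ → Fin (n + 1) → k} {μ : ℕ → ℝ} {i₀ : PlaceIndex S → Fin (n + 1)}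
  {π : PlaceIndex S → Fin n → Fin (n + 1)}

theorem IsReducedSystem.one_le (hr : IsReducedSystem S C x z μ i₀ π) {i : ℕ} (hi : i < n) :
    1 ≤ μ i :=
  hr.weight_zero ▸ hr.weight_mono 0 i (Nat.zero_le i) hi

theorem IsReducedSystem.one_le_placeWeight (hr : IsReducedSystem S C x z μ i₀ π)
    (v : PlaceIndex S) {i : ℕ} (hi : i < n) : 1 ≤ placeWeight S μ v i := by
  rcases v with φ | w
  · exact hr.one_le hi
  · exact le_rfl

theorem IsReducedSystem.placeWeight_mono (hr : IsReducedSystem S C x z μ i₀ π)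
    (v : PlaceIndex S) {i j : ℕ} (hij : i ≤ j) (hj : j < n) :
    placeWeight S μ v i ≤ placeWeight S μ v j := by
  rcases v with φ | w
  · exact hr.weight_mono i j hij hj
  · exact le_rfl

theorem IsReducedSystem.det_relationMatrix_ne_zero (hr : IsReducedSystem S C x z μ i₀ π)
    (hx : IsSUnitSol S x) : (relationMatrix x z).det ≠ 0 := by
  have h1 : relationMatrix x z = (Matrix.of fun (l : Fin n) (i : Fin n) => z l i.castSucc) *
      Matrix.diagonal fun i : Fin n => x i.castSucc := by
    ext l b
    rw [Matrix.mul_diagonal, mul_comm]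
    rfl
  rw [h1, Matrix.det_mul, Matrix.det_diagonal]
  exact mul_ne_zero hr.det_ne_zero (Finset.prod_ne_zero_iff.mpr fun i _ => (hx.unit _).1)

theorem IsReducedSystem.isApproxBasis (hr : IsReducedSystem S C x z μ i₀ π) (hC : 1 ≤ C)
    (hx : IsSUnitSol S x) {p l : ℕ} (h : l + p = n) (hp : 0 < p) (hl : 0 < l)
    {e : SubIndex p n → PlaceIndex S → ℝ} {H : ℝ}
    (he : ∀ a v, minorExponent h (fun b => placeAbs S v (x (π v b))) (placeWeight S μ v) a +
      Real.log (p.factorial * C ^ p) ≤ H * e a v) [DecidableEq (SubIndex p n)] :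
    IsApproxBasis (sIntegers S) (placeAbs S) (fun v => (selectionMatrix (π v)).compound p) e
      (SubIndex.top h) ((relationMatrix x z).compound p) H where
  det_ne_zero := by
    convert Matrix.det_compound_ne_zero p (hr.det_relationMatrix_ne_zero hx)
  mem I _ J := by
    refine (sIntegers S).det_mem fun s t => ?_
    exact (sIntegers S).mul_mem (hx.unit _).mem_sIntegers
      (mem_sIntegers_of_isIntegral S ((hr.rel _ (I.1 s).2).1 _))
  le v I hI a := by
    rw [sum_compound_selectionMatrix_mul fun l hl => (hr.rel l hl).2]
    refine le_trans (det_le_exp_minorExponent h hp hl (placeAbs S v)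
      (X := fun b => placeAbs S v (x (π v b))) (fun b => (placeAbs S v).pos (hx.unit _).1)
      (m := placeWeight S μ v) (fun i hi => zero_lt_one.trans_le (hr.one_le_placeWeight v hi))
      (fun i j hij hj => hr.placeWeight_mono v hij hj) hC
      (w := fun i a => x (π v a) * z i (π v a)) (fun i a => ?_) hI)
      (Real.exp_le_exp.mpr (he a v))
    rw [map_mul]
    exact mul_le_mul_of_nonneg_left (hr.le i i.2 v a) (apply_nonneg _ _)

theorem IsSUnitSol.log_totalHeight (hx : IsSUnitSol S x) :
    Real.log (totalHeight S x) = ∑ v, Real.log (localHeight S v x) :=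
  Real.log_prod fun v _ => (zero_lt_one.trans_le (hx.one_le_localHeight v)).ne'

theorem IsSUnit.sum_log_eq_zero {y : k} (hy : IsSUnit S y) :
    ∑ v, Real.log (placeAbs S v y) = 0 := by
  rw [← Real.log_prod fun v _ => ((placeAbs S v).pos hy.1).ne', prod_placeAbs_eq_one hy,
    Real.log_one]

theorem IsSUnitSol.abs_log_le (hx : IsSUnitSol S x) (v : PlaceIndex S) (i : Fin (n + 1)) :
    |Real.log (placeAbs S v (x i))| ≤ Real.log (totalHeight S x) := by
  classical
  have h1 : ∀ w, Real.log (placeAbs S w (x i)) ≤ Real.log (localHeight S w x) := fun w =>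
    Real.log_le_log ((placeAbs S w).pos (hx.unit i).1) (placeAbs_le_localHeight S w x i)
  have h2 : ∀ w, 0 ≤ Real.log (localHeight S w x) := fun w =>
    Real.log_nonneg (hx.one_le_localHeight w)
  have h3 := Finset.add_sum_erase Finset.univ (fun w => Real.log (placeAbs S w (x i)))
    (Finset.mem_univ v)
  have h4 := Finset.add_sum_erase Finset.univ (fun w => Real.log (localHeight S w x))
    (Finset.mem_univ v)
  have h5 := Finset.sum_le_sum fun w (_ : w ∈ Finset.univ.erase v) => h1 w
  have h6 := Finset.sum_nonneg fun w (_ : w ∈ Finset.univ.erase v) => h2 w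
  rw [(hx.unit i).sum_log_eq_zero] at h3
  rw [← hx.log_totalHeight] at h4
  rw [abs_le]
  constructor
  · linarith [h2 v]
  · linarith [h1 v]

theorem IsReducedSystem.sum_log_weight_le (hr : IsReducedSystem S C x z μ i₀ π) (hC : 1 ≤ C)
    (hx : IsSUnitSol S x) :
    finrank ℚ k * ∑ i ∈ Finset.range n, Real.log (μ i) ≤
      Real.log C + Real.log (totalHeight S x) := by
  have hpos : ∀ i ∈ Finset.range n, 0 < μ i ^ finrank ℚ k := fun i hi =>
    pow_pos (zero_lt_one.trans_le (hr.one_le (Finset.mem_range.mp hi))) _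
  have h := Real.log_le_log (Finset.prod_pos hpos) hr.prod_le
  rw [Real.log_mul (by linarith) (zero_lt_one.trans_le hx.one_le_totalHeight).ne',
    Real.log_prod fun i hi => (hpos i hi).ne'] at h
  simpa only [Real.log_pow, ← Finset.mul_sum] using h

theorem IsReducedSystem.log_placeWeight_le (hr : IsReducedSystem S C x z μ i₀ π) (hC : 1 ≤ C)
    (hx : IsSUnitSol S x) (v : PlaceIndex S) {i : ℕ} (hi : i < n) :
    Real.log (placeWeight S μ v i) ≤ Real.log C + Real.log (totalHeight S x) := by
  rcases v with φ | w
  · refine le_trans ?_ (hr.sum_log_weight_le hC hx)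
    have h1 : ∀ j ∈ Finset.range n, 0 ≤ Real.log (μ j) := fun j hj =>
      Real.log_nonneg (hr.one_le (Finset.mem_range.mp hj))
    have h2 := Finset.single_le_sum h1 (Finset.mem_range.mpr hi)
    have h3 : (1 : ℝ) ≤ finrank ℚ k := by exact_mod_cast finrank_pos (R := ℚ) (M := k)
    rw [placeWeight_inl]
    nlinarith [Finset.sum_nonneg h1]
  · rw [placeWeight_inr, Real.log_one]
    exact add_nonneg (Real.log_nonneg hC) (Real.log_nonneg hx.one_le_totalHeight)

theorem IsReducedSystem.abs_minorExponent_le (hr : IsReducedSystem S C x z μ i₀ π) (hC : 1 ≤ C)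
    (hx : IsSUnitSol S x) {p l : ℕ} (h : l + p = n) (hp : 0 < p) (v : PlaceIndex S)
    (a : SubIndex p n) :
    |minorExponent h (fun b => placeAbs S v (x (π v b))) (placeWeight S μ v) a| ≤
      (2 * p + 1) * (1 + Real.log C) + (2 * p + 1) * (1 + Real.log C) *
        Real.log (totalHeight S x) := by
  classical
  have hC0 := Real.log_nonneg hC
  have hH0 := Real.log_nonneg hx.one_le_totalHeight
  have h0 : ∀ i < n, 0 ≤ Real.log (placeWeight S μ v i) := fun i hi =>
    Real.log_nonneg (hr.one_le_placeWeight v hi)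
  have h1 : |∑ t, (Real.log (placeAbs S v (x (π v (a.1 t)))) +
      Real.log (placeWeight S μ v (a.1 t)))| ≤
      p * (Real.log C + 2 * Real.log (totalHeight S x)) := by
    refine (Finset.abs_sum_le_sum_abs _ _).trans ((Finset.sum_le_card_nsmul _ _
      (Real.log C + 2 * Real.log (totalHeight S x)) fun t _ => ?_).trans_eq ?_)
    · refine (abs_add_le _ _).trans ?_
      rw [abs_of_nonneg (h0 _ (a.1 t).2)]
      linarith [hx.abs_log_le v (π v (a.1 t)), hr.log_placeWeight_le hC hx v (a.1 t).2]
    · rw [Finset.card_univ, Fintype.card_fin, nsmul_eq_mul]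
  have h2 : |if a = SubIndex.top h then Real.log (placeWeight S μ v l) -
      Real.log (placeWeight S μ v (l - 1)) else 0| ≤
      Real.log C + Real.log (totalHeight S x) := by
    split_ifs with ha
    · have h3 := hr.log_placeWeight_le hC hx v (i := l) (by omega)
      have h4 := h0 (l - 1) (by omega)
      have h5 := Real.log_le_log (zero_lt_one.trans_le (hr.one_le_placeWeight v (by omega)))
        (hr.placeWeight_mono v (Nat.sub_le l 1) (by omega))
      rw [abs_of_nonneg (by linarith)]
      linarith
    · rw [abs_zero]
      linarith
  refine (abs_sub _ _).trans ((add_le_add h1 h2).trans ?_)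
  have hp0 : (0 : ℝ) ≤ p := Nat.cast_nonneg p
  have h3 := mul_nonneg hp0 hC0
  have h4 := mul_nonneg hC0 hH0
  have h5 := mul_nonneg h3 hH0
  nlinarith

theorem IsReducedSystem.sum_log_placeAbs (hr : IsReducedSystem S C x z μ i₀ π)
    (hx : IsSUnitSol S x) :
    ∑ v, ∑ a, Real.log (placeAbs S v (x (π v a))) = -Real.log (totalHeight S x) := by
  classical
  have h1 : ∀ v, ∑ a, Real.log (placeAbs S v (x (π v a))) =
      ∑ i, Real.log (placeAbs S v (x i)) - Real.log (localHeight S v x) := by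
    intro v
    have h2 : Finset.univ.image (π v) = Finset.univ.erase (i₀ v) := by
      refine Finset.eq_of_subset_of_card_le (fun i hi => ?_) ?_
      · obtain ⟨a, -, rfl⟩ := Finset.mem_image.mp hi
        exact Finset.mem_erase.mpr ⟨hr.ne v a, Finset.mem_univ _⟩
      · rw [Finset.card_image_of_injective _ (hr.injective v),
          Finset.card_erase_of_mem (Finset.mem_univ _)]
        simp
    have h3 := Finset.add_sum_erase Finset.univ (fun i => Real.log (placeAbs S v (x i)))
      (Finset.mem_univ (i₀ v))
    rw [← h2, Finset.sum_image fun a _ b _ hab => hr.injective v hab] at h3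
    rw [hr.eq_localHeight, ← h3]
    ring
  simp only [h1]
  rw [Finset.sum_sub_distrib, Finset.sum_comm, ← hx.log_totalHeight,
    Finset.sum_eq_zero fun i _ => (hx.unit i).sum_log_eq_zero, zero_sub]

theorem sum_placeWeight (f : ℝ → ℝ) (hf : f 1 = 0) (i : ℕ) :
    ∑ v, f (placeWeight S μ v i) = finrank ℚ k * f (μ i) := by
  simp [Fintype.sum_sum_type, hf, Embeddings.card k ℂ]

theorem exists_sum_minorExponent_le (p n : ℕ) : ∃ κ : ℕ, ∀ {C : ℝ}, 1 ≤ C →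
    ∀ {x : Fin (n + 1) → k} {z : ℕ → Fin (n + 1) → k} {μ : ℕ → ℝ}
      {i₀ : PlaceIndex S → Fin (n + 1)} {π : PlaceIndex S → Fin n → Fin (n + 1)},
      IsReducedSystem S C x z μ i₀ π → IsSUnitSol S x → ∀ {l : ℕ} (h : l + p = n),
        ∑ q : SubIndex p n × PlaceIndex S, minorExponent h
          (fun b => placeAbs S q.2 (x (π q.2 b))) (placeWeight S μ q.2) q.1 ≤
        κ * Real.log C - finrank ℚ k * (Real.log (μ l) - Real.log (μ (l - 1))) := by
  classical
  obtain ⟨κ, hκ⟩ := exists_sum_subIndex p n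
  refine ⟨κ, fun {C} hC {x z μ i₀ π} hr hx {l} h => ?_⟩
  rw [Fintype.sum_prod_type_right]
  simp only [minorExponent]
  have h1 : ∀ v : PlaceIndex S, ∑ a : SubIndex p n, (∑ t,
      (Real.log (placeAbs S v (x (π v (a.1 t)))) + Real.log (placeWeight S μ v (a.1 t))) -
      if a = SubIndex.top h then Real.log (placeWeight S μ v l) -
        Real.log (placeWeight S μ v (l - 1)) else 0) =
      κ * (∑ a, Real.log (placeAbs S v (x (π v a))) +
        ∑ a : Fin n, Real.log (placeWeight S μ v a)) -
        (Real.log (placeWeight S μ v l) - Real.log (placeWeight S μ v (l - 1))) := by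
    intro v
    rw [Finset.sum_sub_distrib, Finset.sum_ite_eq', if_pos (Finset.mem_univ _),
      ← Finset.sum_add_distrib, ← hκ]
  have h2 : ∑ v, ∑ a : Fin n, Real.log (placeWeight S μ v a) ≤
      Real.log C + Real.log (totalHeight S x) := by
    rw [Finset.sum_comm]
    simp only [sum_placeWeight Real.log Real.log_one]
    rw [← Finset.mul_sum, Fin.sum_univ_eq_sum_range (fun i => Real.log (μ i))]
    exact hr.sum_log_weight_le hC hx
  calc _ = ∑ v, (κ * (∑ a, Real.log (placeAbs S v (x (π v a))) +
        ∑ a : Fin n, Real.log (placeWeight S μ v a)) -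
        (Real.log (placeWeight S μ v l) - Real.log (placeWeight S μ v (l - 1)))) := by
        refine Finset.sum_congr rfl fun v _ => ?_
        rw [← h1 v]
    _ = κ * (-Real.log (totalHeight S x) + ∑ v, ∑ a : Fin n, Real.log (placeWeight S μ v a)) -
        (finrank ℚ k * Real.log (μ l) - finrank ℚ k * Real.log (μ (l - 1))) := by
        rw [Finset.sum_sub_distrib, ← Finset.mul_sum, Finset.sum_add_distrib,
          hr.sum_log_placeAbs hx, Finset.sum_sub_distrib, sum_placeWeight Real.log Real.log_one,
          sum_placeWeight Real.log Real.log_one]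
    _ ≤ _ := by
        have h3 : (κ : ℝ) * (-Real.log (totalHeight S x) +
            ∑ v, ∑ a : Fin n, Real.log (placeWeight S μ v a)) ≤ κ * Real.log C :=
          mul_le_mul_of_nonneg_left (by linarith) (Nat.cast_nonneg κ)
        linarith

end Relation

section LinearRelation

open Module NumberField

variable {k : Type*} [Field k] [NumberField k]

/-- Infinitely many of the solutions of an `S`-unit equation satisfy a further linear equation. -/
theorem exists_linear_relation {n : ℕ} (hn : 1 < n) {S : Finset (FinitePlace k)}
    {𝒳 : Set (Fin (n + 1) → k)} (h𝒳 : 𝒳.Infinite) (hsol : ∀ x ∈ 𝒳, IsSUnitSol S x) :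
    ∃ c : Fin n → k, c ≠ 0 ∧ {x ∈ 𝒳 | ∑ i, c i * x i.castSucc = 0}.Infinite := by
  classical
  obtain ⟨C, hC, hex⟩ := exists_isReducedSystem k n (by omega)
  have hC0 := Real.log_nonneg hC
  choose z μ i₀ π hr using fun j : 𝒳 => hex S j.1 (hsol j.1 j.2)
  obtain ⟨H, hH⟩ : ∃ H : 𝒳 → ℝ, H = fun j => Real.log (totalHeight S j.1) := ⟨_, rfl⟩
  have hgap : ∀ j : 𝒳, ∃ l : Fin n, 0 < (l : ℕ) ∧ H j ≤ finrank ℚ k * Real.log C +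
      n ^ 2 * (finrank ℚ k * (Real.log (μ j l) - Real.log (μ j (l - 1)))) := by
    intro j
    obtain ⟨l, hl0, hln, hl⟩ := exists_gap hn (hr j).weight_zero (hr j).weight_mono hC
      (hsol j.1 j.2).one_le_totalHeight (hr j).height_le
    exact ⟨⟨l, hln⟩, hl0, by rw [hH]; exact hl⟩
  choose l hl0 hl using hgap
  have huniv : (Set.univ : Set 𝒳).Infinite := by
    have := h𝒳.to_subtype
    exact Set.infinite_univ
  obtain ⟨⟨l₀, π₀⟩, -, hT⟩ := huniv.exists_infinite_fiber
    (f := fun j => ((l j, π j) : Fin n × (PlaceIndex S → Fin n → Fin (n + 1))))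
    Set.finite_univ (Set.mapsTo_univ _ _)
  obtain ⟨T, hTdef⟩ : ∃ T : Set 𝒳, T = {j | j ∈ Set.univ ∧ (l j, π j) = (l₀, π₀)} := ⟨_, rfl⟩
  rw [← hTdef] at hT
  have hTl : ∀ j ∈ T, l j = l₀ := fun j hj => by
    rw [hTdef] at hj
    exact congrArg Prod.fst hj.2
  have hTπ : ∀ j ∈ T, π j = π₀ := fun j hj => by
    rw [hTdef] at hj
    exact congrArg Prod.snd hj.2
  have hh : ∀ B : ℝ, {j | H j ≤ B}.Finite := by
    intro B
    refine Set.Finite.of_finite_image (f := Subtype.val)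
      ((finite_isSUnit_localHeight_le S (Real.exp B)).subset ?_) Subtype.val_injective.injOn
    rintro _ ⟨j, hj, rfl⟩
    have hs := hsol j.1 j.2
    refine ⟨hs.unit, hs.last, ?_⟩
    rw [hH] at hj
    exact (Real.log_le_iff_le_exp (zero_lt_one.trans_le hs.one_le_totalHeight)).mp hj
  obtain ⟨q, hq⟩ : ∃ q, (l₀ : ℕ) + (q + 1) = n := ⟨n - l₀ - 1, by omega⟩
  obtain ⟨E, hE⟩ : ∃ E : 𝒳 → SubIndex (q + 1) n × PlaceIndex S → ℝ, E = fun j r =>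
    minorExponent hq (fun b => placeAbs S r.2 (j.1 (π j r.2 b))) (placeWeight S (μ j) r.2) r.1 :=
    ⟨_, rfl⟩
  obtain ⟨κ, hκ⟩ := exists_sum_minorExponent_le (k := k) (S := S) (q + 1) n
  have hn2 : (0 : ℝ) < n ^ 2 := by
    have : (0 : ℝ) < n := Nat.cast_pos.mpr (by omega)
    positivity
  obtain ⟨e, he, hTe⟩ := exists_common_exponents hT hh (E := E)
    (K := (2 * (q + 1 : ℕ) + 1) * (1 + Real.log C)) (γ := 1 / n ^ 2)
    (C := κ * Real.log C + finrank ℚ k * Real.log C / n ^ 2)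
    (b := Real.log ((q + 1).factorial * C ^ (q + 1))) (by positivity)
    (fun j _ a => by
      rw [hE, hH]
      exact (hr j).abs_minorExponent_le hC (hsol j.1 j.2) hq (Nat.succ_pos q) a.2 a.1)
    (fun j hj => by
      have h1 := hκ hC (hr j) (hsol j.1 j.2) hq
      have h2 := hl j
      rw [hTl j hj, ← sub_le_iff_le_add', ← div_le_iff₀' hn2] at h2
      rw [hE]
      refine h1.trans ?_
      rw [sub_div] at h2
      rw [one_div_mul_eq_div]
      linarith)
  choose M' hM' using fun v => exists_mul_selectionMatrix_eq_one ((hr hT.nonempty.some).injective v)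
  rw [hTπ _ hT.nonempty.some_mem] at hM'
  obtain ⟨ξ, hξ, hinf⟩ := exists_common_kernel (sIntegers S) (placeAbs S)
    (fun x hx hx0 => one_le_prod_placeAbs hx hx0) (fun x hx => mem_sIntegers_of_isIntegral S hx)
    (fun x hx A hA h v => placeAbs_le_of_isIntegral S hx hA h v)
    (M := fun v => (selectionMatrix (π₀ v)).compound (q + 1))
    (M' := fun v => (M' v).compound (q + 1))
    (fun v => by
      rw [← Matrix.compound_mul, hM' v, Matrix.compound_one])
    (fun a v => e (a, v)) (by rw [← Fintype.sum_prod_type_right]; exact he)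
    (SubIndex.top hq) hTe hh
    (Y := fun j => (relationMatrix j.1 (z j)).compound (q + 1))
    (fun j hj => by
      have h1 := (hr j).isApproxBasis hC (hsol j.1 j.2) hq (Nat.succ_pos q) (hTl j hj.1 ▸ hl0 j)
        (e := fun a v => e (a, v)) (H := H j) (fun a v => by
          have := hj.2 (a, v)
          rw [hE] at this
          exact this)
      rwa [hTπ j hj.1] at h1)
  obtain ⟨c, hc, hrel⟩ := exists_relation_of_compound hξ
  refine ⟨c, hc, (hinf.image Subtype.val_injective.injOn).mono ?_⟩
  rintro _ ⟨j, ⟨hj, hjξ⟩, rfl⟩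
  refine ⟨j.2, ?_⟩
  have h2 := hrel (relationMatrix j.1 (z j)) ⟨0, by omega⟩ (SubIndex.top hq)
    ((hr j).det_relationMatrix_ne_zero (hsol j.1 j.2)) (fun t ht => by
    have := congrArg Fin.val ht
    simp only [SubIndex.top] at this
    have := hl0 j
    rw [hTl j hj.1] at this
    omega) hjξ
  rw [← h2]
  refine Finset.sum_congr rfl fun b _ => ?_
  simp [relationMatrix, (hr j).zero]

end LinearRelation

section UnitSolutions

open Module NumberField

variable {k : Type*} [Field k] [NumberField k]

theorem IsSUnit.mul {S : Finset (FinitePlace k)} {x y : k} (hx : IsSUnit S x)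
    (hy : IsSUnit S y) : IsSUnit S (x * y) :=
  ⟨mul_ne_zero hx.1 hy.1, fun w hw => by rw [map_mul, hx.2 w hw, hy.2 w hw, one_mul]⟩

theorem IsSUnit.inv {S : Finset (FinitePlace k)} {x : k} (hx : IsSUnit S x) : IsSUnit S x⁻¹ :=
  ⟨inv_ne_zero hx.1, fun w hw => by rw [map_inv₀, hx.2 w hw, inv_one]⟩

theorem IsSUnit.mono {S S' : Finset (FinitePlace k)} (hS : S ⊆ S') {x : k} (hx : IsSUnit S x) :
    IsSUnit S' x :=
  ⟨hx.1, fun w hw => hx.2 w fun h => hw (hS h)⟩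

theorem exists_subset_isSUnit (S : Finset (FinitePlace k)) {ι : Type*} [Fintype ι] {a : ι → k}
    (ha : ∀ i, a i ≠ 0) : ∃ S', S ⊆ S' ∧ ∀ i, IsSUnit S' (a i) := by
  classical
  refine ⟨S ∪ Finset.univ.biUnion fun i =>
    (FinitePlace.hasFiniteMulSupport (ha i)).toFinset, Finset.subset_union_left, fun i =>
    ⟨ha i, fun w hw => ?_⟩⟩
  by_contra h
  refine hw (Finset.mem_union_right _ (Finset.mem_biUnion.mpr ⟨i, Finset.mem_univ i, ?_⟩))
  exact (Set.Finite.mem_toFinset _).mpr h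

/-- The nondegenerate solutions of the `S`-unit equation. -/
def unitSolutions (S : Finset (FinitePlace k)) (ι : Type*) [Fintype ι] : Set (ι → k) :=
  {x | (∀ i, IsSUnit S (x i)) ∧ ∑ i, x i = 1 ∧ ∀ I : Finset ι, I.Nonempty → ∑ i ∈ I, x i ≠ 0}

omit [NumberField k] in
/-- A sum with value `1` has a nondegenerate subsum with value `1`. -/
theorem exists_nondegenerate_subsum {ι : Type*} [Fintype ι] {x : ι → k} (hx : ∑ i, x i = 1) :
    ∃ I : Finset ι, ∑ i ∈ I, x i = 1 ∧ ∀ J ⊆ I, J.Nonempty → ∑ i ∈ J, x i ≠ 0 := by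
  classical
  obtain ⟨I, hI⟩ := (Set.toFinite {I : Finset ι | ∑ i ∈ I, x i = 1}).exists_minimal
    ⟨Finset.univ, hx⟩
  refine ⟨I, hI.prop, fun J hJ hJ0 h0 => ?_⟩
  have h1 := Finset.sum_sdiff hJ (f := x)
  rw [h0, add_zero] at h1
  have h2 : I ≤ I \ J := hI.le_of_le (h1.trans hI.prop) Finset.sdiff_subset
  obtain ⟨j, hj⟩ := hJ0
  exact (Finset.mem_sdiff.mp (h2 (hJ hj))).2 hj

theorem exists_linear_relation_unitSolutions {ι : Type*} [Fintype ι] (hι : 1 < Fintype.card ι)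
    {S : Finset (FinitePlace k)} {𝒴 : Set (ι → k)} (h𝒴 : 𝒴.Infinite)
    (hsub : 𝒴 ⊆ unitSolutions S ι) :
    ∃ c : ι → k, c ≠ 0 ∧ {x ∈ 𝒴 | ∑ i, c i * x i = 0}.Infinite := by
  obtain ⟨σ, hσ⟩ : ∃ σ : (ι → k) → Fin (Fintype.card ι + 1) → k, σ = fun x =>
    Fin.snoc (α := fun _ => k) (x ∘ (Fintype.equivFin ι).symm) (-1) := ⟨_, rfl⟩
  have hσc : ∀ x i, σ x (Fin.castSucc i) = x ((Fintype.equivFin ι).symm i) := fun x i => by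
    rw [hσ]
    exact Fin.snoc_castSucc (α := fun _ => k) _ _ _
  have hσl : ∀ x, σ x (Fin.last _) = -1 := fun x => by
    rw [hσ]
    exact Fin.snoc_last (α := fun _ => k) _ _
  have hinj : Function.Injective σ := by
    intro x y h
    ext i
    have := congrFun h (Fin.castSucc (Fintype.equivFin ι i))
    simpa [hσc] using this
  obtain ⟨c, hc, hinf⟩ := exists_linear_relation hι (h𝒴.image hinj.injOn) (S := S) (by
    rintro _ ⟨x, hx, rfl⟩
    obtain ⟨h1, h2, -⟩ := hsub hx
    refine ⟨fun i => ?_, hσl x, ?_⟩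
    · induction i using Fin.lastCases with
      | last =>
        rw [hσl]
        exact ⟨by simp, fun w _ => by
          have : w (-1) = 1 := by
            rw [← w.norm_embedding_eq, map_neg, map_one, norm_neg, norm_one]
          exact this⟩
      | cast i =>
        rw [hσc]
        exact h1 _
    · rw [Fin.sum_univ_castSucc, hσl]
      simp only [hσc]
      rw [(Fintype.equivFin ι).symm.sum_comp, h2, add_neg_cancel])
  refine ⟨c ∘ Fintype.equivFin ι, fun h => hc ?_, ?_⟩
  · ext i
    simpa using congrFun h ((Fintype.equivFin ι).symm i)
  · refine Set.Infinite.of_image σ (hinf.mono ?_)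
    rintro _ ⟨⟨x, hx, rfl⟩, h⟩
    refine ⟨x, ⟨hx, ?_⟩, rfl⟩
    rw [← h, ← (Fintype.equivFin ι).symm.sum_comp]
    simp [hσc]

/-- The unit equation has finitely many nondegenerate solutions. -/
theorem finite_unitSolutions (N : ℕ) : ∀ (ι : Type) [Fintype ι], Fintype.card ι = N →
    ∀ S : Finset (FinitePlace k), (unitSolutions S ι).Finite := by
  classical
  induction N using Nat.strong_induction_on with
  | _ N ih =>
  intro ι _ hN S
  by_contra hinf
  rcases Nat.lt_or_ge 1 (Fintype.card ι) with hι | hι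
  swap
  · refine hinf (Set.Subsingleton.finite fun x hx y hy => ?_)
    have := Fintype.card_le_one_iff_subsingleton.mp hι
    ext i
    have h1 := hx.2.1
    have h2 := hy.2.1
    rw [Fintype.sum_subsingleton _ i] at h1 h2
    rw [h1, h2]
  obtain ⟨c, hc, h𝒴⟩ := exists_linear_relation_unitSolutions hι (Set.not_finite.mp hinf) subset_rfl
  obtain ⟨p, hp⟩ := Function.ne_iff.mp hc
  obtain ⟨b, hb⟩ : ∃ b : ι → k, ∀ i, b i = 1 - c i / c p := ⟨_, fun _ => rfl⟩
  have hbp : b p = 0 := by rw [hb, div_self hp, sub_self]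
  have hb1 : ∀ x ∈ {x ∈ unitSolutions S ι | ∑ i, c i * x i = 0}, ∑ i, b i * x i = 1 := by
    rintro x ⟨hx, hcx⟩
    have h1 : ∑ i, b i * x i = ∑ i, x i - (∑ i, c i * x i) / c p := by
      rw [Finset.sum_div, ← Finset.sum_sub_distrib]
      refine Finset.sum_congr rfl fun i _ => ?_
      rw [hb]
      ring
    rw [h1, hx.2.1, hcx, zero_div, sub_zero]
  choose! F hF1 hF0 using fun x hx => exists_nondegenerate_subsum (hb1 x hx)
  obtain ⟨I, -, hI⟩ := h𝒴.exists_infinite_fiber (f := F) Set.finite_univ (Set.mapsTo_univ _ _)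
  obtain ⟨x₀, hx₀⟩ := hI.nonempty
  have hbI : ∀ i ∈ I, b i ≠ 0 := by
    intro i hi h0
    obtain ⟨hx, hFx⟩ := hx₀
    refine hF0 x₀ hx {i} (by rw [hFx]; exact Finset.singleton_subset_iff.mpr hi)
      (Finset.singleton_nonempty i) ?_
    rw [Finset.sum_singleton, h0, zero_mul]
  have hpI : p ∉ I := fun h => hbI p h hbp
  obtain ⟨i, hi⟩ : I.Nonempty := by
    rw [Finset.nonempty_iff_ne_empty]
    rintro rfl
    have := hF1 x₀ hx₀.1
    rw [hx₀.2, Finset.sum_empty] at this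
    exact zero_ne_one this
  obtain ⟨S', hS', hbS'⟩ := exists_subset_isSUnit S (a := fun i : I => b i) fun i => hbI i i.2
  have hcard : Fintype.card I < N := by
    rw [Fintype.card_coe, ← hN]
    exact Finset.card_lt_univ_of_notMem hpI
  obtain ⟨y, -, hy⟩ := hI.exists_infinite_fiber (f := fun x (i : I) => b i * x i)
    (ih _ hcard I rfl S') (by
      rintro x ⟨hx, hFx⟩
      refine ⟨fun i => (hbS' i).mul ((hx.1.1 i).mono hS'), ?_, fun J hJ => ?_⟩
      · rw [Finset.sum_coe_sort I fun i => b i * x i, ← hFx]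
        exact hF1 x hx
      · have h1 := hF0 x hx (J.map (Function.Embedding.subtype _)) (by
          rw [hFx]
          intro j hj
          obtain ⟨j', -, rfl⟩ := Finset.mem_map.mp hj
          exact j'.2) (hJ.map)
        rwa [Finset.sum_map] at h1)
  obtain ⟨w, hw⟩ : ∃ w, w = y ⟨i, hi⟩ / b i := ⟨_, rfl⟩
  have hxw : ∀ x : ι → k, (fun j : I => b j * x j) = y → x i = w := by
    rintro x rfl
    rw [hw]
    exact (mul_div_cancel_left₀ _ (hbI i hi)).symm
  have hrest : ∀ x ∈ unitSolutions S ι, x i = w → ∑ j : {j // j ≠ i}, x j = 1 - w := by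
    intro x hx hxi
    rw [← hx.2.1, ← hxi, ← Finset.add_sum_erase Finset.univ x (Finset.mem_univ i), add_sub_cancel_left]
    exact (Finset.sum_subtype _ (by simp) x).symm
  have hsubsum : ∀ x ∈ unitSolutions S ι, ∀ J : Finset {j // j ≠ i}, J.Nonempty →
      ∑ j ∈ J, x j ≠ 0 := by
    intro x hx J hJ
    have := hx.2.2 (J.map (Function.Embedding.subtype _)) hJ.map
    rwa [Finset.sum_map] at this
  have hw1 : 1 - w ≠ 0 := by
    obtain ⟨x, hx⟩ := hy.nonempty
    rw [← hrest x hx.1.1.1 (hxw x hx.2)]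
    refine hsubsum x hx.1.1.1 Finset.univ ?_
    exact ⟨⟨p, fun h => hpI (h ▸ hi)⟩, Finset.mem_univ _⟩
  obtain ⟨S'', hS'', hwS''⟩ := exists_subset_isSUnit S (a := fun _ : Unit => 1 - w) fun _ => hw1
  have hcard' : Fintype.card {j // j ≠ i} < N := by
    rw [← hN]
    exact Fintype.card_subtype_lt (x := i) (by simp)
  refine hy (Set.Finite.of_finite_image (f := fun x (j : {j // j ≠ i}) => (1 - w)⁻¹ * x j)
    ((ih _ hcard' _ rfl S'').subset ?_) ?_)
  · rintro _ ⟨x, ⟨⟨⟨hx, -⟩, -⟩, hxy⟩, rfl⟩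
    refine ⟨fun j => (hwS'' ()).inv.mul ((hx.1 j).mono hS''), ?_, fun J hJ => ?_⟩
    · rw [← Finset.mul_sum, hrest x hx (hxw x hxy), inv_mul_cancel₀ hw1]
    · rw [← Finset.mul_sum]
      exact mul_ne_zero (inv_ne_zero hw1) (hsubsum x hx J hJ)
  · rintro x ⟨-, hxy⟩ x' ⟨-, hxy'⟩ h
    ext j
    by_cases hj : j = i
    · rw [hj, hxw x hxy, hxw x' hxy']
    · exact mul_left_cancel₀ (inv_ne_zero hw1) (congrFun h ⟨j, hj⟩)

end UnitSolutions

/-- The `S`-unit lemma: let `k` be a number field, `n > 1`, and `Γ` a finitely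
generated subgroup of `k*`.  All but finitely many solutions
`(u₀, …, uₙ) ∈ Γ^{n+1}` of `u₀ + u₁ + ⋯ + uₙ = 1` lie in some diagonal hyperplane
`∑_{i ∈ I} uᵢ = 0` with `I ⊆ {0, …, n}` a proper subset with at least two
elements. -/
theorem stmt_18 (k : Type*) [Field k] [NumberField k]
    (n : ℕ) (hn : 1 < n) (Γ : Subgroup kˣ) (hΓ : Γ.FG) :
    {u : Fin (n + 1) → Γ |
        (∑ i, ((u i : kˣ) : k)) = 1 ∧
        ¬ ∃ I : Finset (Fin (n + 1)), 2 ≤ I.card ∧ I ≠ Finset.univ ∧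
          ∑ i ∈ I, ((u i : kˣ) : k) = 0}.Finite := by
  obtain ⟨S, hS⟩ := exists_isSUnit_of_fg hΓ
  refine Set.Finite.of_finite_image (f := fun u i => ((u i : kˣ) : k))
    ((finite_unitSolutions (k := k) _ (Fin (n + 1)) rfl S).subset ?_) ?_
  · rintro _ ⟨u, ⟨h1, h2⟩, rfl⟩
    refine ⟨fun i => hS _ (u i).2, h1, fun I hI h0 => ?_⟩
    rcases Nat.lt_or_ge 1 I.card with hc | hc
    · refine h2 ⟨I, hc, ?_, h0⟩
      rintro rfl
      exact one_ne_zero (h1.symm.trans h0)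
    · obtain ⟨i, rfl⟩ := Finset.card_eq_one.mp (le_antisymm hc hI.card_pos)
      rw [Finset.sum_singleton] at h0
      exact (u i : kˣ).ne_zero h0
  · intro u _ u' _ h
    ext i
    exact congrFun h i
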